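/- Let n ≥ 2 and 2 ≤ k ≤ n be integers and let α > 0, G ≥ 0, m > 0, M > 0, F > 0, D > 0 be real constants. Then there exist constants β > 0 and C > 0, depending only on n, k, α, G, m, M, F, D, with the following property: for every bounded domain Ω ⊂ ℝ^n with diam(Ω) ≤ D, every f ∈ C²(Ω̄ × ℝ × ℝ^n) with f ≥ m and with ‖f‖_{C²} ≤ F, and every u ∈ C⁴(Ω) ∩ C²(Ω̄) satisfying u = 0 on ∂Ω, λ(D²u(x)) ∈ Γ̃_k for all x ∈ Ω, σ_{k−1}(λ(D²u(x))) + α·σ_k(λ(D²u(x))) = f(x, u(x), Du(x)) in Ω, σ_k(λ(D²u(x))) ≥ −G in Ω, and ‖u‖_{C¹(Ω̄)} ≤ M, one has the Pogorelov type estimate (−u(x))^β · Δu(x) ≤ C for all x ∈ Ω. -/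

import Mathlib

open Finset

/-- The `j`-th elementary symmetric polynomial of `lam` restricted to the index set `A`,
with `σ_0 = 1` and `σ_j = 0` for `j < 0` or `j > |A|`. -/
noncomputable def esigma {n : ℕ} (A : Finset (Fin n)) (j : ℤ) (lam : Fin n → ℝ) : ℝ :=
  if 0 ≤ j then ∑ s ∈ A.powersetCard j.toNat, ∏ i ∈ s, lam i else 0

/-- The sum Hessian operator `S_j(λ) = σ_{j-1}(λ) + α σ_j(λ)` on the index set `A`. -/
noncomputable def Ssum {n : ℕ} (α : ℝ) (A : Finset (Fin n)) (j : ℤ) (lam : Fin n → ℝ) : ℝ :=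
  esigma A (j - 1) lam + α * esigma A j lam

/-- The Gårding cone `Γ_k`. -/
def Gamma (n k : ℕ) : Set (Fin n → ℝ) :=
  {lam | ∀ j : ℕ, 1 ≤ j → j ≤ k → 0 < esigma Finset.univ (j : ℤ) lam}

/-- The admissible cone `Γ̃_k = Γ_{k-1} ∩ {S_k > 0}`. -/
def GammaTilde (n k : ℕ) (α : ℝ) : Set (Fin n → ℝ) :=
  Gamma n (k - 1) ∩ {lam | 0 < Ssum α Finset.univ (k : ℤ) lam}

/-- The Hessian matrix `D²u(x)` of `u : ℝⁿ → ℝ`. -/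
noncomputable def hessianMat {n : ℕ} (u : EuclideanSpace ℝ (Fin n) → ℝ)
    (x : EuclideanSpace ℝ (Fin n)) : Matrix (Fin n) (Fin n) ℝ :=
  Matrix.of fun i j =>
    iteratedFDeriv ℝ 2 u x ![EuclideanSpace.single i 1, EuclideanSpace.single j 1]

/-- The gradient `Du(x)` of `u : ℝⁿ → ℝ`, as a vector in `ℝⁿ`. -/
noncomputable def gradVec {n : ℕ} (u : EuclideanSpace ℝ (Fin n) → ℝ)
    (x : EuclideanSpace ℝ (Fin n)) : EuclideanSpace ℝ (Fin n) :=
  (WithLp.equiv 2 (Fin n → ℝ)).symm fun i => fderiv ℝ u x (EuclideanSpace.single i 1)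

/-- The `j`-th elementary symmetric polynomial of the family `x` over the index set `S`. -/
noncomputable def es {ι : Type*} (x : ι → ℝ) (S : Finset ι) (j : ℕ) : ℝ :=
  ∑ s ∈ S.powersetCard j, ∏ i ∈ s, x i

section ElementarySymmetric

variable {ι : Type*} (x : ι → ℝ)

@[simp] lemma es_zero (S : Finset ι) : es x S 0 = 1 := by simp [es]

lemma es_empty_succ (j : ℕ) : es x ∅ (j + 1) = 0 := by
  rw [es, Finset.powersetCard_eq_empty.2 (by simp), Finset.sum_empty]

variable [DecidableEq ι]

lemma es_insert {S : Finset ι} {i : ι} (hi : i ∉ S) (j : ℕ) :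
    es x (insert i S) (j + 1) = es x S (j + 1) + x i * es x S j := by
  unfold es
  rw [Finset.powersetCard_succ_insert hi, Finset.sum_union, Finset.sum_image]
  · congr 1
    rw [Finset.mul_sum]
    refine Finset.sum_congr rfl fun s hs => ?_
    rw [Finset.prod_insert]
    exact fun h => hi ((Finset.mem_powersetCard.1 hs).1 h)
  · intro s hs t ht hst
    have h1 : i ∉ s := fun h => hi ((Finset.mem_powersetCard.1 hs).1 h)
    have h2 : i ∉ t := fun h => hi ((Finset.mem_powersetCard.1 ht).1 h)
    rw [← Finset.erase_insert h1, ← Finset.erase_insert h2]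
    exact congrArg (fun r => r.erase i) hst
  · rw [Finset.disjoint_left]
    intro s hs ht
    obtain ⟨t, -, rfl⟩ := Finset.mem_image.1 ht
    exact hi ((Finset.mem_powersetCard.1 hs).1 (Finset.mem_insert_self _ _))

lemma es_erase {S : Finset ι} {i : ι} (hi : i ∈ S) (j : ℕ) :
    es x S (j + 1) = es x (S.erase i) (j + 1) + x i * es x (S.erase i) j := by
  conv_lhs => rw [← Finset.insert_erase hi]
  exact es_insert x (Finset.notMem_erase i S) j

lemma es_eq_coeff (S : Finset ι) (j : ℕ) :
    es x S j = (∏ i ∈ S, (1 + Polynomial.C (x i) * Polynomial.X)).coeff j := by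
  induction S using Finset.induction_on generalizing j with
  | empty =>
    cases j with
    | zero => simp
    | succ j => simp [es_empty_succ, Polynomial.coeff_one]
  | insert i S hi ih =>
    rw [Finset.prod_insert hi, add_mul, one_mul, Polynomial.coeff_add, mul_assoc,
      Polynomial.coeff_C_mul, ← ih]
    cases j with
    | zero => simp
    | succ j => rw [es_insert x hi, Polynomial.coeff_X_mul, ← ih]

/-- Euler's identity for elementary symmetric polynomials. -/
lemma sum_mul_es_erase (S : Finset ι) (j : ℕ) :
    ∑ i ∈ S, x i * es x (S.erase i) j = (j + 1) * es x S (j + 1) := by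
  induction S using Finset.induction_on generalizing j with
  | empty => simp [es_empty_succ]
  | insert a S ha ih =>
    rw [Finset.sum_insert ha, Finset.erase_insert ha]
    have key : ∀ i ∈ S, (insert a S).erase i = insert a (S.erase i) := by
      intro i hi
      rw [Finset.erase_insert_of_ne]
      rintro rfl; exact ha hi
    have hn : ∀ i, a ∉ S.erase i := fun i h => ha (Finset.mem_of_mem_erase h)
    cases j with
    | zero =>
      have := ih 0
      simp only [es_zero, mul_one] at this ⊢
      rw [this, es_insert x ha]; simp; ring
    | succ j =>
      have : ∑ i ∈ S, x i * es x ((insert a S).erase i) (j + 1)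
          = ∑ i ∈ S, x i * es x (S.erase i) (j + 1)
            + x a * ∑ i ∈ S, x i * es x (S.erase i) j := by
        rw [Finset.mul_sum, ← Finset.sum_add_distrib]
        refine Finset.sum_congr rfl fun i hi => ?_
        rw [key i hi, es_insert x (hn i)]; ring
      rw [this, ih, ih, es_insert x ha]; push_cast; ring

end ElementarySymmetric

section RealRooted

open Polynomial

lemma splits_derivative {P : ℝ[X]} (h : P.Splits) : P.derivative.Splits := by
  by_cases h0 : P.natDegree = 0
  · rw [Polynomial.natDegree_eq_zero] at h0
    obtain ⟨c, rfl⟩ := h0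
    simp
  rw [Polynomial.splits_iff_card_roots] at h ⊢
  have h1 := Polynomial.card_roots_le_derivative P
  have h2 := Polynomial.card_roots' P.derivative
  have h3 := Polynomial.natDegree_derivative_lt h0
  omega

lemma splits_iterate_derivative {P : ℝ[X]} (h : P.Splits) (j : ℕ) :
    (derivative^[j] P).Splits := by
  induction j with
  | zero => exact h
  | succ j ih => rw [Function.iterate_succ_apply']; exact splits_derivative ih

/-- Newton's identities up to order three, with the associated power sum inequalities. -/
lemma exists_power_sums_prod (s : Multiset ℝ) (hs : ∀ a ∈ s, a ≠ 0) :
    ∃ p₁ p₂ p₃ : ℝ, 0 ≤ p₂ ∧ p₃ ^ 2 ≤ p₂ ^ 3 ∧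
      (s.map fun a => X - C a).prod.coeff 0 ≠ 0 ∧
      (s.map fun a => X - C a).prod.coeff 1 = (s.map fun a => X - C a).prod.coeff 0 * p₁ ∧
      2 * (s.map fun a => X - C a).prod.coeff 2 =
        (s.map fun a => X - C a).prod.coeff 0 * (p₁ ^ 2 - p₂) ∧
      6 * (s.map fun a => X - C a).prod.coeff 3 =
        (s.map fun a => X - C a).prod.coeff 0 * (p₁ ^ 3 - 3 * p₁ * p₂ + 2 * p₃) := by
  induction s using Multiset.induction_on with
  | empty => exact ⟨0, 0, 0, by simp [Polynomial.coeff_one]⟩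
  | cons a s ih =>
    obtain ⟨p₁, p₂, p₃, h2, h3, e0, e1, e2, e3⟩ :=
      ih fun b hb => hs b (Multiset.mem_cons_of_mem hb)
    have ha : a ≠ 0 := hs a (Multiset.mem_cons_self a s)
    simp only [Multiset.map_cons, Multiset.prod_cons]
    generalize (s.map fun a => X - C a).prod = Q at *
    set y := -a⁻¹ with hy
    have hay : a * y = -1 := by rw [hy]; field_simp
    have c0 : ((X - C a) * Q).coeff 0 = -a * Q.coeff 0 := by simp [sub_mul]
    have cs : ∀ j, ((X - C a) * Q).coeff (j + 1) = Q.coeff j - a * Q.coeff (j + 1) := by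
      intro j; rw [sub_mul, coeff_sub, coeff_X_mul, coeff_C_mul]
    refine ⟨p₁ + y, p₂ + y ^ 2, p₃ + y ^ 3, by positivity, ?_, ?_, ?_, ?_, ?_⟩
    · have hsq : (2 * p₃ * y ^ 3) ^ 2 ≤ (p₂ ^ 2 * y ^ 2 + p₂ * y ^ 4) ^ 2 := by
        have h4 : p₃ ^ 2 * y ^ 6 ≤ p₂ ^ 3 * y ^ 6 := by gcongr
        nlinarith [sq_nonneg (p₂ ^ 2 * y ^ 2 - p₂ * y ^ 4)]
      have hle := (abs_le_of_sq_le_sq' hsq (by positivity)).2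
      have : 0 ≤ p₂ ^ 2 * y ^ 2 := by positivity
      have : 0 ≤ p₂ * y ^ 4 := by positivity
      nlinarith
    · rw [c0]; exact mul_ne_zero (neg_ne_zero.2 ha) e0
    · rw [c0, cs 0, zero_add, e1]
      linear_combination (Q.coeff 0) * hay
    · rw [c0, cs 1]
      norm_num
      linear_combination (-a) * e2 + 2 * e1 + (2 * Q.coeff 0 * p₁) * hay
    · rw [c0, cs 2]
      norm_num
      linear_combination (-a) * e3 + 3 * e2 + (3 * Q.coeff 0 * (p₁ ^ 2 - p₂)) * hay

lemma exists_power_sums {Q : ℝ[X]} (h : Q.Splits) (h0 : Q.coeff 0 ≠ 0) :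
    ∃ p₁ p₂ p₃ : ℝ, 0 ≤ p₂ ∧ p₃ ^ 2 ≤ p₂ ^ 3 ∧ Q.coeff 1 = Q.coeff 0 * p₁ ∧
      2 * Q.coeff 2 = Q.coeff 0 * (p₁ ^ 2 - p₂) ∧
      6 * Q.coeff 3 = Q.coeff 0 * (p₁ ^ 3 - 3 * p₁ * p₂ + 2 * p₃) := by
  have hne : ∀ a ∈ Q.roots, a ≠ 0 := by
    rintro a ha rfl
    apply h0
    rw [coeff_zero_eq_eval_zero]
    exact (Polynomial.mem_roots'.1 ha).2
  obtain ⟨p₁, p₂, p₃, h2, h3, -, e1, e2, e3⟩ := exists_power_sums_prod Q.roots hne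
  have hQ : ∀ j, Q.coeff j
      = Q.leadingCoeff * (Q.roots.map fun a => X - C a).prod.coeff j := by
    intro j; rw [← coeff_C_mul, ← h.eq_prod_roots]
  refine ⟨p₁, p₂, p₃, h2, h3, ?_, ?_, ?_⟩
  · rw [hQ 0, hQ 1, e1]; ring
  · rw [hQ 0, hQ 2]; linear_combination Q.leadingCoeff * e2
  · rw [hQ 0, hQ 3]; linear_combination Q.leadingCoeff * e3

variable {ι : Type*} [DecidableEq ι]

lemma es_power_sums (x : ι → ℝ) (S : Finset ι) (j : ℕ) (h0 : es x S j ≠ 0) :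
    ∃ p₁ p₂ p₃ : ℝ, 0 ≤ p₂ ∧ p₃ ^ 2 ≤ p₂ ^ 3 ∧
      (j + 1) * es x S (j + 1) = es x S j * p₁ ∧
      (j + 2) * (j + 1) * es x S (j + 2) = es x S j * (p₁ ^ 2 - p₂) ∧
      (j + 3) * (j + 2) * (j + 1) * es x S (j + 3)
        = es x S j * (p₁ ^ 3 - 3 * p₁ * p₂ + 2 * p₃) := by
  set P : ℝ[X] := ∏ i ∈ S, (1 + C (x i) * X) with hP
  have hsp : P.Splits := by
    refine Polynomial.Splits.prod fun i _ => ?_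
    apply Polynomial.Splits.of_natDegree_le_one
    refine (Polynomial.natDegree_add_le _ _).trans ?_
    simpa using Polynomial.natDegree_C_mul_X_pow_le (x i) 1
  have hc : ∀ i, (derivative^[j] P).coeff i = ((i + j).descFactorial j : ℝ) * es x S (i + j) := by
    intro i
    rw [Polynomial.coeff_iterate_derivative, es_eq_coeff, nsmul_eq_mul]
  have hd : ((0 + j).descFactorial j : ℝ) ≠ 0 := by
    rw [zero_add, Nat.descFactorial_self]; exact_mod_cast j.factorial_ne_zero
  have hstep : ∀ i : ℕ, ((i + 1 : ℕ) : ℝ) * ((i + 1 + j).descFactorial j : ℝ)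
      = (i + 1 + j) * ((i + j).descFactorial j : ℝ) := by
    intro i
    have h1 := Nat.factorial_mul_descFactorial (show j ≤ i + j by omega)
    have h2 := Nat.factorial_mul_descFactorial (show j ≤ i + 1 + j by omega)
    rw [Nat.add_sub_cancel] at h1 h2
    rw [show i + 1 + j = (i + j) + 1 by ring, Nat.factorial_succ, Nat.factorial_succ, ← h1] at h2
    have h3 : (i + 1) * (i + 1 + j).descFactorial j = (i + 1 + j) * (i + j).descFactorial j := by
      apply Nat.eq_of_mul_eq_mul_left i.factorial_pos
      rw [show i + 1 + j = (i + j) + 1 by ring]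
      linarith
    exact_mod_cast h3
  obtain ⟨p₁, p₂, p₃, h2, h3, e1, e2, e3⟩ :=
    exists_power_sums (splits_iterate_derivative hsp j) (by
      rw [hc]; exact mul_ne_zero hd (by simpa using h0))
  have s0 := hstep 0
  have s1 := hstep 1
  have s2 := hstep 2
  rw [hc, hc] at e1 e2 e3
  generalize ((0 + j).descFactorial j : ℝ) = d₀ at *
  generalize ((0 + 1 + j).descFactorial j : ℝ) = d₁ at *
  norm_num [add_comm _ j] at s0 s1 s2 e1 e2 e3 ⊢
  refine ⟨p₁, p₂, h2, p₃, h3, ?_, ?_, ?_⟩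
  all_goals apply mul_left_cancel₀ hd
  · rw [s0] at e1
    linear_combination e1
  · rw [s0] at s1
    linear_combination e2 - es x S (j + 2) * s1
  · rw [s0] at s1
    linear_combination e3 - es x S (j + 3) * (2 * s2 + (j + 3) * s1)

/-- A dimension independent form of Newton's inequality. -/
lemma es_newton (x : ι → ℝ) (S : Finset ι) (j : ℕ) :
    (j + 2) * (es x S (j + 2) * es x S j) ≤ (j + 1) * es x S (j + 1) ^ 2 := by
  by_cases h0 : es x S j = 0
  · rw [h0]; simp; positivity
  obtain ⟨p₁, p₂, p₃, h2, -, e1, e2, -⟩ := es_power_sums x S j h0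
  have hj : (0 : ℝ) < j + 1 := by positivity
  have : ((j : ℝ) + 1) * ((j + 2) * (es x S (j + 2) * es x S j))
      ≤ (j + 1) * ((j + 1) * es x S (j + 1) ^ 2) := by
    have h4 : (j + 1) * ((j + 1) * es x S (j + 1) ^ 2) = (es x S j * p₁) ^ 2 := by
      rw [← e1]; ring
    have h5 : ((j : ℝ) + 1) * ((j + 2) * (es x S (j + 2) * es x S j))
      = es x S j * (es x S j * (p₁ ^ 2 - p₂)) := by rw [← e2]; ring
    rw [h4, h5]
    nlinarith [mul_nonneg (sq_nonneg (es x S j)) h2]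
  exact le_of_mul_le_mul_left this hj

lemma es_mul_le_sq (x : ι → ℝ) (S : Finset ι) (j : ℕ) :
    es x S (j + 2) * es x S j ≤ es x S (j + 1) ^ 2 := by
  have h := es_newton x S j
  have hj : (0 : ℝ) < j + 2 := by positivity
  refine le_of_mul_le_mul_left (h.trans ?_) hj
  nlinarith [sq_nonneg (es x S (j + 1))]

set_option maxHeartbeats 800000 in
lemma abs_es_le_of_ratio (j : ℕ) (c : ℝ) (hc : 0 ≤ c) : ∃ C : ℝ, 0 < C ∧
    ∀ (x : ι → ℝ) (S : Finset ι), 0 < es x S (j + 1) → es x S (j + 1) ≤ es x S j →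
      |es x S (j + 2)| ≤ c * es x S (j + 1) → |es x S (j + 3)| ≤ C * es x S (j + 1) := by
  set B : ℝ := (j + 2) ^ 2 * (1 + c) with hB
  have hB1 : 1 ≤ B := by
    have : (0 : ℝ) ≤ j := by positivity
    nlinarith [mul_nonneg this hc]
  refine ⟨6 * B ^ 3, by positivity, fun x S h1 h2 h3 => ?_⟩
  have hj : (0 : ℝ) ≤ j := by positivity
  have hpos : 0 < es x S j := h1.trans_le h2
  obtain ⟨p₁, p₂, p₃, hp2, hp3, e1, e2, e3⟩ := es_power_sums x S j hpos.ne'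
  set r := es x S (j + 1) / es x S j with hr
  have hr0 : 0 < r := div_pos h1 hpos
  have hr1 : r ≤ 1 := (div_le_one hpos).2 h2
  have hrm : es x S (j + 1) = es x S j * r := by rw [hr]; field_simp
  have q1 : p₁ = (j + 1) * r := by
    apply mul_left_cancel₀ hpos.ne'
    rw [← e1, hrm]; ring
  have q2 : p₂ ≤ B * r := by
    have h4 : es x S j * p₂ ≤ es x S j * (B * r) := by
      have h5 : es x S j * p₂ = es x S j * p₁ ^ 2 - (j + 2) * (j + 1) * es x S (j + 2) := by
        linarith
      have h6 : -(es x S (j + 2)) ≤ c * (es x S j * r) := by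
        rw [← hrm]; exact (neg_le_abs _).trans h3
      have h7 : ((j : ℝ) + 2) * (j + 1) * -(es x S (j + 2))
          ≤ (j + 2) * (j + 1) * (c * (es x S j * r)) := by gcongr
      have h8 : es x S j * p₁ ^ 2 ≤ es x S j * ((j + 1) ^ 2 * r) := by
        rw [q1, mul_pow]
        have : r ^ 2 ≤ r := by nlinarith
        gcongr
      have h9 : 0 ≤ es x S j * r := by positivity
      have h10 : 0 ≤ c * (es x S j * r) := by positivity
      have h11 : 0 ≤ j * (es x S j * r) := by positivity
      have h12 : 0 ≤ j * (c * (es x S j * r)) := by positivity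
      rw [hB]
      nlinarith
    exact le_of_mul_le_mul_left h4 hpos
  have q1' : p₁ ≤ B * r := by
    rw [q1, hB]
    have : ((j : ℝ) + 1) ≤ (j + 2) ^ 2 * (1 + c) := by nlinarith [mul_nonneg hj hc]
    gcongr
  have q1n : 0 ≤ p₁ := by rw [q1]; positivity
  have q3 : |p₃| ≤ B ^ 2 * r := by
    apply abs_le_of_sq_le_sq _ (by positivity)
    calc p₃ ^ 2 ≤ p₂ ^ 3 := hp3
      _ ≤ (B * r) ^ 3 := by gcongr
      _ = B ^ 3 * (r ^ 2 * r) := by ring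
      _ ≤ B ^ 4 * (r ^ 2 * 1) := by
        have : B ^ 3 ≤ B ^ 4 := pow_le_pow_right₀ hB1 (by norm_num)
        gcongr
      _ = (B ^ 2 * r) ^ 2 := by ring
  have q4 : |p₁ ^ 3 - 3 * p₁ * p₂ + 2 * p₃| ≤ 6 * B ^ 3 * r := by
    have a1 : p₁ ^ 3 ≤ B ^ 3 * r := by
      calc p₁ ^ 3 ≤ (B * r) ^ 3 := by gcongr
        _ = B ^ 3 * (r * r ^ 2) := by ring
        _ ≤ B ^ 3 * (r * 1) := by
          have : r ^ 2 ≤ 1 := by nlinarith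
          gcongr
        _ = B ^ 3 * r := by ring
    have a2 : p₁ * p₂ ≤ B ^ 2 * r := by
      calc p₁ * p₂ ≤ (B * r) * (B * r) := by gcongr
        _ = B ^ 2 * (r * r) := by ring
        _ ≤ B ^ 2 * (r * 1) := by gcongr
        _ = B ^ 2 * r := by ring
    have a3 : B ^ 2 * r ≤ B ^ 3 * r := by
      have : B ^ 2 ≤ B ^ 3 := pow_le_pow_right₀ hB1 (by norm_num)
      gcongr
    have a4 : 0 ≤ p₁ * p₂ := by positivity
    have a5 : 0 ≤ p₁ ^ 3 := by positivity
    have a6 : 0 ≤ B ^ 2 * r := by positivity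
    rw [abs_le] at q3 ⊢
    constructor <;> linarith
  have e3' : es x S j * |p₁ ^ 3 - 3 * p₁ * p₂ + 2 * p₃|
      = (j + 3) * (j + 2) * (j + 1) * |es x S (j + 3)| := by
    have h4 := congrArg abs e3
    rw [abs_mul, abs_mul (es x S j), abs_of_pos hpos, abs_of_nonneg (by positivity)] at h4
    exact h4.symm
  have hfin : |es x S (j + 3)| ≤ (j + 3) * (j + 2) * (j + 1) * |es x S (j + 3)| := by
    have : (1 : ℝ) ≤ (j + 3) * (j + 2) * (j + 1) := by 
      nlinarith [mul_nonneg hj hj, mul_nonneg (mul_nonneg hj hj) hj]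
    exact le_mul_of_one_le_left (abs_nonneg _) this
  calc |es x S (j + 3)| ≤ es x S j * |p₁ ^ 3 - 3 * p₁ * p₂ + 2 * p₃| := by rw [e3']; exact hfin
    _ ≤ es x S j * (6 * B ^ 3 * r) := by gcongr
    _ = 6 * B ^ 3 * es x S (j + 1) := by rw [hrm]; ring

end RealRooted

/-- The Gårding cone `Γ_k` for families indexed by `S`. -/
def Gam {ι : Type*} (x : ι → ℝ) (S : Finset ι) (k : ℕ) : Prop := ∀ j ≤ k, 0 < es x S j

section Garding

variable {ι : Type*} {x y : ι → ℝ} {S : Finset ι}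

lemma Gam.mono {k l : ℕ} (h : Gam x S k) (hl : l ≤ k) : Gam x S l :=
  fun j hj => h j (hj.trans hl)

lemma gam_succ_iff {k : ℕ} : Gam x S (k + 1) ↔ Gam x S k ∧ 0 < es x S (k + 1) := by
  refine ⟨fun h => ⟨h.mono k.le_succ, h _ le_rfl⟩, fun h j hj => ?_⟩
  rcases Nat.lt_or_ge j (k + 1) with h' | h'
  · exact h.1 j (by omega)
  · rw [le_antisymm hj h']; exact h.2

variable [DecidableEq ι]

lemma Gam.erase {k : ℕ} (h : Gam x S (k + 1)) {i : ι} (hi : i ∈ S) : Gam x (S.erase i) k := by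
  intro j
  induction j with
  | zero => intro _; simp
  | succ j ih =>
    intro hj
    have h0 := ih (by omega)
    by_contra hneg
    push Not at hneg
    have h1 := h (j + 1) (by omega)
    have h2 := h (j + 2) (by omega)
    rw [es_erase x hi] at h1 h2
    have hN := es_mul_le_sq x (S.erase i) j
    set a := es x (S.erase i) j
    set b := es x (S.erase i) (j + 1)
    set c := es x (S.erase i) (j + 2)
    have e1 : 0 < a * (c + x i * b) := mul_pos h0 h2
    have e2 : 0 ≤ (-b) * (b + x i * a) := mul_nonneg (by linarith) h1.le
    nlinarith

lemma Gam.pow_le_of_ratio_gt {j : ℕ} {ε : ℝ} (hε : 0 < ε) (h : Gam x S j)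
    (hr : ε * es x S j < es x S (j + 1)) : ε ^ j ≤ es x S j := by
  induction j with
  | zero => simp
  | succ j ih =>
    have hN := es_mul_le_sq x S j
    have h0 := h j (by omega)
    have h1 := h (j + 1) le_rfl
    have h2 : ε * es x S j < es x S (j + 1) := by
      have : es x S (j + 1) * (ε * es x S j) < es x S (j + 1) * es x S (j + 1) := by
        calc es x S (j + 1) * (ε * es x S j) = (ε * es x S (j + 1)) * es x S j := by ring
          _ < es x S (j + 2) * es x S j := by gcongr
          _ ≤ _ := by rw [← pow_two]; exact hN
      exact lt_of_mul_lt_mul_left this h1.le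
    have h3 := ih (h.mono (by omega)) h2
    calc ε ^ (j + 1) = ε * ε ^ j := by ring
      _ ≤ ε * es x S j := by gcongr
      _ ≤ _ := h2.le

lemma Gam.succ_le_mul {j : ℕ} {ε : ℝ} (hε : 0 < ε) (h : Gam x S (j + 1))
    (hle : es x S (j + 1) ≤ ε ^ (j + 1)) : es x S (j + 2) ≤ ε * es x S (j + 1) := by
  by_contra hr
  push Not at hr
  have hN := es_mul_le_sq x S j
  have h0 := h j (by omega)
  have h1 := h (j + 1) le_rfl
  have h2 : ε * es x S j < es x S (j + 1) := by
    have : es x S (j + 1) * (ε * es x S j) < es x S (j + 1) * es x S (j + 1) := by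
      calc es x S (j + 1) * (ε * es x S j) = (ε * es x S (j + 1)) * es x S j := by ring
        _ < es x S (j + 2) * es x S j := by gcongr
        _ ≤ _ := by rw [← pow_two]; exact hN
    exact lt_of_mul_lt_mul_left this h1.le
  have h3 := (h.mono (Nat.le_succ j)).pow_le_of_ratio_gt hε h2
  have h4 : ε ^ (j + 1) ≤ ε * es x S j := by rw [pow_succ']; gcongr
  linarith

lemma Gam.succ_le_self {j : ℕ} (h : Gam x S (j + 1)) (hle : es x S (j + 1) ≤ 1) :
    es x S (j + 1) ≤ es x S j := by
  by_contra hr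
  push Not at hr
  have h3 := (h.mono (Nat.le_succ j)).pow_le_of_ratio_gt one_pos (by simpa using hr)
  rw [one_pow] at h3
  linarith

lemma titu {a b s t r : ℝ} (hs : 0 < s) (ht : 0 < t) (hr : s + t ≤ r) :
    (a + b) ^ 2 / r ≤ a ^ 2 / s + b ^ 2 / t := by
  have h1 : (a + b) ^ 2 / r ≤ (a + b) ^ 2 / (s + t) := by
    apply div_le_div_of_nonneg_left (by positivity) (by positivity) hr
  refine h1.trans ?_
  rw [div_add_div _ _ hs.ne' ht.ne', div_le_div_iff₀ (by positivity) (by positivity)]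
  have : 0 ≤ (a * t - b * s) ^ 2 := sq_nonneg _
  have : 0 ≤ s * t := by positivity
  nlinarith [mul_nonneg this (sq_nonneg (a * t - b * s))]

lemma Gam.add_quotient_pos {k : ℕ} (h : Gam x S (k + 1)) {i : ι} (hi : i ∈ S) :
    0 < x i + es x (S.erase i) (k + 1) / es x (S.erase i) k := by
  have h0 : 0 < es x (S.erase i) k := h.erase hi k le_rfl
  have h1 := h (k + 1) le_rfl
  rw [es_erase x hi] at h1
  have : x i + es x (S.erase i) (k + 1) / es x (S.erase i) k
      = (es x (S.erase i) (k + 1) + x i * es x (S.erase i) k) / es x (S.erase i) k := by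
    field_simp; ring
  rw [this]; positivity

lemma Gam.quotient_eq {k : ℕ} (h : Gam x S (k + 1)) :
    (k + 2) * (es x S (k + 2) / es x S (k + 1)) = ∑ i ∈ S,
      (x i - x i ^ 2 / (x i + es x (S.erase i) (k + 1) / es x (S.erase i) k)) := by
  have h1 : 0 < es x S (k + 1) := h (k + 1) le_rfl
  have hE := sum_mul_es_erase x S (k + 1)
  push_cast at hE
  rw [show (k : ℝ) + 2 = k + 1 + 1 by ring, ← mul_div_assoc, ← hE, Finset.sum_div]
  refine Finset.sum_congr rfl fun i hi => ?_
  have h0 : 0 < es x (S.erase i) k := h.erase hi k le_rfl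
  have hp := h.add_quotient_pos hi
  have h2 : es x S (k + 1) = es x (S.erase i) k *
      (x i + es x (S.erase i) (k + 1) / es x (S.erase i) k) := by
    rw [es_erase x hi]; field_simp; ring
  set q := es x (S.erase i) (k + 1) / es x (S.erase i) k with hq
  have h3 : es x (S.erase i) (k + 1) = q * es x (S.erase i) k := by rw [hq]; field_simp
  rw [h2, h3]
  field_simp
  ring

/-- The quotient `σ_{k+1} / σ_k` is superadditive on `Γ_k`. -/
lemma Gam.add_superadditive {k : ℕ} (hx : Gam x S k) (hy : Gam y S k) :
    Gam (x + y) S k ∧ es x S (k + 1) / es x S k + es y S (k + 1) / es y S k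
      ≤ es (x + y) S (k + 1) / es (x + y) S k := by
  induction k generalizing S with
  | zero =>
    refine ⟨fun j hj => by rw [Nat.le_zero.1 hj]; simp, ?_⟩
    have : ∀ z : ι → ℝ, es z S 1 = ∑ i ∈ S, z i := by
      intro z
      have := sum_mul_es_erase z S 0
      simp only [es_zero, mul_one] at this
      rw [this]; simp
    simp only [zero_add, this, es_zero, div_one, Pi.add_apply, Finset.sum_add_distrib, le_refl]
  | succ k ih =>
    obtain ⟨hG, hq⟩ := ih (hx.mono k.le_succ) (hy.mono k.le_succ)
    have hG' : Gam (x + y) S (k + 1) := by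
      rw [gam_succ_iff]
      refine ⟨hG, ?_⟩
      have h1 : 0 < es x S (k + 1) / es x S k := div_pos (hx _ le_rfl) (hx _ k.le_succ)
      have h2 : 0 < es y S (k + 1) / es y S k := div_pos (hy _ le_rfl) (hy _ k.le_succ)
      exact (div_pos_iff_of_pos_right (hG k le_rfl)).1 (by linarith)
    refine ⟨hG', ?_⟩
    have hk : (0 : ℝ) < k + 2 := by positivity
    refine le_of_mul_le_mul_left ?_ hk
    rw [mul_add, hx.quotient_eq, hy.quotient_eq, hG'.quotient_eq, ← Finset.sum_add_distrib]
    refine Finset.sum_le_sum fun i hi => ?_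
    have h3 := (ih (hx.erase hi) (hy.erase hi)).2
    have h4 := titu (a := x i) (b := y i) (hx.add_quotient_pos hi) (hy.add_quotient_pos hi)
      (r := (x + y) i + es (x + y) (S.erase i) (k + 1) / es (x + y) (S.erase i) k)
      (by rw [Pi.add_apply]; linarith)
    rw [Pi.add_apply] at h4 ⊢
    linarith

end Garding

section Jets

open Filter Topology

/-- `Jet2 g a b c` says that `g` has the value `a`, the first derivative `b` and the second
derivative `c` at `0`. -/
def Jet2 (g : ℝ → ℝ) (a b c : ℝ) : Prop :=
  ∃ g' : ℝ → ℝ, (∀ᶠ t in 𝓝 0, HasDerivAt g (g' t) t) ∧ g 0 = a ∧ g' 0 = b ∧ HasDerivAt g' c 0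

lemma Jet2.value {g : ℝ → ℝ} {a b c : ℝ} (h : Jet2 g a b c) : g 0 = a := by
  obtain ⟨_, _, h0, _⟩ := h
  exact h0

lemma Jet2.hasDerivAt {g : ℝ → ℝ} {a b c : ℝ} (h : Jet2 g a b c) : HasDerivAt g b 0 := by
  obtain ⟨g', h1, -, rfl, -⟩ := h
  exact h1.self_of_nhds

lemma Jet2.congr {g h : ℝ → ℝ} {a b c : ℝ} (hg : Jet2 g a b c) (e : g =ᶠ[𝓝 0] h) :
    Jet2 h a b c := by
  obtain ⟨g', h1, h2, h3, h4⟩ := hg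
  refine ⟨g', ?_, e.self_of_nhds ▸ h2, h3, h4⟩
  filter_upwards [h1, e.eventually_nhds] with t ht1 ht2
  exact ht1.congr_of_eventuallyEq (EventuallyEq.symm ht2)

lemma Jet2.unique {g : ℝ → ℝ} {a b c a' b' c' : ℝ} (h : Jet2 g a b c) (h' : Jet2 g a' b' c') :
    a = a' ∧ b = b' ∧ c = c' := by
  obtain ⟨g₁, h1, rfl, rfl, h4⟩ := h
  obtain ⟨g₂, k1, rfl, rfl, k4⟩ := h'
  have e : g₂ =ᶠ[𝓝 0] g₁ := by
    filter_upwards [h1, k1] with t ht kt using kt.unique ht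
  exact ⟨rfl, e.self_of_nhds.symm, h4.unique (k4.congr_of_eventuallyEq e.symm)⟩

lemma jet2_affine (a b : ℝ) : Jet2 (fun t => a + t * b) a b 0 := by
  refine ⟨fun _ => b, Eventually.of_forall fun t => ?_, by simp, rfl, hasDerivAt_const _ _⟩
  simpa using ((hasDerivAt_id t).mul_const b).const_add a

lemma jet2_const (a : ℝ) : Jet2 (fun _ => a) a 0 0 := by
  simpa using jet2_affine a 0

lemma Jet2.add {g h : ℝ → ℝ} {a b c a' b' c' : ℝ} (hg : Jet2 g a b c) (hh : Jet2 h a' b' c') :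
    Jet2 (fun t => g t + h t) (a + a') (b + b') (c + c') := by
  obtain ⟨g₁, h1, rfl, rfl, h4⟩ := hg
  obtain ⟨g₂, k1, rfl, rfl, k4⟩ := hh
  refine ⟨fun t => g₁ t + g₂ t, ?_, rfl, rfl, h4.add k4⟩
  filter_upwards [h1, k1] with t ht kt using ht.add kt

lemma Jet2.mul {g h : ℝ → ℝ} {a b c a' b' c' : ℝ} (hg : Jet2 g a b c) (hh : Jet2 h a' b' c') :
    Jet2 (fun t => g t * h t) (a * a') (b * a' + a * b') (c * a' + 2 * (b * b') + a * c') := by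
  have h0 := hg.hasDerivAt
  have k0 := hh.hasDerivAt
  obtain ⟨g₁, h1, rfl, rfl, h4⟩ := hg
  obtain ⟨g₂, k1, rfl, rfl, k4⟩ := hh
  refine ⟨fun t => g₁ t * h t + g t * g₂ t, ?_, rfl, rfl, ?_⟩
  · filter_upwards [h1, k1] with t ht kt using ht.mul kt
  · exact ((h4.mul k0).add (h0.mul k4)).congr_deriv (by ring)

lemma Jet2.const_mul {g : ℝ → ℝ} {a b c : ℝ} (r : ℝ) (hg : Jet2 g a b c) :
    Jet2 (fun t => r * g t) (r * a) (r * b) (r * c) := by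
  simpa using (jet2_const r).mul hg

lemma Jet2.neg {g : ℝ → ℝ} {a b c : ℝ} (hg : Jet2 g a b c) :
    Jet2 (fun t => -g t) (-a) (-b) (-c) := by
  simpa using hg.const_mul (-1)

lemma Jet2.sub {g h : ℝ → ℝ} {a b c a' b' c' : ℝ} (hg : Jet2 g a b c) (hh : Jet2 h a' b' c') :
    Jet2 (fun t => g t - h t) (a - a') (b - b') (c - c') := by
  simpa [sub_eq_add_neg] using hg.add hh.neg

lemma Jet2.sum {κ : Type*} {g : κ → ℝ → ℝ} {a b c : κ → ℝ} (s : Finset κ)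
    (h : ∀ i ∈ s, Jet2 (g i) (a i) (b i) (c i)) :
    Jet2 (fun t => ∑ i ∈ s, g i t) (∑ i ∈ s, a i) (∑ i ∈ s, b i) (∑ i ∈ s, c i) := by
  classical
  induction s using Finset.induction_on with
  | empty => simpa using jet2_const 0
  | insert i s hi ih =>
    simp only [Finset.sum_insert hi]
    exact (h i (Finset.mem_insert_self i s)).add
      (ih fun j hj => h j (Finset.mem_insert_of_mem hj))

lemma Jet2.comp {g h h' : ℝ → ℝ} {a b c d : ℝ} (hg : Jet2 g a b c)
    (hh : ∀ᶠ s in 𝓝 a, HasDerivAt h (h' s) s) (hd : HasDerivAt h' d a) :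
    Jet2 (fun t => h (g t)) (h a) (h' a * b) (d * b ^ 2 + h' a * c) := by
  have h0 := hg.hasDerivAt
  obtain ⟨g₁, h1, rfl, rfl, h4⟩ := hg
  refine ⟨fun t => h' (g t) * g₁ t, ?_, rfl, rfl, ?_⟩
  · filter_upwards [h1, h0.continuousAt.eventually hh] with t ht kt using kt.comp t ht
  · refine ((hd.comp (0 : ℝ) h0).mul h4).congr_deriv ?_
    simp only [Function.comp_apply]; ring

lemma Jet2.log {g : ℝ → ℝ} {a b c : ℝ} (hg : Jet2 g a b c) (ha : 0 < a) :
    Jet2 (fun t => Real.log (g t)) (Real.log a) (b / a) (c / a - (b / a) ^ 2) := by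
  have := hg.comp (h := Real.log) (h' := fun s => s⁻¹) (d := -(a ^ 2)⁻¹)
    (by filter_upwards [isOpen_ne.mem_nhds ha.ne'] with s hs using Real.hasDerivAt_log hs)
    (hasDerivAt_inv ha.ne')
  convert this using 1 <;> field_simp
  ring

lemma Jet2.inv {g : ℝ → ℝ} {a b c : ℝ} (hg : Jet2 g a b c) (ha : 0 < a) :
    ∃ b' c', Jet2 (fun t => (g t)⁻¹) a⁻¹ b' c' := by
  refine ⟨_, _, hg.comp (h := fun s => s⁻¹) (h' := fun s => -(s ^ 2)⁻¹)
    (d := 2 * a / (a ^ 2) ^ 2) ?_ ?_⟩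
  · filter_upwards [isOpen_ne.mem_nhds ha.ne'] with s hs using hasDerivAt_inv hs
  · have := ((hasDerivAt_pow 2 a).inv (pow_ne_zero 2 ha.ne')).neg
    refine this.congr_deriv ?_
    simp; ring

lemma Jet2.comp_neg {g : ℝ → ℝ} {a b c : ℝ} (hg : Jet2 g a b c) :
    Jet2 (fun t => g (-t)) a (-b) c := by
  obtain ⟨g₁, h1, rfl, rfl, h4⟩ := hg
  have hc : Tendsto (fun t : ℝ => -t) (𝓝 0) (𝓝 0) := by
    simpa using (continuous_neg (G := ℝ)).tendsto 0
  refine ⟨fun t => -g₁ (-t), ?_, by simp, by simp, ?_⟩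
  · filter_upwards [hc.eventually h1] with t ht
    have := HasDerivAt.comp (h₂ := g) t ht (hasDerivAt_neg t)
    simpa [Function.comp_def] using this
  · have h5 : HasDerivAt g₁ c (-0) := by simpa using h4
    exact ((HasDerivAt.comp (h₂ := g₁) (0 : ℝ) h5 (hasDerivAt_neg (0 : ℝ))).neg).congr_deriv
      (by ring)

lemma Jet2.of_isLocalMax {g : ℝ → ℝ} {a b c : ℝ} (hg : Jet2 g a b c) (hm : IsLocalMax g 0) :
    b = 0 ∧ c ≤ 0 := by
  have hb : b = 0 := hm.hasDerivAt_eq_zero hg.hasDerivAt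
  refine ⟨hb, ?_⟩
  subst hb
  have h0 := hg.hasDerivAt
  obtain ⟨g₁, h1, h2, h3, h4⟩ := id hg
  by_contra! hc
  have e : deriv g =ᶠ[𝓝 0] g₁ := h1.mono fun t ht => ht.deriv
  have hdd : deriv (deriv g) 0 = c := by rw [e.deriv_eq, h4.deriv]
  have hmin := isLocalMin_of_deriv_deriv_pos (by rw [hdd]; exact hc) h0.deriv h0.continuousAt
  have hconst : g =ᶠ[𝓝 0] fun _ => g 0 := by
    filter_upwards [hmin, hm] with t h5 h6 using le_antisymm h6 h5
  have := (hg.unique ((jet2_const (g 0)).congr hconst.symm)).2.2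
  linarith

end Jets

section PolynomialJets

open Polynomial

/-- Coefficientwise version of `Jet2` for polynomial valued functions. -/
def PJet (P : ℝ → ℝ[X]) (a b c : ℝ[X]) : Prop :=
  ∀ j, Jet2 (fun t => (P t).coeff j) (a.coeff j) (b.coeff j) (c.coeff j)

lemma pjet_const (a : ℝ[X]) : PJet (fun _ => a) a 0 0 := fun j => by
  simpa using jet2_const (a.coeff j)

lemma PJet.mul {P Q : ℝ → ℝ[X]} {a b c a' b' c' : ℝ[X]} (hP : PJet P a b c)
    (hQ : PJet Q a' b' c') :
    PJet (fun t => P t * Q t) (a * a') (b * a' + a * b') (c * a' + (b * b' + b * b') + a * c') := by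
  intro j
  have := Jet2.sum (Finset.HasAntidiagonal.antidiagonal j)
    (g := fun p t => (P t).coeff p.1 * (Q t).coeff p.2) fun p _ => (hP p.1).mul (hQ p.2)
  simp only [coeff_mul, coeff_add]
  convert this using 1
  · rw [← Finset.sum_add_distrib]
  · rw [← Finset.sum_add_distrib, ← Finset.sum_add_distrib, ← Finset.sum_add_distrib]
    exact Finset.sum_congr rfl fun p _ => by ring

lemma PJet.sum {κ : Type*} {P : κ → ℝ → ℝ[X]} {a b c : κ → ℝ[X]} (s : Finset κ)
    (h : ∀ i ∈ s, PJet (P i) (a i) (b i) (c i)) :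
    PJet (fun t => ∑ i ∈ s, P i t) (∑ i ∈ s, a i) (∑ i ∈ s, b i) (∑ i ∈ s, c i) := by
  intro j
  simp only [finsetSum_coeff]
  exact Jet2.sum s fun i hi => h i hi j

variable {ι : Type*} [DecidableEq ι]

lemma PJet.prod {P : ι → ℝ → ℝ[X]} {a b c : ι → ℝ[X]} (s : Finset ι)
    (h : ∀ i, PJet (P i) (a i) (b i) (c i)) :
    PJet (fun t => ∏ i ∈ s, P i t) (∏ i ∈ s, a i) (∑ i ∈ s, b i * ∏ l ∈ s.erase i, a l)
      (∑ i ∈ s, c i * ∏ l ∈ s.erase i, a l +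
        ∑ i ∈ s, ∑ j ∈ s.erase i, b i * b j * ∏ l ∈ (s.erase i).erase j, a l) := by
  induction s using Finset.induction_on with
  | empty => simpa using pjet_const 1
  | insert i s hi ih =>
    simp only [Finset.prod_insert hi, Finset.sum_insert hi, Finset.erase_insert hi]
    have hk : ∀ j ∈ s, (insert i s).erase j = insert i (s.erase j) := by
      intro j hj
      rw [Finset.erase_insert_of_ne]
      rintro rfl; exact hi hj
    have hni : ∀ j, i ∉ s.erase j := fun j h' => hi (Finset.mem_of_mem_erase h')
    have hni2 : ∀ j l, i ∉ (s.erase j).erase l := fun j l h' => hni j (Finset.mem_of_mem_erase h')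
    have hS : ∀ e : ι → ℝ[X], ∑ j ∈ s, e j * ∏ l ∈ (insert i s).erase j, a l
        = a i * ∑ j ∈ s, e j * ∏ l ∈ s.erase j, a l := by
      intro e
      rw [Finset.mul_sum]
      refine Finset.sum_congr rfl fun j hj => ?_
      rw [hk j hj, Finset.prod_insert (hni j)]; ring
    have hD : ∑ j ∈ s, ∑ l ∈ (insert i s).erase j,
          b j * b l * ∏ r ∈ ((insert i s).erase j).erase l, a r
        = b i * ∑ j ∈ s, b j * ∏ l ∈ s.erase j, a l
          + a i * ∑ j ∈ s, ∑ l ∈ s.erase j, b j * b l * ∏ r ∈ (s.erase j).erase l, a r := by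
      rw [Finset.mul_sum, Finset.mul_sum, ← Finset.sum_add_distrib]
      refine Finset.sum_congr rfl fun j hj => ?_
      rw [hk j hj, Finset.sum_insert (hni j), Finset.erase_insert (hni j), Finset.mul_sum]
      congr 1
      · ring
      · refine Finset.sum_congr rfl fun l hl => ?_
        rw [Finset.erase_insert_of_ne, Finset.prod_insert (hni2 j l)]
        · ring
        · rintro rfl; exact hni j hl
    rw [hS, hS, hD]
    convert (h i).mul ih using 1
    have : ∑ j ∈ s, b i * b j * ∏ l ∈ s.erase j, a l
        = b i * ∑ j ∈ s, b j * ∏ l ∈ s.erase j, a l := by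
      rw [Finset.mul_sum]; exact Finset.sum_congr rfl fun j _ => by ring
    rw [this]; ring

lemma PJet.const_mul {P : ℝ → ℝ[X]} {a b c : ℝ[X]} (r : ℝ[X]) (hP : PJet P a b c) :
    PJet (fun t => r * P t) (r * a) (r * b) (r * c) := by
  simpa using (pjet_const r).mul hP

lemma perm_eq_one_or_swap {σ : Equiv.Perm ι} {i j : ι}
    (h : ∀ l, l ≠ i → l ≠ j → σ l = l) : σ = 1 ∨ σ = Equiv.swap i j := by
  have hmaps : ∀ l, (l = i ∨ l = j) → (σ l = i ∨ σ l = j) := by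
    intro l hl
    by_contra hc
    push Not at hc
    have h1 := σ.injective (h (σ l) hc.1 hc.2)
    rw [h1] at hc
    tauto
  rcases hmaps i (Or.inl rfl) with hi | hi
  · left
    ext l
    by_cases hli : l = i
    · simp [hli, hi]
    by_cases hlj : l = j
    · rcases hmaps l (Or.inr hlj) with h2 | h2
      · exact absurd (σ.injective (h2.trans hi.symm)) hli
      · rw [h2, hlj]; rfl
    · simp [h l hli hlj]
  · right
    ext l
    by_cases hli : l = i
    · simp [hli, hi]
    by_cases hlj : l = j
    · rcases hmaps l (Or.inr hlj) with h2 | h2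
      · rw [h2, hlj]; simp
      · exact absurd (σ.injective (h2.trans hi.symm)) hli
    · rw [h l hli hlj, Equiv.swap_apply_of_ne_of_ne hli hlj]

variable [Fintype ι]

lemma PJet.det {N : ℝ → Matrix ι ι ℝ[X]} {d : ι → ℝ[X]} {B C : Matrix ι ι ℝ[X]}
    (h : ∀ i j, PJet (fun t => N t i j) (Matrix.diagonal d i j) (B i j) (C i j)) :
    PJet (fun t => (N t).det) (∏ i, d i) (∑ i, B i i * ∏ l ∈ univ.erase i, d l)
      (∑ i, C i i * ∏ l ∈ univ.erase i, d l + ∑ i, ∑ j ∈ univ.erase i,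
        (B i i * B j j - B i j * B j i) * ∏ l ∈ (univ.erase i).erase j, d l) := by
  have key := PJet.sum (univ : Finset (Equiv.Perm ι)) fun σ _ =>
    (PJet.prod (univ : Finset ι) fun i => h (σ i) i).const_mul ((Equiv.Perm.sign σ : ℤ) : ℝ[X])
  simp only [Matrix.det_apply']
  have hone : ∀ (i : ι) (E : Matrix ι ι ℝ[X]), ∑ σ : Equiv.Perm ι,
      ((Equiv.Perm.sign σ : ℤ) : ℝ[X]) *
        (E (σ i) i * ∏ l ∈ univ.erase i, Matrix.diagonal d (σ l) l)
      = E i i * ∏ l ∈ univ.erase i, d l := by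
    intro i E
    rw [Finset.sum_eq_single 1]
    · simp
    · intro σ _ hσ
      obtain ⟨l, hl⟩ : ∃ l, l ≠ i ∧ σ l ≠ l := by
        by_contra hc
        push Not at hc
        rcases perm_eq_one_or_swap (σ := σ) (i := i) (j := i) fun l hl _ => hc l hl with h1 | h1
        · exact hσ h1
        · exact hσ (by rw [h1, Equiv.swap_self]; rfl)
      rw [Finset.prod_eq_zero (i := l) (f := fun l => Matrix.diagonal d (σ l) l) (by simp [hl.1])
        (Matrix.diagonal_apply_ne d hl.2)]
      simp
    · simp
  have htwo : ∀ (i j : ι), j ≠ i → ∑ σ : Equiv.Perm ι,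
      ((Equiv.Perm.sign σ : ℤ) : ℝ[X]) * (B (σ i) i * B (σ j) j *
        ∏ l ∈ (univ.erase i).erase j, Matrix.diagonal d (σ l) l)
      = (B i i * B j j - B i j * B j i) * ∏ l ∈ (univ.erase i).erase j, d l := by
    intro i j hij
    rw [Fintype.sum_eq_add 1 (Equiv.swap i j)]
    · have hs : ∏ l ∈ (univ.erase i).erase j, Matrix.diagonal d (Equiv.swap i j l) l
          = ∏ l ∈ (univ.erase i).erase j, d l := by
        refine Finset.prod_congr rfl fun l hl => ?_
        simp only [Finset.mem_erase, Finset.mem_univ, and_true] at hl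
        rw [Equiv.swap_apply_of_ne_of_ne hl.2 hl.1]; simp
      rw [hs, Equiv.Perm.sign_swap hij.symm]
      simp
      ring
    · intro hc
      have := congrArg (fun τ : Equiv.Perm ι => τ i) hc
      simp at this
      exact hij this.symm
    · intro σ hσ
      obtain ⟨l, hl⟩ : ∃ l, (l ≠ i ∧ l ≠ j) ∧ σ l ≠ l := by
        by_contra hc
        push Not at hc
        rcases perm_eq_one_or_swap (σ := σ) (i := i) (j := j)
          fun l h1 h2 => hc l ⟨h1, h2⟩ with h1 | h1
        · exact hσ.1 h1
        · exact hσ.2 h1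
      rw [Finset.prod_eq_zero (i := l) (f := fun l => Matrix.diagonal d (σ l) l) (by simp [hl.1])
        (Matrix.diagonal_apply_ne d hl.2)]
      simp
  convert key using 1
  · rw [← Matrix.det_diagonal, Matrix.det_apply']
  · simp only [Finset.mul_sum]
    rw [Finset.sum_comm]
    refine Finset.sum_congr rfl fun i _ => ?_
    rw [hone i B]
  · simp only [mul_add, Finset.mul_sum, Finset.sum_add_distrib]
    congr 1
    · rw [Finset.sum_comm]
      exact Finset.sum_congr rfl fun i _ => (hone i C).symm
    · rw [Finset.sum_comm]
      refine Finset.sum_congr rfl fun i _ => ?_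
      rw [Finset.sum_comm]
      exact Finset.sum_congr rfl fun j hj => (htwo i j (Finset.ne_of_mem_erase hj)).symm

/-- The sum of the principal minors of order `k` of `M`, as a coefficient of `det (1 + X M)`. -/
noncomputable def msig (k : ℕ) (M : Matrix ι ι ℝ) : ℝ :=
  (Matrix.det (1 + (X : ℝ[X]) • M.map Polynomial.C)).coeff k

lemma msig_diagonal (k : ℕ) (x : ι → ℝ) : msig k (Matrix.diagonal x) = es x univ k := by
  rw [msig, es_eq_coeff]
  have : (1 + (X : ℝ[X]) • (Matrix.diagonal x).map Polynomial.C)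
      = Matrix.diagonal fun i => 1 + Polynomial.C (x i) * X := by
    ext1 i j
    by_cases hij : i = j
    · subst hij; simp [X_mul_C]
    · simp [hij]
  rw [this, Matrix.det_diagonal]

lemma jet2_msig {M : ℝ → Matrix ι ι ℝ} {M₁ M₂ : Matrix ι ι ℝ} {x : ι → ℝ}
    (h : ∀ i j, Jet2 (fun t => M t i j) (Matrix.diagonal x i j) (M₁ i j) (M₂ i j)) (k : ℕ) :
    Jet2 (fun t => msig (k + 2) (M t)) (es x univ (k + 2))
      (∑ i, M₁ i i * es x (univ.erase i) (k + 1))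
      (∑ i, M₂ i i * es x (univ.erase i) (k + 1) + ∑ i, ∑ j ∈ univ.erase i,
        (M₁ i i * M₁ j j - M₁ i j * M₁ j i) * es x ((univ.erase i).erase j) k) := by
  have hN : ∀ i j, PJet (fun t => (1 + (X : ℝ[X]) • (M t).map Polynomial.C) i j)
      (Matrix.diagonal (fun i => 1 + Polynomial.C (x i) * X) i j)
      ((Matrix.of fun i j => X * Polynomial.C (M₁ i j)) i j)
      ((Matrix.of fun i j => X * Polynomial.C (M₂ i j)) i j) := by
    intro i j l
    have e1 : Matrix.diagonal (fun i => 1 + Polynomial.C (x i) * X) i j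
        = (1 : Matrix ι ι ℝ[X]) i j + X * Polynomial.C (Matrix.diagonal x i j) := by
      by_cases hij : i = j
      · subst hij; simp [X_mul_C]
      · simp [hij]
    rw [e1]
    simp only [Matrix.add_apply, Matrix.smul_apply, Matrix.map_apply, smul_eq_mul, coeff_add,
      Matrix.of_apply]
    cases l with
    | zero => simpa using jet2_const _
    | succ l =>
      simp only [coeff_X_mul, coeff_C]
      split_ifs
      · simpa using (jet2_const _).add (h i j)
      · simpa using jet2_const _
  have key := PJet.det hN (k + 2)
  simp only [Matrix.of_apply, finsetSum_coeff, coeff_add] at key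
  unfold msig
  convert key using 1
  · exact es_eq_coeff x univ (k + 2)
  · refine Finset.sum_congr rfl fun i _ => ?_
    rw [mul_assoc, coeff_X_mul, coeff_C_mul, es_eq_coeff]
  · congr 1
    · refine Finset.sum_congr rfl fun i _ => ?_
      rw [mul_assoc, coeff_X_mul, coeff_C_mul, es_eq_coeff]
    · refine Finset.sum_congr rfl fun i _ => Finset.sum_congr rfl fun j _ => ?_
      rw [es_eq_coeff, show (X * Polynomial.C (M₁ i i) * (X * Polynomial.C (M₁ j j)) -
        X * Polynomial.C (M₁ i j) * (X * Polynomial.C (M₁ j i))) =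
        X * (X * Polynomial.C (M₁ i i * M₁ j j - M₁ i j * M₁ j i)) by
          simp only [map_sub, map_mul]; ring, mul_assoc, coeff_X_mul, mul_assoc, coeff_X_mul,
          coeff_C_mul]

end PolynomialJets

section Concavity

open Filter Topology

lemma es_const_mul {ι : Type*} (r : ℝ) (x : ι → ℝ) (S : Finset ι) (j : ℕ) :
    es (fun i => r * x i) S j = r ^ j * es x S j := by
  unfold es
  rw [Finset.mul_sum]
  refine Finset.sum_congr rfl fun s hs => ?_
  rw [Finset.prod_mul_distrib, Finset.prod_const, (Finset.mem_powersetCard.1 hs).2]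

lemma es_one_eq_sum {ι : Type*} [DecidableEq ι] (x : ι → ℝ) (S : Finset ι) : es x S 1 = ∑ i ∈ S, x i := by
  have := sum_mul_es_erase x S 0
  simp only [es_zero, mul_one] at this
  rw [this]; simp

variable {ι : Type*} [Fintype ι] [DecidableEq ι]

lemma jet2_es (x η : ι → ℝ) (k : ℕ) :
    Jet2 (fun t => es (fun i => x i + t * η i) univ (k + 2)) (es x univ (k + 2))
      (∑ i, η i * es x (univ.erase i) (k + 1))
      (∑ i, ∑ j ∈ univ.erase i, η i * η j * es x ((univ.erase i).erase j) k) := by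
  have h := jet2_msig (M := fun t => Matrix.diagonal fun i => x i + t * η i)
    (M₁ := Matrix.diagonal η) (M₂ := 0) (x := x) (fun i j => by
      by_cases hij : i = j
      · subst hij; simpa using jet2_affine (x i) (η i)
      · simpa [hij] using jet2_const 0) k
  simp only [msig_diagonal] at h
  convert h using 1
  · simp
  · simp only [Matrix.zero_apply, zero_mul, Finset.sum_const_zero, zero_add]
    refine Finset.sum_congr rfl fun i _ => Finset.sum_congr rfl fun j hj => ?_
    rw [Matrix.diagonal_apply_ne _ (Finset.ne_of_mem_erase hj).symm]
    simp

lemma exists_jet2_es (x η : ι → ℝ) (j : ℕ) :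
    ∃ b c, Jet2 (fun t => es (fun i => x i + t * η i) univ j) (es x univ j) b c := by
  match j with
  | 0 => exact ⟨0, 0, by simpa using jet2_const 1⟩
  | 1 =>
    simp only [es_one_eq_sum]
    exact ⟨_, _, Jet2.sum univ fun i _ => jet2_affine (x i) (η i)⟩
  | k + 2 => exact ⟨_, _, jet2_es x η k⟩

lemma Gam.eventually {x : ι → ℝ} {k : ℕ} (hx : Gam x univ k) (η : ι → ℝ) :
    ∀ᶠ t in 𝓝 (0 : ℝ), Gam (fun i => x i + t * η i) univ k := by
  have h : ∀ j ∈ Set.Iic k, ∀ᶠ t in 𝓝 (0 : ℝ), 0 < es (fun i => x i + t * η i) univ j := by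
    intro j hj
    obtain ⟨b, c, hjet⟩ := exists_jet2_es x η j
    have hc := hjet.hasDerivAt.continuousAt
    refine hc.eventually (lt_mem_nhds ?_)
    simpa using hx j hj
  exact ((Set.finite_Iic k).eventually_all.2 h).mono fun t ht j hj => ht j hj

lemma Gam.quotient_jet_nonpos {x : ι → ℝ} {k : ℕ} (hx : Gam x univ k) (η : ι → ℝ) {a b c : ℝ}
    (hq : Jet2 (fun t => es (fun i => x i + t * η i) univ (k + 1) *
      (es (fun i => x i + t * η i) univ k)⁻¹) a b c) : c ≤ 0 := by
  have hsum := hq.add hq.comp_neg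
  have hmax : IsLocalMax (fun t => es (fun i => x i + t * η i) univ (k + 1) *
      (es (fun i => x i + t * η i) univ k)⁻¹ + es (fun i => x i + -t * η i) univ (k + 1) *
      (es (fun i => x i + -t * η i) univ k)⁻¹) 0 := by
    have hc : Tendsto (fun t : ℝ => -t) (𝓝 0) (𝓝 0) := by
      simpa using (continuous_neg (G := ℝ)).tendsto 0
    filter_upwards [hx.eventually η, hc.eventually (hx.eventually η)] with t h1 h2
    have h3 := (h1.add_superadditive h2).2
    have e : (fun i => x i + t * η i) + (fun i => x i + -t * η i) = fun i => 2 * x i := by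
      ext i; simp only [Pi.add_apply]; ring
    rw [e, es_const_mul, es_const_mul, pow_succ] at h3
    have h0 := hx k le_rfl
    simp only [div_eq_mul_inv] at h3
    simp only [neg_zero, zero_mul, add_zero]
    refine h3.trans (le_of_eq ?_)
    have : (2 : ℝ) ^ k ≠ 0 := by positivity
    field_simp
    ring
  have := (hsum.of_isLocalMax hmax).2
  linarith

lemma Gam.jet_concave {x : ι → ℝ} {k : ℕ} (hx : Gam x univ k) (η : ι → ℝ) {b c : ℝ}
    (h : Jet2 (fun t => es (fun i => x i + t * η i) univ k) (es x univ k) b c) :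
    k * (es x univ k * c) ≤ (k - 1) * b ^ 2 := by
  induction k generalizing b c with
  | zero =>
    have h0 : Jet2 (fun t => es (fun i => x i + t * η i) univ 0) 1 0 0 := by
      simpa using jet2_const 1
    obtain ⟨-, rfl, rfl⟩ := h.unique h0
    simp
  | succ k ih =>
    obtain ⟨b₀, c₀, h₀⟩ := exists_jet2_es x η k
    have hx' := hx.mono k.le_succ
    have ih' := ih hx' h₀
    have hpos := hx' k le_rfl
    obtain ⟨b₁, c₁, h₁⟩ := h₀.inv hpos
    have hq := h.mul h₁
    have hc := hx'.quotient_jet_nonpos η hq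
    have hback := hq.mul h₀
    have hev : ∀ᶠ t in 𝓝 (0 : ℝ), es (fun i => x i + t * η i) univ (k + 1) *
        (es (fun i => x i + t * η i) univ k)⁻¹ * es (fun i => x i + t * η i) univ k
        = es (fun i => x i + t * η i) univ (k + 1) := by
      filter_upwards [hx'.eventually η] with t ht
      have := ht k le_rfl
      field_simp
    obtain ⟨e0, e1, e2⟩ := h.unique (hback.congr hev)
    have hq0 : 0 < es x univ (k + 1) * (es x univ k)⁻¹ := by
      have := hx (k + 1) le_rfl
      positivity
    generalize c * (es x univ k)⁻¹ + 2 * (b * b₁) + es x univ (k + 1) * c₁ = q₂ at *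
    generalize b * (es x univ k)⁻¹ + es x univ (k + 1) * b₁ = q₁ at *
    generalize es x univ (k + 1) * (es x univ k)⁻¹ = q₀ at *
    generalize es x univ k = s at *
    rw [e0, e1, e2]
    push_cast
    rcases Nat.eq_zero_or_pos k with rfl | hk
    · have h0 : Jet2 (fun t => es (fun i => x i + t * η i) univ 0) 1 0 0 := by
        simpa using jet2_const 1
      obtain ⟨rfl, rfl, rfl⟩ := h₀.unique h0
      norm_num
      nlinarith
    · have hk' : (1 : ℝ) ≤ k := by exact_mod_cast hk
      have a1 : q₀ * s * (q₂ * s) ≤ 0 := by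
        have : 0 ≤ q₀ * s * s * (-q₂) := mul_nonneg (by positivity) (by linarith)
        linarith
      have a2 : q₀ ^ 2 * (k * (s * c₀)) ≤ q₀ ^ 2 * ((k - 1) * b₀ ^ 2) := by gcongr
      have a3 : 0 ≤ (k * (q₁ * s) - q₀ * b₀) ^ 2 := sq_nonneg _
      have hk0 : (0 : ℝ) < k := by linarith
      refine le_of_mul_le_mul_left ?_ hk0
      nlinarith [mul_nonneg (mul_nonneg hk0.le (by linarith : (0 : ℝ) ≤ k + 1))
        (neg_nonneg.2 a1)]

/-- Concavity of `σ_{k+2}^{1/(k+2)}` on the Gårding cone, in infinitesimal form. -/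
lemma Gam.concave {x : ι → ℝ} {k : ℕ} (hx : Gam x univ (k + 2)) (η : ι → ℝ) :
    (k + 2) * (es x univ (k + 2) *
      ∑ i, ∑ j ∈ univ.erase i, η i * η j * es x ((univ.erase i).erase j) k)
      ≤ (k + 1) * (∑ i, η i * es x (univ.erase i) (k + 1)) ^ 2 := by
  have h := hx.jet_concave η (jet2_es x η k)
  push_cast at h
  convert h using 2; ring

end Concavity

section CofactorEstimates

variable {ι : Type*} [DecidableEq ι]

lemma Gam.sq_es_erase_erase_le {x : ι → ℝ} {T : Finset ι} {K : ℕ} {o p : ι} (ho : o ∈ T)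
    (hp : p ∈ T) (hop : o ≠ p) (h : Gam x T (K + 2)) :
    es x ((T.erase o).erase p) (K + 1) ^ 2
        ≤ (K + 2) * (es x (T.erase o) (K + 1) * es x (T.erase p) (K + 1)) ∧
      es x ((T.erase o).erase p) (K + 2) * es x ((T.erase o).erase p) K
        ≥ -(es x (T.erase o) (K + 1) * es x (T.erase p) (K + 1)) := by
  have hpo : p ∈ T.erase o := Finset.mem_erase.2 ⟨hop.symm, hp⟩
  have hop' : o ∈ T.erase p := Finset.mem_erase.2 ⟨hop, ho⟩
  have hA := h (K + 2) le_rfl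
  have h0 := (h.erase ho).erase hpo K le_rfl
  have hX := es_erase x hpo K
  have hX2 := es_erase x hpo (K + 1)
  have hD := es_erase x hop' K
  rw [Finset.erase_right_comm] at hD
  have hA' := es_erase x ho (K + 1)
  have hN := es_newton x ((T.erase o).erase p) K
  set e₀ := es x ((T.erase o).erase p) K
  set e₁ := es x ((T.erase o).erase p) (K + 1)
  set e₂ := es x ((T.erase o).erase p) (K + 2)
  have key : e₁ ^ 2 - e₂ * e₀ = es x (T.erase o) (K + 1) * es x (T.erase p) (K + 1)
      - e₀ * es x T (K + 2) := by
    rw [hA', hX2, hX, hD]; ring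
  have hpos : 0 < e₀ * es x T (K + 2) := mul_pos h0 hA
  constructor
  · have hK : (0 : ℝ) ≤ K + 2 := by positivity
    have := mul_le_mul_of_nonneg_left
      (show e₁ ^ 2 - e₂ * e₀ ≤ es x (T.erase o) (K + 1) * es x (T.erase p) (K + 1) by linarith) hK
    nlinarith
  · nlinarith [sq_nonneg e₁]

set_option maxHeartbeats 1000000 in
lemma exists_sq_es_erase_le (K : ℕ) {L δ : ℝ} (hL : 0 < L) (hδ : 0 < δ) :
    ∃ s : ℝ, 0 < s ∧ ∀ (x : ι → ℝ) (T : Finset ι) (o p : ι), o ∈ T → p ∈ T → o ≠ p → x o = L →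
      Gam x T (K + 2) → es x (T.erase o) (K + 1) ≤ s →
      es x (T.erase p) (K + 2) ^ 2 ≤ δ * es x (T.erase p) (K + 1) := by
  obtain ⟨C, hC, hcub⟩ := abs_es_le_of_ratio (ι := ι) (K - 1) (1 + L) (by positivity)
  set N : ℝ := K + 2 with hN
  have hN0 : 0 < N := by positivity
  set ρ : ℝ := min (1 / 2) (δ / (4 * C ^ 2)) with hρ
  have hρ0 : 0 < ρ := by positivity
  have hρ1 : ρ ≤ 1 / 2 := min_le_left _ _
  have hρ2 : 2 * C ^ 2 * ρ ≤ δ / 2 := by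
    have : ρ ≤ δ / (4 * C ^ 2) := min_le_right _ _
    rw [le_div_iff₀ (by positivity)] at this
    linarith
  set d : ℝ := min 1 (ρ * L ^ 2 / 4) with hd
  have hd0 : 0 < d := by positivity
  have hd1 : d ≤ 1 := min_le_left _ _
  have hd2 : d ≤ ρ * L ^ 2 / 4 := min_le_right _ _
  set s : ℝ := min (min (d / (4 * N)) (ρ * L ^ 2 / (4 * N)))
    (min (δ / (4 * L ^ 2 * N)) (min 1 (δ * d / (16 * L ^ 2 * N ^ 2)))) with hs
  have hs0 : 0 < s := by positivity
  refine ⟨s, hs0, fun x T o p ho hp hop hxo h hXs => ?_⟩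
  have hpo : p ∈ T.erase o := Finset.mem_erase.2 ⟨hop.symm, hp⟩
  have hop' : o ∈ T.erase p := Finset.mem_erase.2 ⟨hop, ho⟩
  obtain ⟨q1, q2⟩ := h.sq_es_erase_erase_le ho hp hop
  have hDpos := h.erase hp (K + 1) le_rfl
  have hXpos := h.erase ho (K + 1) le_rfl
  have hG := (h.erase ho).erase hpo
  have h0 := hG K le_rfl
  have hnewt := es_mul_le_sq x ((T.erase o).erase p) K
  have hD := es_erase x hop' K
  have hB := es_erase x hop' (K + 1)
  rw [Finset.erase_right_comm, hxo] at hD hB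
  have hX : ∀ b, s ≤ b → es x (T.erase o) (K + 1) ≤ b := fun b hb => hXs.trans hb
  have X1 : N * es x (T.erase o) (K + 1) ≤ d / 4 := by
    have := hX (d / (4 * N)) ((min_le_left _ _).trans (min_le_left _ _))
    rw [le_div_iff₀ (by positivity)] at this
    linarith
  have X2 : N * es x (T.erase o) (K + 1) ≤ ρ * L ^ 2 / 4 := by
    have := hX (ρ * L ^ 2 / (4 * N)) ((min_le_left _ _).trans (min_le_right _ _))
    rw [le_div_iff₀ (by positivity)] at this
    linarith
  have X3 : 2 * L ^ 2 * (N * es x (T.erase o) (K + 1)) ≤ δ / 2 := by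
    have := hX (δ / (4 * L ^ 2 * N)) ((min_le_right _ _).trans (min_le_left _ _))
    rw [le_div_iff₀ (by positivity)] at this
    linarith
  have X4 : es x (T.erase o) (K + 1) ≤ 1 :=
    hX 1 ((min_le_right _ _).trans ((min_le_right _ _).trans (min_le_left _ _)))
  have X5 : 8 * L ^ 2 * N ^ 2 * es x (T.erase o) (K + 1) ≤ δ * d / 2 := by
    have := hX (δ * d / (16 * L ^ 2 * N ^ 2))
      ((min_le_right _ _).trans ((min_le_right _ _).trans (min_le_right _ _)))
    rw [le_div_iff₀ (by positivity)] at this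
    linarith
  have hBsq : es x (T.erase p) (K + 2) ^ 2 ≤ 2 * es x ((T.erase o).erase p) (K + 2) ^ 2
      + 2 * L ^ 2 * es x ((T.erase o).erase p) (K + 1) ^ 2 := by
    rw [hB]
    nlinarith [sq_nonneg (es x ((T.erase o).erase p) (K + 2)
      - L * es x ((T.erase o).erase p) (K + 1))]
  have hsecond : 2 * L ^ 2 * es x ((T.erase o).erase p) (K + 1) ^ 2
      ≤ δ / 2 * es x (T.erase p) (K + 1) := by
    calc _ ≤ 2 * L ^ 2 * (N * (es x (T.erase o) (K + 1) * es x (T.erase p) (K + 1))) := by gcongr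
      _ = (2 * L ^ 2 * (N * es x (T.erase o) (K + 1))) * es x (T.erase p) (K + 1) := by ring
      _ ≤ _ := by gcongr
  suffices hfirst : 2 * es x ((T.erase o).erase p) (K + 2) ^ 2
      ≤ δ / 2 * es x (T.erase p) (K + 1) by linarith
  by_cases hcase : d ≤ es x (T.erase p) (K + 1)
  · clear hcub hBsq hsecond hB
    generalize es x ((T.erase o).erase p) K = e₀ at *
    generalize es x ((T.erase o).erase p) (K + 1) = e₁ at *
    generalize es x ((T.erase o).erase p) (K + 2) = e₂ at *
    generalize es x (T.erase o) (K + 1) = X at *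
    generalize es x (T.erase p) (K + 1) = D at *
    have a1 : |e₁| ≤ D / 2 := by
      apply abs_le_of_sq_le_sq _ (by positivity)
      calc e₁ ^ 2 ≤ (N * X) * D := by linarith
        _ ≤ d / 4 * D := by gcongr
        _ ≤ D / 4 * D := by gcongr
        _ = (D / 2) ^ 2 := by ring
    have a2 : D / (2 * L) ≤ e₀ := by
      rw [div_le_iff₀ (by positivity)]
      have := le_abs_self e₁
      linarith
    have a3 : |e₂| ≤ 2 * L * N * X := by
      have hub : e₂ * e₀ ≤ (2 * L * N * X) * e₀ := by
        calc e₂ * e₀ ≤ N * (X * D) := hnewt.trans q1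
          _ = (2 * L * N * X) * (D / (2 * L)) := by field_simp
          _ ≤ _ := by gcongr
      have hlb : -(2 * L * N * X) * e₀ ≤ e₂ * e₀ := by
        have : X * D ≤ (2 * L * N * X) * e₀ := by
          calc X * D = (2 * L * 1 * X) * (D / (2 * L)) := by field_simp
            _ ≤ (2 * L * N * X) * e₀ := by
              have hK : (0 : ℝ) ≤ K := by positivity
              have : (1 : ℝ) ≤ N := by linarith
              gcongr
        linarith
      rw [abs_le]
      exact ⟨le_of_mul_le_mul_right hlb h0, le_of_mul_le_mul_right hub h0⟩
    have a4 : e₂ ^ 2 ≤ (2 * L * N * X) ^ 2 := sq_le_sq' (abs_le.1 a3).1 (abs_le.1 a3).2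
    calc 2 * e₂ ^ 2 ≤ 2 * (2 * L * N * X) ^ 2 := by gcongr
      _ = (8 * L ^ 2 * N ^ 2 * X) * X := by ring
      _ ≤ (δ * d / 2) * 1 := by gcongr
      _ = δ / 2 * d := by ring
      _ ≤ _ := by gcongr
  · push Not at hcase
    have b1 : es x ((T.erase o).erase p) K ^ 2 ≤ ρ * es x (T.erase p) (K + 1) := by
      clear hcub hBsq hsecond hB hG
      generalize es x ((T.erase o).erase p) K = e₀ at *
      generalize es x ((T.erase o).erase p) (K + 1) = e₁ at *
      generalize es x (T.erase o) (K + 1) = X at *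
      generalize es x (T.erase p) (K + 1) = D at *
      have c1 : (L * e₀) ^ 2 ≤ 2 * D ^ 2 + 2 * e₁ ^ 2 := by
        rw [show L * e₀ = D - e₁ by linarith]
        nlinarith [sq_nonneg (D + e₁)]
      have c2 : e₁ ^ 2 ≤ ρ * L ^ 2 / 4 * D := by
        calc e₁ ^ 2 ≤ (N * X) * D := by linarith
          _ ≤ _ := by gcongr
      have c3 : D ^ 2 ≤ ρ * L ^ 2 / 4 * D := by
        calc D ^ 2 = D * D := by ring
          _ ≤ (ρ * L ^ 2 / 4) * D := by gcongr; linarith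
      have c4 : L ^ 2 * e₀ ^ 2 ≤ L ^ 2 * (ρ * D) := by
        calc L ^ 2 * e₀ ^ 2 = (L * e₀) ^ 2 := by ring
          _ ≤ _ := by linarith
      exact le_of_mul_le_mul_left c4 (by positivity)
    have b2 : es x ((T.erase o).erase p) K < 1 := by
      have : es x ((T.erase o).erase p) K ^ 2 < 1 := by
        refine b1.trans_lt ?_
        have : ρ * es x (T.erase p) (K + 1) ≤ 1 / 2 * 1 := by gcongr; linarith
        linarith
      nlinarith
    obtain _ | K := K
    · simp at b2
    have hcub' := hcub x ((T.erase o).erase p)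
    rw [Nat.add_sub_cancel] at hcub'
    have c1 := hG.succ_le_self b2.le
    have c2 := hG.succ_le_mul one_pos (by simpa using b2.le)
    have c3 : |es x ((T.erase o).erase p) (K + 3)| ≤ C * es x ((T.erase o).erase p) (K + 1) := by
      refine hcub' h0 c1 ?_
      rw [abs_le]
      have hLe : 0 < L * es x ((T.erase o).erase p) (K + 1) := mul_pos hL h0
      constructor <;> linarith
    have c4 : es x ((T.erase o).erase p) (K + 3) ^ 2
        ≤ (C * es x ((T.erase o).erase p) (K + 1)) ^ 2 :=
      sq_le_sq' (abs_le.1 c3).1 (abs_le.1 c3).2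
    calc 2 * es x ((T.erase o).erase p) (K + 1 + 2) ^ 2
        ≤ 2 * (C * es x ((T.erase o).erase p) (K + 1)) ^ 2 := by gcongr
      _ = 2 * C ^ 2 * es x ((T.erase o).erase p) (K + 1) ^ 2 := by ring
      _ ≤ 2 * C ^ 2 * (ρ * es x (T.erase p) (K + 1 + 1)) := by gcongr
      _ = (2 * C ^ 2 * ρ) * es x (T.erase p) (K + 1 + 1) := by ring
      _ ≤ _ := by gcongr

end CofactorEstimates

section KeyInequality

variable {ι : Type*} [DecidableEq ι] [Fintype ι]

lemma exists_cofactor_bounds (K : ℕ) {L C₀ ε δ : ℝ} (hL : 0 < L) (hε : 0 < ε)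
    (hδ : 0 < δ) : ∃ R : ℝ, 3 ≤ R ∧ ∀ (x : ι → ℝ) (o a : ι), o ≠ a → x o = L →
      Gam x univ (K + 3) → es x (univ.erase o) (K + 2) ≤ C₀ → R ≤ x a →
      |es x (univ.erase a) (K + 3)| ≤ ε ∧ ∀ p, p ≠ a → p ≠ o →
        es x ((univ.erase a).erase p) (K + 2) ^ 2
          ≤ δ * es x ((univ.erase a).erase p) (K + 1) := by
  obtain ⟨s, hs, hsq⟩ := exists_sq_es_erase_le (ι := ι) K hL hδ
  obtain ⟨C, hC, hcub⟩ := abs_es_le_of_ratio (ι := ι) K (1 + L) (by positivity)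
  set C' : ℝ := C + L * (1 + L) with hC'
  have hC'0 : 0 < C' := by positivity
  set r : ℝ := min (min s 1) (ε / C') with hr
  have hr0 : 0 < r := by positivity
  refine ⟨max (max 3 (2 * L)) (2 * C₀ / r), (le_max_left _ _).trans (le_max_left _ _),
    fun x o a hoa hxo hG hC₀x hR => ?_⟩
  have hR1 : 3 ≤ x a := ((le_max_left _ _).trans (le_max_left _ _)).trans hR
  have hR2 : 2 * L ≤ x a := ((le_max_right _ _).trans (le_max_left _ _)).trans hR
  have hR3 : 2 * C₀ / r ≤ x a := (le_max_right _ _).trans hR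
  have hoT : o ∈ univ.erase a := by simp [hoa]
  have haT : a ∈ univ.erase o := by simp [hoa.symm]
  have hGT := hG.erase (Finset.mem_univ a)
  have hGX := hGT.erase hoT
  have hXpos := hGX (K + 1) le_rfl
  have hApos := hGT (K + 2) le_rfl
  have hA := es_erase x hoT (K + 1)
  have hE := es_erase x hoT (K + 2)
  have hF := es_erase x haT (K + 1)
  rw [Finset.erase_right_comm] at hF
  rw [hxo] at hA hE
  have hXr : es x ((univ.erase a).erase o) (K + 1) ≤ r := by
    rw [div_le_iff₀ hr0] at hR3
    set X := es x ((univ.erase a).erase o) (K + 1)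
    have h1 : (x a - L) * X ≤ C₀ := by linarith
    have h2 : x a / 2 * X ≤ C₀ := by
      refine le_trans ?_ h1
      gcongr
      linarith
    have h3 : x a * X ≤ x a * r := by linarith
    exact le_of_mul_le_mul_left h3 (by linarith)
  have hX1 : es x ((univ.erase a).erase o) (K + 1) ≤ 1 :=
    hXr.trans ((min_le_left _ _).trans (min_le_right _ _))
  have hXs : es x ((univ.erase a).erase o) (K + 1) ≤ s :=
    hXr.trans ((min_le_left _ _).trans (min_le_left _ _))
  have hXε : C' * es x ((univ.erase a).erase o) (K + 1) ≤ ε := by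
    have := hXr.trans (min_le_right _ _)
    rw [le_div_iff₀ hC'0] at this
    linarith
  refine ⟨?_, fun p hpa hpo => ?_⟩
  · have c1 := hGX.succ_le_self hX1
    have c2 := hGX.succ_le_mul one_pos (by simpa using hX1)
    have hLX : 0 < L * es x ((univ.erase a).erase o) (K + 1) := mul_pos hL hXpos
    have c3 : |es x ((univ.erase a).erase o) (K + 2)|
        ≤ (1 + L) * es x ((univ.erase a).erase o) (K + 1) := by
      rw [abs_le]
      constructor <;> linarith
    have c4 := hcub x _ hXpos c1 c3
    rw [hE]
    calc _ ≤ |es x ((univ.erase a).erase o) (K + 3)|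
          + |L * es x ((univ.erase a).erase o) (K + 2)| := abs_add_le _ _
      _ = |es x ((univ.erase a).erase o) (K + 3)|
          + L * |es x ((univ.erase a).erase o) (K + 2)| := by rw [abs_mul, abs_of_pos hL]
      _ ≤ C * es x ((univ.erase a).erase o) (K + 1)
          + L * ((1 + L) * es x ((univ.erase a).erase o) (K + 1)) := by gcongr
      _ = C' * es x ((univ.erase a).erase o) (K + 1) := by rw [hC']; ring
      _ ≤ ε := hXε
  · exact hsq x _ o p hoT (by simp [hpa]) hpo.symm hxo hGT hXs

lemma neg_one_le_of_cofactor_bound {K : ℕ} {x : ι → ℝ} {a p : ι} (hG : Gam x univ (K + 3))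
    (hpa : p ≠ a) (h : es x ((univ.erase a).erase p) (K + 2) ^ 2
      ≤ es x ((univ.erase a).erase p) (K + 1)) : -1 ≤ x p := by
  have hpT : p ∈ univ.erase a := by simp [hpa]
  have hGT := hG.erase (Finset.mem_univ a)
  have hA := hGT (K + 2) le_rfl
  have hGp := hGT.erase hpT
  have hD := hGp (K + 1) le_rfl
  have hBD : es x ((univ.erase a).erase p) (K + 2) ≤ es x ((univ.erase a).erase p) (K + 1) := by
    rcases le_total (es x ((univ.erase a).erase p) (K + 1)) 1 with h1 | h1
    · simpa using hGp.succ_le_mul one_pos (by simpa using h1)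
    · nlinarith
  rw [es_erase x hpT (K + 1)] at hA
  by_contra! hc
  nlinarith

lemma key_inequality_aux {k m lam A F κ ξ Fη Fηη B T S V : ℝ} (hk : 1 ≤ k) (hm : 0 < m)
    (hlam : 0 < lam) (hF : m ≤ F) (hA : m ≤ 2 * (lam * A)) (hτ : 4 * k * (lam * A) ≤ (4 * k + 1) * F)
    (hκ : κ = A * ξ + Fη) (hS : Fη = lam * S + B) (hV : V = 2 * (ξ * S) + Fηη)
    (hconc : k * (F * Fηη) ≤ (k - 1) * Fη ^ 2)
    (hB : 8 * k * B ^ 2 ≤ m * T) :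
    A * ξ ^ 2 / lam ≤ (21 * k + 1) / m * κ ^ 2 - V + 2 * T := by
  have hF0 : 0 < F := hm.trans_le hF
  have hA0 : 0 < A := by
    by_contra! h
    nlinarith
  have hk0 : 0 < k := by linarith
  have h1 : lam * Fηη ≤ (1 - 1 / (2 * k)) * (A * ξ ^ 2) + (4 * k + 1) / m * lam * κ ^ 2 := by
    have e1 : Fη ^ 2 ≤ (1 + 1 / (4 * k)) * (A * ξ) ^ 2 + (1 + 4 * k) * κ ^ 2 := by
      rw [show Fη = κ - A * ξ by linarith]
      have : 0 ≤ (2 * k * κ * 2 + A * ξ) ^ 2 / (4 * k) := by positivity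
      have h2 : (2 * k * κ * 2 + A * ξ) ^ 2 / (4 * k)
        = 4 * k * κ ^ 2 + 2 * κ * (A * ξ) + 1 / (4 * k) * (A * ξ) ^ 2 := by field_simp; ring
      nlinarith
    have e2 : lam * Fηη ≤ (1 - 1 / k) * (lam / F) * Fη ^ 2 := by
      have : (1 - 1 / k) * (lam / F) * Fη ^ 2 = lam * ((k - 1) * Fη ^ 2) / (k * F) := by
        field_simp
      rw [this, le_div_iff₀ (by positivity)]
      have := mul_le_mul_of_nonneg_left hconc hlam.le
      linarith
    have hk1 : 0 ≤ 1 - 1 / k := by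
      rw [sub_nonneg, div_le_one hk0]; exact hk
    have e3 : (lam / F) * (A * ξ) ^ 2 ≤ (1 + 1 / (4 * k)) * (A * ξ ^ 2) := by
      have : lam * A / F ≤ 1 + 1 / (4 * k) := by
        rw [div_le_iff₀ hF0, show 1 + 1 / (4 * k) = (4 * k + 1) / (4 * k) by field_simp,
          div_mul_eq_mul_div, le_div_iff₀ (by positivity)]
        linarith
      calc (lam / F) * (A * ξ) ^ 2 = (lam * A / F) * (A * ξ ^ 2) := by ring
        _ ≤ _ := by gcongr
    have e4 : (lam / F) * κ ^ 2 ≤ (lam / m) * κ ^ 2 := by gcongr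
    have e5 : (1 - 1 / k) * ((1 + 1 / (4 * k)) * (1 + 1 / (4 * k))) ≤ 1 - 1 / (2 * k) := by
      have : (1 - 1 / (2 * k)) - (1 - 1 / k) * ((1 + 1 / (4 * k)) * (1 + 1 / (4 * k)))
          = (7 * k + 1) / (16 * k ^ 3) := by field_simp; ring
      have h3 : 0 ≤ (7 * k + 1) / (16 * k ^ 3) := by positivity
      linarith
    calc lam * Fηη ≤ (1 - 1 / k) * (lam / F) * Fη ^ 2 := e2
      _ ≤ (1 - 1 / k) * (lam / F) * ((1 + 1 / (4 * k)) * (A * ξ) ^ 2 + (1 + 4 * k) * κ ^ 2) := by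
        gcongr
      _ = (1 - 1 / k) * (1 + 1 / (4 * k)) * ((lam / F) * (A * ξ) ^ 2)
          + (1 - 1 / k) * ((1 + 4 * k) * ((lam / F) * κ ^ 2)) := by ring
      _ ≤ (1 - 1 / k) * (1 + 1 / (4 * k)) * ((1 + 1 / (4 * k)) * (A * ξ ^ 2))
          + 1 * ((1 + 4 * k) * ((lam / m) * κ ^ 2)) := by
        have : 1 - 1 / k ≤ 1 := by
          have : 0 ≤ 1 / k := by positivity
          linarith
        gcongr
      _ = ((1 - 1 / k) * ((1 + 1 / (4 * k)) * (1 + 1 / (4 * k)))) * (A * ξ ^ 2)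
          + 1 * ((1 + 4 * k) * ((lam / m) * κ ^ 2)) := by ring
      _ ≤ (1 - 1 / (2 * k)) * (A * ξ ^ 2) + 1 * ((1 + 4 * k) * ((lam / m) * κ ^ 2)) := by gcongr
      _ = _ := by ring
  have h2 : -(2 * (ξ * B)) ≤ 1 / (8 * k) * (A * ξ ^ 2) + 2 * lam * T := by
    have e1 : 8 * k * B ^ 2 / A ≤ 2 * lam * T := by
      rw [div_le_iff₀ hA0]
      have hT : 0 ≤ T := by
        by_contra! h
        nlinarith [sq_nonneg B, mul_pos hm (neg_pos.2 h), mul_nonneg hk0.le (sq_nonneg B)]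
      nlinarith [mul_le_mul_of_nonneg_right hA hT]
    have e2 : 0 ≤ (A * ξ + 8 * k * B) ^ 2 / (8 * k * A) := by positivity
    have e3 : (A * ξ + 8 * k * B) ^ 2 / (8 * k * A)
      = 1 / (8 * k) * (A * ξ ^ 2) + 2 * (ξ * B) + 8 * k * B ^ 2 / A := by field_simp; ring
    linarith
  have h3 : 2 * (ξ * κ) ≤ 1 / (8 * k) * (A * ξ ^ 2) + 16 * k / m * lam * κ ^ 2 := by
    have e1 : 8 * k * κ ^ 2 / A ≤ 16 * k / m * lam * κ ^ 2 := by
      have : 1 / A ≤ 2 * lam / m := by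
        rw [div_le_div_iff₀ hA0 hm]; linarith
      calc 8 * k * κ ^ 2 / A = 8 * k * κ ^ 2 * (1 / A) := by ring
        _ ≤ 8 * k * κ ^ 2 * (2 * lam / m) := by gcongr
        _ = _ := by ring
    have e2 : 0 ≤ (A * ξ - 8 * k * κ) ^ 2 / (8 * k * A) := by positivity
    have e3 : (A * ξ - 8 * k * κ) ^ 2 / (8 * k * A)
      = 1 / (8 * k) * (A * ξ ^ 2) - 2 * (ξ * κ) + 8 * k * κ ^ 2 / A := by field_simp; ring
    linarith
  have e4 : 1 / (8 * k) * (A * ξ ^ 2) = 1 / (2 * k) * (A * ξ ^ 2) / 4 := by ring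
  have e5 : 0 ≤ 1 / (2 * k) * (A * ξ ^ 2) := by positivity
  have e6 : 0 ≤ k / m * (lam * κ ^ 2) := by positivity
  have e7 : (21 * k + 1) / m * (lam * κ ^ 2) = (4 * k + 1) / m * lam * κ ^ 2
    + 16 * k / m * lam * κ ^ 2 + k / m * (lam * κ ^ 2) := by ring
  rw [div_le_iff₀ hlam]
  have e8 : lam * V = 2 * ξ * (κ - A * ξ - B) + lam * Fηη := by
    rw [hV]
    linear_combination (2 * ξ) * (-1) * (hκ + hS)
  have e9 : ((21 * k + 1) / m * κ ^ 2 - V + 2 * T) * lam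
    = (21 * k + 1) / m * (lam * κ ^ 2) - lam * V + 2 * lam * T := by ring
  rw [e9, e8, e7]
  linarith

/-- The concavity inequality that absorbs the third order terms in the direction of the largest
eigenvalue. -/
lemma exists_key_inequality (K : ℕ) {L C₀ m : ℝ} (hL : 0 < L) (hm : 0 < m) :
    ∃ R Q : ℝ, 3 ≤ R ∧ 0 < Q ∧ ∀ (x : ι → ℝ) (o a : ι), o ≠ a → x o = L →
      Gam x univ (K + 3) → es x (univ.erase o) (K + 2) ≤ C₀ → m ≤ es x univ (K + 3) → R ≤ x a →
      m ≤ 2 * (x a * es x (univ.erase a) (K + 2)) ∧ (∀ p, p ≠ a → p ≠ o → -1 ≤ x p) ∧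
      ∀ ξ : ι → ℝ, ξ o = 0 → es x (univ.erase a) (K + 2) * ξ a ^ 2 / x a ≤
        Q * (∑ i, ξ i * es x (univ.erase i) (K + 2)) ^ 2
        - (∑ i, ∑ j ∈ univ.erase i, ξ i * ξ j * es x ((univ.erase i).erase j) (K + 1))
        + 2 * ∑ p ∈ univ.erase a, es x ((univ.erase a).erase p) (K + 1) * ξ p ^ 2 := by
  set k : ℝ := K + 3 with hk
  have hk1 : 1 ≤ k := by
    have : (0 : ℝ) ≤ K := by positivity
    linarith
  have hk0 : 0 < k := by linarith
  set N : ℝ := (Fintype.card ι : ℝ) + 1 with hN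
  have hN0 : 0 < N := by positivity
  set δ : ℝ := min 1 (m / (8 * k * N)) with hδ
  have hδ0 : 0 < δ := by positivity
  obtain ⟨R, hR3, hR⟩ := exists_cofactor_bounds (ι := ι) K hL (C₀ := C₀) (ε := m / (4 * k))
    (by positivity) hδ0
  refine ⟨R, (21 * k + 1) / m, hR3, by positivity, fun x o a hoa hxo hG hC₀x hmF hRx => ?_⟩
  obtain ⟨hE, hB⟩ := hR x o a hoa hxo hG hC₀x hRx
  have hlam : 0 < x a := by linarith
  have hGT := hG.erase (Finset.mem_univ a)
  have hDpos : ∀ p, p ≠ a → 0 < es x ((univ.erase a).erase p) (K + 1) := fun p hp =>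
    hGT.erase (by simp [hp]) (K + 1) le_rfl
  have hF := es_erase x (Finset.mem_univ a) (K + 2)
  have hE1 := abs_le.1 hE
  have hmk : m / (4 * k) * (4 * k) = m := by field_simp
  have hA : m ≤ 2 * (x a * es x (univ.erase a) (K + 2)) := by
    have : m / (4 * k) ≤ m / 2 := by
      apply div_le_div_of_nonneg_left hm.le (by norm_num); linarith
    linarith
  refine ⟨hA, fun p hpa hpo => neg_one_le_of_cofactor_bound hG hpa ?_, fun ξ hξo => ?_⟩
  · refine (hB p hpa hpo).trans ?_
    have := hDpos p hpa
    nlinarith [min_le_left 1 (m / (8 * k * N))]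
  set η : ι → ℝ := Function.update ξ a 0 with hη
  have hηa : η a = 0 := by simp [hη]
  have hηp : ∀ p, p ≠ a → η p = ξ p := fun p hp => by simp [hη, hp]
  have hηT : ∀ p ∈ univ.erase a, η p = ξ p := fun p hp => hηp p (Finset.ne_of_mem_erase hp)
  have hsplit : ∀ g : ι → ℝ, ∑ i, g i = g a + ∑ i ∈ univ.erase a, g i := fun g =>
    (Finset.add_sum_erase univ g (Finset.mem_univ a)).symm
  have hconc := hG.concave (k := K + 1) η
  refine key_inequality_aux (F := es x univ (K + 3))
    (Fη := ∑ i, η i * es x (univ.erase i) (K + 2))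
    (Fηη := ∑ i, ∑ j ∈ univ.erase i, η i * η j * es x ((univ.erase i).erase j) (K + 1))
    (B := ∑ p ∈ univ.erase a, es x ((univ.erase a).erase p) (K + 2) * ξ p)
    (S := ∑ p ∈ univ.erase a, es x ((univ.erase a).erase p) (K + 1) * ξ p)
    hk1 hm hlam hmF hA ?_ ?_ ?_ ?_ ?_ ?_
  · have := hE1.1
    have h2 : x a * es x (univ.erase a) (K + 2) ≤ es x univ (K + 3) + m / (4 * k) := by linarith
    have h3 : 4 * k * (x a * es x (univ.erase a) (K + 2))
        ≤ 4 * k * (es x univ (K + 3) + m / (4 * k)) := by gcongr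
    linarith
  · rw [hsplit, hsplit (fun i => η i * es x (univ.erase i) (K + 2)), hηa, zero_mul, zero_add,
      mul_comm (ξ a)]
    congr 1
    exact Finset.sum_congr rfl fun p hp => by rw [hηT p hp]
  · rw [hsplit, hηa, zero_mul, zero_add, Finset.mul_sum, ← Finset.sum_add_distrib]
    refine Finset.sum_congr rfl fun p hp => ?_
    have hpa : a ∈ univ.erase p := by simp [(Finset.ne_of_mem_erase hp).symm]
    rw [hηT p hp, es_erase x hpa (K + 1), Finset.erase_right_comm]
    ring
  · have inner : ∀ (ζ : ι → ℝ), ∑ i, ∑ j ∈ univ.erase i,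
        ζ i * ζ j * es x ((univ.erase i).erase j) (K + 1)
        = 2 * (ζ a * ∑ p ∈ univ.erase a, es x ((univ.erase a).erase p) (K + 1) * ζ p)
          + ∑ i ∈ univ.erase a, ∑ j ∈ (univ.erase i).erase a,
            ζ i * ζ j * es x ((univ.erase i).erase j) (K + 1) := by
      intro ζ
      rw [hsplit]
      have h1 : ∀ i ∈ univ.erase a, ∑ j ∈ univ.erase i,
          ζ i * ζ j * es x ((univ.erase i).erase j) (K + 1)
          = ζ a * (es x ((univ.erase a).erase i) (K + 1) * ζ i)
            + ∑ j ∈ (univ.erase i).erase a,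
              ζ i * ζ j * es x ((univ.erase i).erase j) (K + 1) := by
        intro i hi
        have hai : a ∈ univ.erase i := by simp [(Finset.ne_of_mem_erase hi).symm]
        rw [← Finset.add_sum_erase _ _ hai, Finset.erase_right_comm]
        congr 1
        ring
      rw [Finset.sum_congr rfl h1, Finset.sum_add_distrib, ← Finset.mul_sum]
      have h2 : ∑ j ∈ univ.erase a, ζ a * ζ j * es x ((univ.erase a).erase j) (K + 1)
          = ζ a * ∑ p ∈ univ.erase a, es x ((univ.erase a).erase p) (K + 1) * ζ p := by
        rw [Finset.mul_sum]
        exact Finset.sum_congr rfl fun j _ => by ring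
      rw [h2]; ring
    rw [inner ξ, inner η, hηa, zero_mul, mul_zero, zero_add]
    congr 1
    refine Finset.sum_congr rfl fun i hi => Finset.sum_congr rfl fun j hj => ?_
    rw [hηT i hi, hηp j (Finset.ne_of_mem_erase hj)]
  · push_cast at hconc
    convert hconc using 2
    · rw [hk]; ring
    · rw [hk]; ring
  · have h1 : (∑ p ∈ univ.erase a, es x ((univ.erase a).erase p) (K + 2) * ξ p) ^ 2
        ≤ N * ∑ p ∈ univ.erase a, (es x ((univ.erase a).erase p) (K + 2) * ξ p) ^ 2 := by
      refine sq_sum_le_card_mul_sum_sq.trans ?_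
      have : ((univ.erase a).card : ℝ) ≤ N := by
        have : (univ.erase a).card ≤ Fintype.card ι := Finset.card_le_univ _
        rw [hN]
        have : ((univ.erase a).card : ℝ) ≤ Fintype.card ι := by exact_mod_cast this
        linarith
      gcongr
    have h2 : ∑ p ∈ univ.erase a, (es x ((univ.erase a).erase p) (K + 2) * ξ p) ^ 2
        ≤ δ * ∑ p ∈ univ.erase a, es x ((univ.erase a).erase p) (K + 1) * ξ p ^ 2 := by
      rw [Finset.mul_sum]
      refine Finset.sum_le_sum fun p hp => ?_
      by_cases hpo : p = o
      · rw [hpo, hξo]; simp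
      · rw [mul_pow, ← mul_assoc]
        gcongr
        exact hB p (Finset.ne_of_mem_erase hp) hpo
    have hT : 0 ≤ ∑ p ∈ univ.erase a, es x ((univ.erase a).erase p) (K + 1) * ξ p ^ 2 :=
      Finset.sum_nonneg fun p hp =>
        mul_nonneg (hDpos p (Finset.ne_of_mem_erase hp)).le (sq_nonneg _)
    have hδm : 8 * k * (N * δ) ≤ m := by
      have : δ ≤ m / (8 * k * N) := min_le_right _ _
      rw [le_div_iff₀ (by positivity)] at this
      linarith
    generalize ∑ p ∈ univ.erase a, es x ((univ.erase a).erase p) (K + 1) * ξ p ^ 2 = T at *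
    calc _ ≤ 8 * k * (N * (δ * T)) := by
          gcongr; exact h1.trans (by gcongr)
      _ = (8 * k * (N * δ)) * T := by ring
      _ ≤ m * T := by gcongr

end KeyInequality

section MaximumPointAlgebra

lemma exists_weight {lam Δ A Dp Fp : ℝ} (hlam : 3 ≤ lam) (hΔ : 0 ≤ Δ) (hΔ' : Δ ≤ lam + 1)
    (hA : 0 < A) (hD : 0 < Dp) (hF : Fp = A + Δ * Dp) :
    ∃ w g : ℝ, g = 4 * w - 2 * Δ * w ^ 2 ∧ 2 * Dp ≤ g * Fp ∧
      3 / 2 * Fp / lam ≤ 2 * Dp + A * g := by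
  have hl : 0 < lam := by linarith
  rcases hΔ.eq_or_lt with h0 | h0
  · subst h0
    refine ⟨Dp / (2 * A) + 1, 4 * (Dp / (2 * A) + 1), by ring, ?_, ?_⟩
    · rw [hF]
      have : 4 * (Dp / (2 * A) + 1) * (A + 0 * Dp) = 2 * Dp + 4 * A := by field_simp; ring
      linarith
    · rw [hF, div_le_iff₀ hl]
      have : A * (4 * (Dp / (2 * A) + 1)) = 2 * Dp + 4 * A := by field_simp; ring
      rw [this]
      nlinarith [mul_pos hD hl, mul_pos hA hl]
  · refine ⟨1 / Δ, 2 / Δ, by field_simp; ring, ?_, ?_⟩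
    · rw [hF, div_mul_eq_mul_div, le_div_iff₀ h0]
      nlinarith
    · have : 2 * Dp + A * (2 / Δ) = 2 * Fp / Δ := by rw [hF]; field_simp; ring
      have hFp : 0 < Fp := by rw [hF]; positivity
      rw [this, div_le_div_iff₀ hl h0]
      nlinarith [mul_pos hFp hl]

/-- Summation of the second order conditions at a maximum point of the Pogorelov test function,
after the third order terms have been discarded. -/
lemma le_of_summed_second_order {m C M Q N β U lam A va V h SP b₀ : ℝ} (hm : 0 < m)
    (hN : 0 < N) (hβ : 0 < β) (hC : 0 < C) (hQ : 0 < Q)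
    (hU : 0 < U) (hUM : U ≤ M) (hlam : 1 ≤ lam) (hA : m ≤ 2 * (lam * A))
    (hA0 : 0 < A) (hva : |va| ≤ M)
    (hNC : 16 * (2 * C + 4 * Q * C ^ 2) ≤ N * m)
    (hbig : 2 * β * M ^ 2 ≤ N * (U * lam) ^ 2)
    (hh : |h| ≤ 2 * C * lam) (hV : |V| ≤ C) (hSP : |SP| ≤ C)
    (hb₀ : b₀ ≤ C)
    (H : -(β * b₀ / U) - β * A * va ^ 2 / U ^ 2 - C * (1 + lam ^ 2) / lam - Q * h ^ 2 / lam
      + N * (A * lam ^ 2) + N * V + β * SP / U ≤ 0) :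
    U * lam ≤ 8 * (2 * β * C + N * C * M) / (N * m) := by
  have hl : 0 < lam := by linarith
  have h1 : β * A * va ^ 2 / U ^ 2 ≤ N / 2 * (A * lam ^ 2) := by
    rw [div_le_iff₀ (by positivity)]
    have : va ^ 2 ≤ M ^ 2 := sq_le_sq' (by linarith [abs_le.1 hva]) (abs_le.1 hva).2
    calc β * A * va ^ 2 ≤ β * A * M ^ 2 := by gcongr
      _ = A / 2 * (2 * β * M ^ 2) := by ring
      _ ≤ A / 2 * (N * (U * lam) ^ 2) := by gcongr
      _ = _ := by ring
  have h2 : C * (1 + lam ^ 2) / lam ≤ 2 * C * lam := by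
    rw [div_le_iff₀ hl]
    have : 1 ≤ lam ^ 2 := one_le_pow₀ hlam
    nlinarith [mul_le_mul_of_nonneg_left this hC.le]
  have h3 : Q * h ^ 2 / lam ≤ 4 * Q * C ^ 2 * lam := by
    rw [div_le_iff₀ hl]
    have : h ^ 2 ≤ (2 * C * lam) ^ 2 := sq_le_sq' (by linarith [abs_le.1 hh]) (abs_le.1 hh).2
    calc Q * h ^ 2 ≤ Q * (2 * C * lam) ^ 2 := by gcongr
      _ = _ := by ring
  have h4 : m / 2 * lam ≤ A * lam ^ 2 := by nlinarith
  have h5 : N * V ≥ - (N * C) := by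
    have := (abs_le.1 hV).1
    nlinarith
  have h6 : β * SP / U ≥ - (β * C / U) := by
    rw [ge_iff_le, ← neg_div]
    gcongr
    have := (abs_le.1 hSP).1
    nlinarith
  have h7 : β * b₀ / U ≤ β * C / U := by gcongr
  have h8 : N * m / 4 * lam ≤ 2 * (β * C / U) + (2 * C + 4 * Q * C ^ 2) * lam + N * C := by
    have := mul_le_mul_of_nonneg_left h4 (half_pos hN).le
    linarith
  have h9 : N * m / 8 * lam ≤ 2 * (β * C / U) + N * C := by
    have := mul_le_mul_of_nonneg_right hNC hl.le
    have := mul_pos (mul_pos hN hm) hl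
    linarith
  rw [le_div_iff₀ (by positivity)]
  have h10 := mul_le_mul_of_nonneg_right h9 hU.le
  have h11 : (2 * (β * C / U) + N * C) * U = 2 * β * C + N * C * U := by field_simp
  have h12 : N * C * U ≤ N * C * M := by gcongr
  linarith

variable {ι : Type*} [Fintype ι] [DecidableEq ι]

lemma third_order_bound {K : ℕ} {x g : ι → ℝ} {t : ι → ι → ι → ℝ} {a : ι} {Q h lam : ℝ}
    (hG : Gam x univ (K + 3))
    (t₁ : ∀ i j l, t i j l = t j i l) (t₂ : ∀ i j l, t i j l = t i l j)
    (hga : g a = 0) (hg : ∀ p, 0 ≤ g p)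
    (hg₁ : ∀ p, p ≠ a → ∀ i, 2 * es x ((univ.erase a).erase p) (K + 1) * t a p i ^ 2
      ≤ g p * es x (univ.erase p) (K + 2) * t a p i ^ 2)
    (hg₂ : ∀ p, p ≠ a → 3 / 2 * es x (univ.erase p) (K + 2) / lam * t a p a ^ 2
      ≤ (2 * es x ((univ.erase a).erase p) (K + 1)
        + es x (univ.erase a) (K + 2) * g p) * t a p a ^ 2)
    (key : es x (univ.erase a) (K + 2) * t a a a ^ 2 / lam ≤ Q * h ^ 2
      - (∑ i, ∑ j ∈ univ.erase i, t i i a * t j j a * es x ((univ.erase i).erase j) (K + 1))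
      + 2 * ∑ p ∈ univ.erase a, es x ((univ.erase a).erase p) (K + 1) * t p p a ^ 2) :
    es x (univ.erase a) (K + 2) * t a a a ^ 2 / lam
      + ∑ p ∈ univ.erase a, 3 / 2 * es x (univ.erase p) (K + 2) / lam * t a p a ^ 2
    ≤ Q * h ^ 2
      - (∑ i, ∑ j ∈ univ.erase i,
          (t i i a * t j j a - t i j a ^ 2) * es x ((univ.erase i).erase j) (K + 1))
      + ∑ i, es x (univ.erase i) (K + 2) * ∑ p, g p * t a p i ^ 2 := by
  have hE : ∀ i, ∀ j ∈ univ.erase i, 0 ≤ es x ((univ.erase i).erase j) (K + 1) := fun i j hj =>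
    (((hG.erase (mem_univ i)).erase hj) (K + 1) le_rfl).le
  have hA : ∀ i, 0 ≤ es x (univ.erase i) (K + 2) := fun i =>
    ((hG.erase (mem_univ i)) (K + 2) le_rfl).le
  have h1 : ∑ i, ∑ j ∈ univ.erase i,
        (t i i a * t j j a - t i j a ^ 2) * es x ((univ.erase i).erase j) (K + 1)
      = (∑ i, ∑ j ∈ univ.erase i, t i i a * t j j a * es x ((univ.erase i).erase j) (K + 1))
        - ∑ i, ∑ j ∈ univ.erase i, t i j a ^ 2 * es x ((univ.erase i).erase j) (K + 1) := by
    simp only [sub_mul, Finset.sum_sub_distrib]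
  have h2 : ∑ p ∈ univ.erase a, 2 * es x ((univ.erase a).erase p) (K + 1) * t a p a ^ 2
      ≤ ∑ i, ∑ j ∈ univ.erase i, t i j a ^ 2 * es x ((univ.erase i).erase j) (K + 1) := by
    rw [← Finset.add_sum_erase _ _ (mem_univ a)]
    have h3 : ∑ p ∈ univ.erase a, es x ((univ.erase a).erase p) (K + 1) * t a p a ^ 2
        ≤ ∑ i ∈ univ.erase a, ∑ j ∈ univ.erase i,
          t i j a ^ 2 * es x ((univ.erase i).erase j) (K + 1) := by
      refine Finset.sum_le_sum fun p hp => ?_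
      have hap : a ∈ univ.erase p := by simp [(Finset.ne_of_mem_erase hp).symm]
      refine le_trans (le_of_eq ?_) (Finset.single_le_sum
        (f := fun j => t p j a ^ 2 * es x ((univ.erase p).erase j) (K + 1))
        (fun j hj => mul_nonneg (sq_nonneg _) (hE p j hj)) hap)
      rw [Finset.erase_right_comm, t₁ p a a, mul_comm]
    have h4 : ∑ p ∈ univ.erase a, 2 * es x ((univ.erase a).erase p) (K + 1) * t a p a ^ 2
        = ∑ j ∈ univ.erase a, t a j a ^ 2 * es x ((univ.erase a).erase j) (K + 1)
          + ∑ p ∈ univ.erase a, es x ((univ.erase a).erase p) (K + 1) * t a p a ^ 2 := by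
      rw [← Finset.sum_add_distrib]
      exact Finset.sum_congr rfl fun p _ => by ring
    linarith
  have h5 : ∑ p ∈ univ.erase a, g p * (es x (univ.erase a) (K + 2) * t a p a ^ 2
        + es x (univ.erase p) (K + 2) * t a p p ^ 2)
      ≤ ∑ i, es x (univ.erase i) (K + 2) * ∑ p, g p * t a p i ^ 2 := by
    have : ∑ i, es x (univ.erase i) (K + 2) * ∑ p, g p * t a p i ^ 2
        = ∑ p, g p * ∑ i, es x (univ.erase i) (K + 2) * t a p i ^ 2 := by
      simp only [Finset.mul_sum]
      rw [Finset.sum_comm]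
      exact Finset.sum_congr rfl fun p _ => Finset.sum_congr rfl fun i _ => by ring
    rw [this, ← Finset.add_sum_erase _ _ (mem_univ a), hga, zero_mul, zero_add]
    refine Finset.sum_le_sum fun p hp => mul_le_mul_of_nonneg_left ?_ (hg p)
    rw [← Finset.add_sum_erase _ _ (mem_univ a)]
    gcongr
    exact Finset.single_le_sum (f := fun i => es x (univ.erase i) (K + 2) * t a p i ^ 2)
      (fun i _ => mul_nonneg (hA i) (sq_nonneg _)) hp
  have h6 : 2 * ∑ p ∈ univ.erase a, es x ((univ.erase a).erase p) (K + 1) * t p p a ^ 2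
        + ∑ p ∈ univ.erase a, 3 / 2 * es x (univ.erase p) (K + 2) / lam * t a p a ^ 2
      ≤ ∑ p ∈ univ.erase a, 2 * es x ((univ.erase a).erase p) (K + 1) * t a p a ^ 2
        + ∑ p ∈ univ.erase a, g p * (es x (univ.erase a) (K + 2) * t a p a ^ 2
          + es x (univ.erase p) (K + 2) * t a p p ^ 2) := by
    rw [Finset.mul_sum, ← Finset.sum_add_distrib, ← Finset.sum_add_distrib]
    refine Finset.sum_le_sum fun p hp => ?_
    have e : t p p a = t a p p := by rw [t₂ p p a, t₁ p a p]
    have := hg₁ p (Finset.ne_of_mem_erase hp) p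
    have := hg₂ p (Finset.ne_of_mem_erase hp)
    rw [e]
    linarith
  linarith

end MaximumPointAlgebra

section PogorelovBound

variable {ι : Type*} [Fintype ι] [DecidableEq ι]

lemma absorb_gradient {β N M U v y z x : ℝ} (hβ : 4 ≤ β) (hN : 0 < N) (hβN : 4 * N * M ^ 2 ≤ β)
    (hv : |v| ≤ M) (hz : z = N * (v * x)) (h : -(β * v / U) + y + z = 0) :
    β * (v ^ 2 / U ^ 2) ≤ y ^ 2 / 2 + N * x ^ 2 := by
  have hβ0 : 0 < β := by linarith
  have e : β * (v ^ 2 / U ^ 2) = (y + z) ^ 2 / β := by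
    have : y + z = β * v / U := by linarith
    rw [this, eq_div_iff hβ0.ne', div_pow, mul_pow]
    ring
  have hv2 : v ^ 2 ≤ M ^ 2 := sq_le_sq' (by linarith [abs_le.1 hv]) (abs_le.1 hv).2
  have hz2 : z ^ 2 ≤ β * (N * x ^ 2) / 4 := by
    rw [hz]
    calc (N * (v * x)) ^ 2 = N ^ 2 * x ^ 2 * v ^ 2 := by ring
      _ ≤ N ^ 2 * x ^ 2 * M ^ 2 := by gcongr
      _ = (4 * N * M ^ 2) * (N * x ^ 2) / 4 := by ring
      _ ≤ β * (N * x ^ 2) / 4 := by gcongr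
  rw [e, div_le_iff₀ hβ0]
  have hx : 0 ≤ β * (N * x ^ 2) := by positivity
  nlinarith [sq_nonneg (y - z), mul_le_mul_of_nonneg_right hβ (sq_nonneg y)]

set_option maxHeartbeats 1000000 in
/-- The second order conditions at a maximum point of the Pogorelov test function bound
`U * x a`, where `U = -u` and `x a` is the largest eigenvalue of the Hessian. -/
lemma exists_pogorelov_bound (K : ℕ) {L C₀ m C M : ℝ} (hL : 0 < L) (hm : 0 < m)
    (hC : 0 < C) (hM : 0 < M) :
    ∃ N β B : ℝ, 0 < N ∧ 1 ≤ β ∧ 0 < B ∧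
      ∀ (x v s P q : ι → ℝ) (t : ι → ι → ι → ℝ) (U r : ℝ) (o a : ι), o ≠ a → x o = L →
      Gam x univ (K + 3) → es x (univ.erase o) (K + 2) ≤ C₀ → m ≤ es x univ (K + 3) →
      (K + 3) * es x univ (K + 3) ≤ C → (∀ p, p ≠ o → x p ≤ x a) → 0 < U → U ≤ M →
      (∀ i, |v i| ≤ M) → (∀ i j l, t i j l = t j i l) → (∀ i j l, t i j l = t i l j) →
      (∀ i j, t o i j = 0) → q o = 0 → v o = 0 →
      (∀ i, i ≠ o → -(β * v i / U) + t a a i / x a + N * (v i * x i) = 0) →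
      (∀ i, i ≠ o → ∀ c : ι → ℝ, c o = 0 → c a = 0 →
        β * (-(x i / U) - v i ^ 2 / U ^ 2)
          + (q i + 4 * ∑ p, c p * t a p i + 2 * ∑ p, c p ^ 2 * x p) / x a - (t a a i / x a) ^ 2
          - 2 * ∑ p, c p ^ 2 + N * (x i ^ 2 + ∑ j, v j * t j i i) ≤ 0) →
      (∀ j, j ≠ o → ∑ i, t i i j * es x (univ.erase i) (K + 2) = s j + x j * P j) →
      (∑ i, q i * es x (univ.erase i) (K + 2) + ∑ i, ∑ j ∈ univ.erase i,
        (t i i a * t j j a - t i j a ^ 2) * es x ((univ.erase i).erase j) (K + 1) = r) →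
      -(C * (1 + x a ^ 2)) + ∑ l, P l * t a a l ≤ r →
      |s a| ≤ C → |P a| ≤ C → |∑ j, v j * s j| ≤ C → |∑ l, P l * v l| ≤ C →
      U * x a ≤ B := by
  obtain ⟨R, Q, hR, hQ, key⟩ := exists_key_inequality (ι := ι) K hL (C₀ := C₀) hm
  set N : ℝ := 16 * (2 * C + 4 * Q * C ^ 2) / m with hNdef
  have hN : 0 < N := by positivity
  set β : ℝ := max 4 (4 * N * M ^ 2)
  have hβ4 : 4 ≤ β := le_max_left _ _
  have hβN : 4 * N * M ^ 2 ≤ β := le_max_right _ _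
  have hβ : 0 < β := by linarith
  set B : ℝ := R * M + 8 * (2 * β * C + N * C * M) / (N * m) + (2 * β * M ^ 2 / N + 1) with hB
  have hB₁ : 0 < R * M := by positivity
  have hB₂ : 0 < 8 * (2 * β * C + N * C * M) / (N * m) := by positivity
  have hB₃ : 0 < 2 * β * M ^ 2 / N := by positivity
  refine ⟨N, β, B, hN, by linarith, by positivity, ?_⟩
  intro x v s P q t U r o a hoa hxo hG hA0 hmE hEC hmax hU hUM hv t₁ t₂ hto hqo hvo hcrit hhess
    eq₁ eq₂ hr hsa hPa hvs hPv
  by_contra! hcon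
  have hRx : R ≤ x a := by
    by_contra! h
    have : U * x a ≤ R * M := by
      calc U * x a ≤ U * R := by gcongr
        _ ≤ M * R := by gcongr
        _ = R * M := by ring
    linarith
  have hl3 : 3 ≤ x a := hR.trans hRx
  have hl : 0 < x a := by linarith
  obtain ⟨hmA, hlow, hkey⟩ := key x o a hoa hxo hG hA0 hmE hRx
  have hA : ∀ i, 0 < es x (univ.erase i) (K + 2) := fun i =>
    (hG.erase (mem_univ i)) (K + 2) le_rfl
  have hDpos : ∀ p, p ≠ a → 0 < es x ((univ.erase a).erase p) (K + 1) := fun p hp =>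
    ((hG.erase (mem_univ a)).erase (i := p) (by simp [hp])) (K + 1) le_rfl
  have hAp : ∀ p, p ≠ a → es x (univ.erase p) (K + 2) = es x (univ.erase a) (K + 2)
      + (x a - x p) * es x ((univ.erase a).erase p) (K + 1) := by
    intro p hp
    have hap : a ∈ univ.erase p := by simp [hp.symm]
    have hpa : p ∈ univ.erase a := by simp [hp]
    rw [es_erase x hap (K + 1), es_erase x hpa (K + 1), Finset.erase_right_comm]
    ring
  have hwt : ∀ p, ∃ w g : ℝ, (p = a ∨ p = o → w = 0 ∧ g = 0) ∧
      g = 4 * w - 2 * (x a - x p) * w ^ 2 ∧ (p ≠ a → p ≠ o →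
      2 * es x ((univ.erase a).erase p) (K + 1) ≤ g * es x (univ.erase p) (K + 2) ∧
      3 / 2 * es x (univ.erase p) (K + 2) / x a ≤ 2 * es x ((univ.erase a).erase p) (K + 1)
        + es x (univ.erase a) (K + 2) * g) := by
    intro p
    by_cases hp : p = a ∨ p = o
    · exact ⟨0, 0, fun _ => ⟨rfl, rfl⟩, by ring, fun h1 h2 => absurd hp (by tauto)⟩
    · push Not at hp
      obtain ⟨w, g, h1, h2, h3⟩ := exists_weight hl3 (sub_nonneg.2 (hmax p hp.2))
        (by linarith [hlow p hp.1 hp.2]) (hA a) (hDpos p hp.1) (hAp p hp.1)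
      exact ⟨w, g, fun h => absurd h (by tauto), h1, fun _ _ => ⟨h2, h3⟩⟩
  choose w g hw0 hgw hwg using hwt
  have hta : ∀ i, t a o i = 0 := fun i => by rw [t₁, hto]
  have hto₃ : ∀ i j, t i j o = 0 := fun i j => by rw [t₂, t₁, hto]
  have hcrit' : ∀ i, -(β * v i / U) + t a a i / x a + N * (v i * x i) = 0 := by
    intro i
    by_cases hi : i = o
    · rw [hi, hvo, hto₃]; simp
    · exact hcrit i hi
  have hg : ∀ p, 0 ≤ g p := by
    intro p
    by_cases hp : p = a ∨ p = o
    · rw [(hw0 p hp).2]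
    · push Not at hp
      have h1 := (hwg p hp.1 hp.2).1
      have h2 := hDpos p hp.1
      by_contra! h
      nlinarith [hA p]
  have third := third_order_bound (Q := Q) (lam := x a) (h := s a + x a * P a) hG t₁ t₂
    (hw0 a (Or.inl rfl)).2 hg
    (fun p hp i => by
      by_cases hpo : p = o
      · rw [hpo, hta]; simp
      · exact mul_le_mul_of_nonneg_right (hwg p hp hpo).1 (sq_nonneg _))
    (fun p hp => by
      by_cases hpo : p = o
      · rw [hpo, hta]; simp
      · exact mul_le_mul_of_nonneg_right (hwg p hp hpo).2 (sq_nonneg _))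
    (by
      have := hkey (fun i => t i i a) (hto o a)
      rw [eq₁ a hoa.symm] at this
      exact this)
  have hess : ∀ i, i ≠ o → -(β * x i / U) - β * (v i ^ 2 / U ^ 2)
      + (q i + ∑ p, g p * t a p i ^ 2) / x a - (t a a i / x a) ^ 2
      + N * (x i ^ 2 + ∑ j, v j * t j i i) ≤ 0 := by
    intro i hi
    have h1 := hhess i hi (fun p => w p * t a p i) (by simp [hta])
      (by simp [(hw0 a (Or.inl rfl)).1])
    have h2 : (∑ p, g p * t a p i ^ 2) / x a = (4 * ∑ p, w p * t a p i * t a p i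
        + 2 * ∑ p, (w p * t a p i) ^ 2 * x p) / x a - 2 * ∑ p, (w p * t a p i) ^ 2 := by
      rw [div_eq_iff hl.ne', sub_mul, div_mul_cancel₀ _ hl.ne', Finset.mul_sum, Finset.mul_sum,
        Finset.mul_sum, Finset.sum_mul, ← Finset.sum_add_distrib, ← Finset.sum_sub_distrib]
      refine Finset.sum_congr rfl fun p _ => ?_
      rw [hgw p]; ring
    rw [add_assoc (q i), add_div] at h1
    rw [add_div, h2]
    have h3 : β * (-(x i / U) - v i ^ 2 / U ^ 2) = -(β * x i / U) - β * (v i ^ 2 / U ^ 2) := by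
      ring
    linarith
  have lin : ∀ i, i ≠ a → -(β * x i / U) + (q i + ∑ p, g p * t a p i ^ 2) / x a
      + N * ∑ j, v j * t j i i ≤ 3 / 2 * (t a a i / x a) ^ 2 := by
    intro i hia
    by_cases hi : i = o
    · have : 0 ≤ β * x i / U := by rw [hi, hxo]; positivity
      have e : ∑ p, g p * t a p i ^ 2 = 0 :=
        Finset.sum_eq_zero fun p _ => by rw [hi, hto₃]; simp
      have e' : ∑ j, v j * t j i i = 0 :=
        Finset.sum_eq_zero fun p _ => by rw [hi, hto₃]; simp
      rw [e, e', hi, hqo, hto₃]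
      rw [hi] at this
      simpa using this
    · have := absorb_gradient hβ4 hN hβN (hv i) rfl (hcrit' i)
      have := hess i hi
      linarith
  have lina : -(β * x a / U) + (q a + ∑ p, g p * t a p a ^ 2) / x a
      + N * ∑ j, v j * t j a a ≤ (t a a a / x a) ^ 2 + β * (v a ^ 2 / U ^ 2) - N * x a ^ 2 := by
    have := hess a hoa.symm
    linarith
  have hsum : ∑ i, es x (univ.erase i) (K + 2) * (-(β * x i / U)
        + (q i + ∑ p, g p * t a p i ^ 2) / x a + N * ∑ j, v j * t j i i)
      ≤ es x (univ.erase a) (K + 2) * ((t a a a / x a) ^ 2 + β * (v a ^ 2 / U ^ 2) - N * x a ^ 2)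
        + ∑ i ∈ univ.erase a, es x (univ.erase i) (K + 2) * (3 / 2 * (t a a i / x a) ^ 2) := by
    rw [← Finset.add_sum_erase _ _ (mem_univ a)]
    refine add_le_add (mul_le_mul_of_nonneg_left lina (hA a).le) (Finset.sum_le_sum fun i hi => ?_)
    exact mul_le_mul_of_nonneg_left (lin i (Finset.ne_of_mem_erase hi)) (hA i).le
  have hE : ∑ i, x i * es x (univ.erase i) (K + 2) = (K + 3) * es x univ (K + 3) := by
    rw [sum_mul_es_erase x univ (K + 2)]; push_cast; ring
  have hgrad : ∑ j, v j * ∑ i, t i i j * es x (univ.erase i) (K + 2)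
      = ∑ j, v j * s j + ∑ j, v j * (x j * P j) := by
    rw [← Finset.sum_add_distrib]
    refine Finset.sum_congr rfl fun j _ => ?_
    by_cases hj : j = o
    · rw [hj, hvo]; ring
    · rw [eq₁ j hj]; ring
  have hlhs : ∑ i, es x (univ.erase i) (K + 2) * (-(β * x i / U)
        + (q i + ∑ p, g p * t a p i ^ 2) / x a + N * ∑ j, v j * t j i i)
      = -(β * ((K + 3) * es x univ (K + 3)) / U)
        + (∑ i, q i * es x (univ.erase i) (K + 2)
          + ∑ i, es x (univ.erase i) (K + 2) * ∑ p, g p * t a p i ^ 2) / x a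
        + N * (∑ j, v j * s j + ∑ j, v j * (x j * P j)) := by
    rw [← hE, ← hgrad]
    have e : ∑ j, v j * ∑ i, t i i j * es x (univ.erase i) (K + 2)
        = ∑ i, es x (univ.erase i) (K + 2) * ∑ j, v j * t j i i := by
      simp only [Finset.mul_sum]
      rw [Finset.sum_comm]
      refine Finset.sum_congr rfl fun i _ => Finset.sum_congr rfl fun j _ => ?_
      rw [t₁ j i i, t₂ i j i]; ring
    rw [e, ← Finset.sum_add_distrib, Finset.sum_div, Finset.mul_sum, Finset.mul_sum,
      Finset.sum_div, ← Finset.sum_neg_distrib, ← Finset.sum_add_distrib,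
      ← Finset.sum_add_distrib]
    refine Finset.sum_congr rfl fun i _ => ?_
    ring
  have hrhs : es x (univ.erase a) (K + 2) * ((t a a a / x a) ^ 2 + β * (v a ^ 2 / U ^ 2)
        - N * x a ^ 2)
        + ∑ i ∈ univ.erase a, es x (univ.erase i) (K + 2) * (3 / 2 * (t a a i / x a) ^ 2)
      = (es x (univ.erase a) (K + 2) * t a a a ^ 2 / x a
        + ∑ p ∈ univ.erase a, 3 / 2 * es x (univ.erase p) (K + 2) / x a * t a p a ^ 2) / x a
        + es x (univ.erase a) (K + 2) * (β * (v a ^ 2 / U ^ 2) - N * x a ^ 2) := by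
    have e : ∑ i ∈ univ.erase a, es x (univ.erase i) (K + 2) * (3 / 2 * (t a a i / x a) ^ 2)
        = (∑ p ∈ univ.erase a, 3 / 2 * es x (univ.erase p) (K + 2) / x a * t a p a ^ 2) / x a := by
      rw [Finset.sum_div]
      refine Finset.sum_congr rfl fun i _ => ?_
      rw [t₂ a a i]; ring
    rw [e]; ring
  rw [hlhs, hrhs] at hsum
  have third' := div_le_div_of_nonneg_right third hl.le
  have hPcrit : (∑ l, P l * t a a l) / x a + N * ∑ j, v j * (x j * P j)
      = β * (∑ l, P l * v l) / U := by
    rw [Finset.sum_div, Finset.mul_sum, Finset.mul_sum, Finset.sum_div, ← Finset.sum_add_distrib]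
    refine Finset.sum_congr rfl fun l _ => ?_
    have := hcrit' l
    have h1 : t a a l / x a = β * v l / U - N * (v l * x l) := by linarith
    rw [mul_div_assoc, h1]; ring
  have hr' := div_le_div_of_nonneg_right hr hl.le
  have hfin : -(β * ((K + 3) * es x univ (K + 3)) / U)
      - β * es x (univ.erase a) (K + 2) * v a ^ 2 / U ^ 2 - C * (1 + x a ^ 2) / x a
      - Q * (s a + x a * P a) ^ 2 / x a + N * (es x (univ.erase a) (K + 2) * x a ^ 2)
      + N * ∑ j, v j * s j + β * (∑ l, P l * v l) / U ≤ 0 := by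
    rw [← hPcrit]
    rw [← eq₂] at hr'
    have e1 : β * es x (univ.erase a) (K + 2) * v a ^ 2 / U ^ 2
        = es x (univ.erase a) (K + 2) * (β * (v a ^ 2 / U ^ 2)) := by ring
    rw [e1]
    simp only [add_div, sub_div, neg_div, mul_sub, mul_add] at hsum third' hr' ⊢
    linarith
  have := le_of_summed_second_order hm hN hβ hC hQ hU hUM (by linarith) hmA (hA a) (hv a)
    (by rw [hNdef]; field_simp; exact le_rfl)
    (by
      have h1 : 2 * β * M ^ 2 / N ≤ (U * x a) ^ 2 := by
        have : 2 * β * M ^ 2 / N + 1 ≤ U * x a := by linarith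
        have : U * x a ≤ (U * x a) ^ 2 := le_self_pow₀ (by linarith) two_ne_zero
        linarith
      rw [div_le_iff₀ hN] at h1
      linarith)
    (by
      have h1 := abs_add_le (s a) (x a * P a)
      rw [abs_mul, abs_of_pos hl] at h1
      have h2 := mul_le_mul_of_nonneg_left hPa hl.le
      have h3 : C ≤ x a * C := le_mul_of_one_le_left hC.le (by linarith)
      linarith)
    hvs hPv hEC hfin
  linarith

end PogorelovBound

section Spectral

open Polynomial

variable {ι κ : Type*} [Fintype ι] [DecidableEq ι] [Fintype κ] [DecidableEq κ]

lemma msig_conj {P Q M : Matrix ι ι ℝ} (h : Q * P = 1) (k : ℕ) :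
    msig k (P * M * Q) = msig k M := by
  unfold msig
  have h' : P * Q = 1 := mul_eq_one_comm.1 h
  have e : (1 : Matrix ι ι ℝ[X]) + (X : ℝ[X]) • (P * M * Q).map C
      = P.map C * (1 + (X : ℝ[X]) • M.map C) * Q.map C := by
    rw [mul_add, add_mul, mul_one, ← Matrix.map_mul, h', Matrix.map_mul, Matrix.map_mul]
    simp [Matrix.map_one]
  have hdet : (P.map (C : ℝ →+* ℝ[X])).det * (Q.map (C : ℝ →+* ℝ[X])).det = 1 := by
    rw [← Matrix.det_mul, ← Matrix.map_mul, h']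
    simp [Matrix.map_one]
  rw [e, Matrix.det_mul, Matrix.det_mul, mul_right_comm, hdet, one_mul]

lemma msig_eq_es_eigenvalues {H : Matrix ι ι ℝ} (hH : H.IsHermitian) (k : ℕ) :
    msig k H = es hH.eigenvalues univ k := by
  rw [← msig_diagonal]
  conv_lhs => rw [hH.spectral_theorem]
  rw [Unitary.conjStarAlgAut_apply]
  refine (msig_conj ?_ k).trans ?_
  · exact Unitary.coe_star_mul_self _
  · rfl

/-- The block diagonal matrix with blocks `L` and `M`. -/
def augment (L : ℝ) (M : Matrix κ κ ℝ) : Matrix (Option κ) (Option κ) ℝ :=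
  Matrix.of fun i j => i.elim (j.elim L fun _ => 0) fun i => j.elim 0 fun j => M i j

lemma msig_augment (L : ℝ) (M : Matrix κ κ ℝ) (k : ℕ) :
    msig (k + 1) (augment L M) = msig (k + 1) M + L * msig k M := by
  have e : ((1 : Matrix (Option κ) (Option κ) ℝ[X]) + (X : ℝ[X]) • (augment L M).map C).det
      = (1 + X * C L) * (1 + (X : ℝ[X]) • M.map C).det := by
    rw [← Matrix.det_submatrix_equiv_self (Equiv.optionEquivSumPUnit.{0} κ).symm]
    have : ((1 : Matrix (Option κ) (Option κ) ℝ[X]) + (X : ℝ[X]) • (augment L M).map C).submatrix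
        (Equiv.optionEquivSumPUnit.{0} κ).symm (Equiv.optionEquivSumPUnit.{0} κ).symm
        = Matrix.fromBlocks (1 + (X : ℝ[X]) • M.map C) 0 0
          (Matrix.of fun _ _ : PUnit.{1} => 1 + X * C L) := by
      ext i j : 1
      rcases i with i | i <;> rcases j with j | j <;> simp [augment, Matrix.one_apply]
    rw [this, Matrix.det_fromBlocks_zero₂₁, Matrix.det_unique (n := PUnit.{1}), Matrix.of_apply,
      mul_comm]
  unfold msig
  rw [e, add_mul, one_mul, coeff_add, mul_assoc, coeff_X_mul, coeff_C_mul]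

/-- The vector of eigenvalues of `augment`. -/
def augmentVec (L : ℝ) (x : κ → ℝ) : Option κ → ℝ := fun i => i.elim L x

lemma augment_diagonal {κ : Type*} [DecidableEq κ] (L : ℝ) (x : κ → ℝ) :
    augment L (Matrix.diagonal x) = Matrix.diagonal (augmentVec L x) := by
  ext i j
  rcases i with _ | i <;> rcases j with _ | j <;>
    simp [augment, augmentVec, Matrix.diagonal_apply]

lemma es_augmentVec (L : ℝ) (x : κ → ℝ) (k : ℕ) :
    es (augmentVec L x) univ (k + 1) = es x univ (k + 1) + L * es x univ k := by
  rw [← msig_diagonal, ← augment_diagonal, msig_augment, msig_diagonal, msig_diagonal]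

lemma es_augmentVec_erase_none (L : ℝ) (x : κ → ℝ) (k : ℕ) :
    es (augmentVec L x) (univ.erase none) k = es x univ k := by
  have h : (univ.erase none : Finset (Option κ)) = univ.map Function.Embedding.some := by
    ext i; rcases i with _ | i <;> simp
  rw [h]
  unfold es
  rw [Finset.powersetCard_map, Finset.sum_map]
  refine Finset.sum_congr rfl fun s _ => ?_
  simp [augmentVec]

lemma gam_augmentVec {L : ℝ} (hL : 0 < L) {x : κ → ℝ} {k : ℕ} (h : Gam x univ k)
    (hk : 0 < es x univ (k + 1) + L * es x univ k) : Gam (augmentVec L x) univ (k + 1) := by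
  intro j hj
  rcases j with _ | j
  · rw [es_zero]; exact one_pos
  · rw [es_augmentVec]
    rcases (Nat.le_of_succ_le_succ hj).eq_or_lt with rfl | hlt
    · exact hk
    · have := h (j + 1) hlt
      have := mul_pos hL (h j hlt.le)
      linarith

end Spectral

section DirectionalDerivatives

open Filter Topology

variable {E : Type*} [NormedAddCommGroup E] [NormedSpace ℝ E]

/-- The derivative of `g` in the direction `b`. -/
noncomputable def dirDeriv (g : E → ℝ) (b : E) : E → ℝ := fun x => fderiv ℝ g x b

lemma ContDiffAt.dirDeriv {g : E → ℝ} {x : E} {m : ℕ} (h : ContDiffAt ℝ (m + 1 : ℕ) g x) (b : E) :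
    ContDiffAt ℝ m (dirDeriv g b) x :=
  (h.fderiv_right (m := m) (by norm_cast)).clm_apply contDiffAt_const

lemma dirDeriv_congr {g h : E → ℝ} {x : E} (e : g =ᶠ[𝓝 x] h) (b : E) :
    dirDeriv g b =ᶠ[𝓝 x] dirDeriv h b := by
  filter_upwards [e.fderiv (𝕜 := ℝ)] with y hy
  simp only [dirDeriv, hy]

lemma dirDeriv_dirDeriv {g : E → ℝ} {x : E} (h : ContDiffAt ℝ 2 g x) (a b : E) :
    dirDeriv (dirDeriv g a) b x = fderiv ℝ (fderiv ℝ g) x b a := by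
  have h1 : DifferentiableAt ℝ (fderiv ℝ g) x :=
    (h.fderiv_right (m := 1) (by norm_num)).differentiableAt (by simp)
  have e : dirDeriv g a = fun y => fderiv ℝ g y a := rfl
  rw [dirDeriv, e, fderiv_clm_apply h1 (differentiableAt_const a)]
  simp

lemma dirDeriv_comm {g : E → ℝ} {x : E} (h : ContDiffAt ℝ 2 g x) (a b : E) :
    dirDeriv (dirDeriv g a) b x = dirDeriv (dirDeriv g b) a x := by
  rw [dirDeriv_dirDeriv h, dirDeriv_dirDeriv h]
  exact (h.isSymmSndFDerivAt (by simp)) b a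

lemma dirDeriv_comm_eventually {g : E → ℝ} {x : E} (h : ContDiffAt ℝ 2 g x) (a b : E) :
    dirDeriv (dirDeriv g a) b =ᶠ[𝓝 x] dirDeriv (dirDeriv g b) a := by
  filter_upwards [h.eventually (by simp)] with y hy using dirDeriv_comm hy a b

lemma iteratedFDeriv_two_eq_dirDeriv {g : E → ℝ} {x : E} (h : ContDiffAt ℝ 2 g x) (a b : E) :
    iteratedFDeriv ℝ 2 g x ![a, b] = dirDeriv (dirDeriv g a) b x := by
  rw [iteratedFDeriv_two_apply, dirDeriv_comm h, dirDeriv_dirDeriv h]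
  simp

lemma hasDerivAt_line {g : E → ℝ} {x b : E} {t : ℝ} (h : DifferentiableAt ℝ g (x + t • b)) :
    HasDerivAt (fun t : ℝ => g (x + t • b)) (dirDeriv g b (x + t • b)) t := by
  have h1 : HasDerivAt (fun t : ℝ => x + t • b) b t := by
    simpa using ((hasDerivAt_id t).smul_const b).const_add x
  exact h.hasFDerivAt.comp_hasDerivAt t h1

lemma tendsto_line (x b : E) : Tendsto (fun t : ℝ => x + t • b) (𝓝 0) (𝓝 x) := by
  have : Continuous fun t : ℝ => x + t • b := by fun_prop
  simpa using this.tendsto 0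

lemma jet2_line {g : E → ℝ} {x : E} (h : ContDiffAt ℝ 2 g x) (b : E) :
    Jet2 (fun t : ℝ => g (x + t • b)) (g x) (dirDeriv g b x) (dirDeriv (dirDeriv g b) b x) := by
  refine ⟨fun t => dirDeriv g b (x + t • b), ?_, by simp, by simp, ?_⟩
  · filter_upwards [(tendsto_line x b).eventually (h.eventually (by simp))] with t ht
    exact hasDerivAt_line (ht.differentiableAt (by simp))
  · have h1 : ContDiffAt ℝ (1 : ℕ) (dirDeriv g b) x := ContDiffAt.dirDeriv (m := 1) h b
    have h2 : DifferentiableAt ℝ (dirDeriv g b) (x + (0 : ℝ) • b) := by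
      simpa using h1.differentiableAt (by simp)
    simpa using hasDerivAt_line h2

lemma jet2_comp_curve {φ : E → ℝ} (hφ : ContDiff ℝ 2 φ) {c c₁ : ℝ → E} {c₂ : E}
    (h₁ : ∀ᶠ t in 𝓝 0, HasDerivAt c (c₁ t) t) (h₂ : HasDerivAt c₁ c₂ 0) :
    Jet2 (fun t => φ (c t)) (φ (c 0)) (fderiv ℝ φ (c 0) (c₁ 0))
      (fderiv ℝ (fderiv ℝ φ) (c 0) (c₁ 0) (c₁ 0) + fderiv ℝ φ (c 0) c₂) := by
  refine ⟨fun t => fderiv ℝ φ (c t) (c₁ t), ?_, rfl, rfl, ?_⟩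
  · filter_upwards [h₁] with t ht
    exact ((hφ.differentiable (by simp)) (c t)).hasFDerivAt.comp_hasDerivAt t ht
  · have h3 : DifferentiableAt ℝ (fderiv ℝ φ) (c 0) :=
      ((hφ.fderiv_right (m := 1) (by norm_num)).differentiable (by simp)) (c 0)
    have h4 := h3.hasFDerivAt.comp_hasDerivAt (0 : ℝ) h₁.self_of_nhds
    exact h4.clm_apply h₂

end DirectionalDerivatives

section TestFunction

open Filter Topology

variable {E κ : Type*} [NormedAddCommGroup E] [InnerProductSpace ℝ E] [Fintype κ]

lemma Jet2.eventually_pos {g : ℝ → ℝ} {a b c : ℝ} (h : Jet2 g a b c) (ha : 0 < a) :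
    ∀ᶠ t in 𝓝 0, 0 < g t :=
  h.hasDerivAt.continuousAt.eventually (lt_mem_nhds (h.value.symm ▸ ha))

lemma dirDeriv_dirDeriv_sum {u : E → ℝ} {y : E} (h : ContDiffAt ℝ 2 u y) (b : κ → E)
    (ξ : κ → ℝ) :
    dirDeriv (dirDeriv u (∑ p, ξ p • b p)) (∑ p, ξ p • b p) y
      = ∑ p, ∑ r, ξ p * ξ r * dirDeriv (dirDeriv u (b p)) (b r) y := by
  rw [dirDeriv_dirDeriv h]
  simp only [map_sum, map_smul, _root_.sum_apply, smul_apply,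
    smul_eq_mul, dirDeriv_dirDeriv h, Finset.mul_sum]
  exact Finset.sum_congr rfl fun p _ => Finset.sum_congr rfl fun r _ => by ring

lemma norm_sq_sum_smul (b : OrthonormalBasis κ ℝ E) (ξ : κ → ℝ) :
    ‖∑ p, ξ p • b p‖ ^ 2 = ∑ p, ξ p ^ 2 := by
  rw [← real_inner_self_eq_norm_sq, b.orthonormal.inner_sum]
  simp [sq]

variable [DecidableEq κ]

/-- The jet of `D²u(ξ, ξ)` along a line, for a direction `ξ` that moves affinely. -/
lemma jet2_quadratic {u : E → ℝ} {x₀ : E} (hu : ContDiffAt ℝ 4 u x₀)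
    (b : κ → E) {x : κ → ℝ}
    (hdiag : ∀ i j, dirDeriv (dirDeriv u (b i)) (b j) x₀ = Matrix.diagonal x i j)
    (a i : κ) (c : κ → ℝ) (hca : c a = 0) :
    Jet2 (fun t => ∑ p, ∑ r, ((if p = a then 1 else 0) + t * c p)
        * ((if r = a then 1 else 0) + t * c r)
        * dirDeriv (dirDeriv u (b p)) (b r) (x₀ + t • b i))
      (x a) (dirDeriv (dirDeriv (dirDeriv u (b a)) (b a)) (b i) x₀)
      (dirDeriv (dirDeriv (dirDeriv (dirDeriv u (b a)) (b a)) (b i)) (b i) x₀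
        + 4 * ∑ p, c p * dirDeriv (dirDeriv (dirDeriv u (b a)) (b p)) (b i) x₀
        + 2 * ∑ p, c p ^ 2 * x p) := by
  have hsymm : ∀ p, dirDeriv (dirDeriv (dirDeriv u (b p)) (b a)) (b i) x₀
      = dirDeriv (dirDeriv (dirDeriv u (b a)) (b p)) (b i) x₀ := fun p =>
    (dirDeriv_congr (dirDeriv_comm_eventually (hu.of_le (by norm_num)) _ _) _).self_of_nhds
  have hjet : ∀ p r, Jet2 (fun t : ℝ => dirDeriv (dirDeriv u (b p)) (b r) (x₀ + t • b i))
      (Matrix.diagonal x p r) (dirDeriv (dirDeriv (dirDeriv u (b p)) (b r)) (b i) x₀)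
      (dirDeriv (dirDeriv (dirDeriv (dirDeriv u (b p)) (b r)) (b i)) (b i) x₀) := by
    intro p r
    rw [← hdiag]
    exact jet2_line (ContDiffAt.dirDeriv (m := 2) (ContDiffAt.dirDeriv (m := 3) hu _) _) _
  have := Jet2.sum univ fun p _ => Jet2.sum univ fun r _ =>
    ((jet2_affine (if p = a then 1 else 0) (c p)).mul
      (jet2_affine (if r = a then 1 else 0) (c r))).mul (hjet p r)
  convert this using 1
  · simp
  · simp [add_mul, Finset.sum_add_distrib, hca, Matrix.diagonal_apply]
  · simp only [Matrix.diagonal_apply, mul_ite, mul_zero, Finset.sum_add_distrib,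
      Finset.sum_ite_eq, mem_univ, if_true, ite_mul, zero_mul, one_mul, mul_one, add_mul, mul_add,
      Finset.sum_ite_eq', add_zero, zero_add, hsymm, Finset.mul_sum]
    have e1 : ∑ p, 2 * (c p * c p) * x p = ∑ p, 2 * (c p ^ 2 * x p) :=
      Finset.sum_congr rfl fun p _ => by ring
    have e2 : ∑ p, 4 * (c p * dirDeriv (dirDeriv (dirDeriv u (b a)) (b p)) (b i) x₀)
        = ∑ p, 2 * (c p * dirDeriv (dirDeriv (dirDeriv u (b a)) (b p)) (b i) x₀)
          + ∑ p, 2 * (c p * dirDeriv (dirDeriv (dirDeriv u (b a)) (b p)) (b i) x₀) := by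
      rw [← Finset.sum_add_distrib]
      exact Finset.sum_congr rfl fun p _ => by ring
    have e3 : ∑ p, ∑ r, (if p = a then
        2 * (c r * dirDeriv (dirDeriv (dirDeriv u (b p)) (b r)) (b i) x₀) else 0)
        = ∑ p, 2 * (c p * dirDeriv (dirDeriv (dirDeriv u (b a)) (b p)) (b i) x₀) := by
      rw [Finset.sum_comm]
      simp
    rw [e1, e2, e3]
    ring

/-- The first and second order conditions at a maximum point of the Pogorelov test function. -/
lemma second_order_conditions {u : E → ℝ} {x₀ : E} (hu : ContDiffAt ℝ 4 u x₀)
    (b : OrthonormalBasis κ ℝ E) {x : κ → ℝ}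
    (hdiag : ∀ i j, dirDeriv (dirDeriv u (b i)) (b j) x₀ = Matrix.diagonal x i j)
    {a : κ} {β N : ℝ} (hneg : u x₀ < 0) (hxa : 0 < x a)
    (hmax : ∀ᶠ y in 𝓝 x₀, ∀ ξ : E, (-u y) ^ β * dirDeriv (dirDeriv u ξ) ξ y
        * Real.exp (N / 2 * ∑ j, dirDeriv u (b j) y ^ 2)
      ≤ (-u x₀) ^ β * x a * Real.exp (N / 2 * ∑ j, dirDeriv u (b j) x₀ ^ 2) * ‖ξ‖ ^ 2)
    (i : κ) (c : κ → ℝ) (hca : c a = 0) :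
    -(β * dirDeriv u (b i) x₀ / -u x₀)
        + dirDeriv (dirDeriv (dirDeriv u (b a)) (b a)) (b i) x₀ / x a
        + N * (dirDeriv u (b i) x₀ * x i) = 0 ∧
    β * (-(x i / -u x₀) - dirDeriv u (b i) x₀ ^ 2 / (-u x₀) ^ 2)
        + (dirDeriv (dirDeriv (dirDeriv (dirDeriv u (b a)) (b a)) (b i)) (b i) x₀
          + 4 * ∑ p, c p * dirDeriv (dirDeriv (dirDeriv u (b a)) (b p)) (b i) x₀
          + 2 * ∑ p, c p ^ 2 * x p) / x a
        - (dirDeriv (dirDeriv (dirDeriv u (b a)) (b a)) (b i) x₀ / x a) ^ 2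
        - 2 * ∑ p, c p ^ 2
        + N * (x i ^ 2
          + ∑ j, dirDeriv u (b j) x₀ * dirDeriv (dirDeriv (dirDeriv u (b j)) (b i)) (b i) x₀)
      ≤ 0 := by
  have hu2 : ContDiffAt ℝ 2 u x₀ := hu.of_le (by norm_num)
  have jU : Jet2 (fun t : ℝ => -u (x₀ + t • b i)) (-u x₀) (-dirDeriv u (b i) x₀) (-x i) := by
    have := (jet2_line hu2 (b i)).neg
    rwa [hdiag, Matrix.diagonal_apply_eq] at this
  have jV := jet2_quadratic hu b hdiag a i c hca
  have jS : Jet2 (fun t => ∑ p, ((if p = a then 1 else 0) + t * c p)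
      * ((if p = a then 1 else 0) + t * c p)) 1 0 (2 * ∑ p, c p ^ 2) := by
    have := Jet2.sum univ fun p _ => (jet2_affine (if p = a then 1 else 0) (c p)).mul
      (jet2_affine (if p = a then 1 else 0) (c p))
    convert this using 1
    · simp
    · simp [hca, Finset.sum_add_distrib]
    · simp [Finset.mul_sum, sq]
  have jG : Jet2 (fun t : ℝ => ∑ j, dirDeriv u (b j) (x₀ + t • b i)
      * dirDeriv u (b j) (x₀ + t • b i)) (∑ j, dirDeriv u (b j) x₀ * dirDeriv u (b j) x₀)
      (2 * (dirDeriv u (b i) x₀ * x i)) (2 * (x i ^ 2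
        + ∑ j, dirDeriv u (b j) x₀ * dirDeriv (dirDeriv (dirDeriv u (b j)) (b i)) (b i) x₀)) := by
    have hj : ∀ j, Jet2 (fun t : ℝ => dirDeriv u (b j) (x₀ + t • b i)) (dirDeriv u (b j) x₀)
        (Matrix.diagonal x j i) (dirDeriv (dirDeriv (dirDeriv u (b j)) (b i)) (b i) x₀) := by
      intro j
      rw [← hdiag]
      exact jet2_line ((ContDiffAt.dirDeriv (m := 3) hu _).of_le (by norm_num)) _
    have := Jet2.sum univ fun j _ => (hj j).mul (hj j)
    convert this using 1
    · simp only [Matrix.diagonal_apply, ite_mul, zero_mul, mul_ite, mul_zero,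
        Finset.sum_add_distrib, Finset.sum_ite_eq', mem_univ, if_true]
      ring
    · simp only [Matrix.diagonal_apply, ite_mul, zero_mul, mul_ite, mul_zero,
        Finset.sum_add_distrib, Finset.sum_ite_eq', mem_univ, if_true, mul_add, Finset.mul_sum]
      have e : ∑ j, 2 * (dirDeriv u (b j) x₀
            * dirDeriv (dirDeriv (dirDeriv u (b j)) (b i)) (b i) x₀)
          = ∑ j, dirDeriv (dirDeriv (dirDeriv u (b j)) (b i)) (b i) x₀ * dirDeriv u (b j) x₀
            + ∑ j, dirDeriv u (b j) x₀
              * dirDeriv (dirDeriv (dirDeriv u (b j)) (b i)) (b i) x₀ := by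
        rw [← Finset.sum_add_distrib]
        exact Finset.sum_congr rfl fun j _ => by ring
      rw [e]
      ring
  have hUpos : 0 < -u x₀ := by linarith
  have jet := ((((jU.log hUpos).const_mul β).add (jV.log hxa)).sub (jS.log one_pos)).add
    (jG.const_mul (N / 2))
  have evU := jU.eventually_pos hUpos
  have evV := jV.eventually_pos hxa
  have evS := jS.eventually_pos one_pos
  have hloc := jet.of_isLocalMax (by
    filter_upwards [evU, evV, evS, (tendsto_line x₀ (b i)).eventually hmax,
      (tendsto_line x₀ (b i)).eventually (hu2.eventually (by simp))] with t h1 h2 h3 h4 h5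
    rw [jet.value]
    have h6 := h4 (∑ p, ((if p = a then 1 else 0) + t * c p) • b p)
    rw [dirDeriv_dirDeriv_sum h5, norm_sq_sum_smul] at h6
    simp only [sq] at h6
    have h7 := Real.log_le_log (by positivity) h6
    rw [Real.log_mul (by positivity) (by positivity), Real.log_mul (by positivity) h2.ne',
      Real.log_exp, Real.log_mul (by positivity) (by positivity),
      Real.log_mul (by positivity) (by positivity), Real.log_mul (by positivity) (by positivity),
      Real.log_exp, Real.log_rpow h1, Real.log_rpow hUpos] at h7
    rw [Real.log_one]
    linarith)
  obtain ⟨h1, h2⟩ := hloc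
  constructor
  · rw [← h1]; ring
  · refine le_trans (le_of_eq ?_) h2
    ring

end TestFunction

section DifferentiatedEquation

open Filter Topology

variable {E κ : Type*} [NormedAddCommGroup E] [NormedSpace ℝ E]

lemma dirDeriv_swap_third {u : E → ℝ} {x : E} (hu : ContDiffAt ℝ 4 u x) (a b c : E) :
    dirDeriv (dirDeriv (dirDeriv u a) b) c =ᶠ[𝓝 x] dirDeriv (dirDeriv (dirDeriv u a) c) b :=
  dirDeriv_comm_eventually ((ContDiffAt.dirDeriv (m := 3) hu a).of_le (by norm_num)) b c

lemma dirDeriv_swap_second {u : E → ℝ} {x : E} (hu : ContDiffAt ℝ 4 u x) (a b c : E) :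
    dirDeriv (dirDeriv (dirDeriv u a) b) c =ᶠ[𝓝 x] dirDeriv (dirDeriv (dirDeriv u b) a) c :=
  dirDeriv_congr (dirDeriv_comm_eventually (hu.of_le (by norm_num)) a b) c

lemma dirDeriv_fourth_symm {u : E → ℝ} {x : E} (hu : ContDiffAt ℝ 4 u x) (p a : E) :
    dirDeriv (dirDeriv (dirDeriv (dirDeriv u p) p) a) a x
      = dirDeriv (dirDeriv (dirDeriv (dirDeriv u a) a) p) p x := by
  have h1 : dirDeriv (dirDeriv (dirDeriv u p) p) a =ᶠ[𝓝 x] dirDeriv (dirDeriv (dirDeriv u a) p) p :=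
    (dirDeriv_swap_third hu p p a).trans (dirDeriv_swap_second hu p a p)
  have h2 : ContDiffAt ℝ 2 (dirDeriv (dirDeriv u a) p) x :=
    ContDiffAt.dirDeriv (m := 2) (ContDiffAt.dirDeriv (m := 3) hu a) p
  rw [(dirDeriv_congr h1 a).self_of_nhds, dirDeriv_comm h2,
    (dirDeriv_congr (dirDeriv_swap_third hu a p a) p).self_of_nhds]

variable [Fintype κ] [DecidableEq κ]

/-- First and second derivatives of the equation `σ_k(D²û) = L φ(x, u, Du)`, where `D²û` is the
Hessian of `u` augmented by the eigenvalue `L`, at a point where the Hessian is diagonal. -/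
lemma differentiated_equation {u : E → ℝ} {x₀ : E} (hu : ContDiffAt ℝ 4 u x₀)
    (b : κ → E) {x : κ → ℝ}
    (hdiag : ∀ i j, dirDeriv (dirDeriv u (b i)) (b j) x₀ = Matrix.diagonal x i j)
    {φ : E × ℝ × E → ℝ} (hφ : ContDiff ℝ 2 φ) {L : ℝ} {K : ℕ}
    (heq : ∀ᶠ y in 𝓝 x₀, msig (K + 2)
        (augment L (Matrix.of fun i j => dirDeriv (dirDeriv u (b i)) (b j) y))
      = L * φ (y, u y, ∑ j, dirDeriv u (b j) y • b j)) (i : κ) :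
    ∑ p, augment 0 (Matrix.of fun p r => dirDeriv (dirDeriv (dirDeriv u (b p)) (b r)) (b i) x₀) p p
        * es (augmentVec L x) (univ.erase p) (K + 1)
      = L * fderiv ℝ φ (x₀, u x₀, ∑ j, dirDeriv u (b j) x₀ • b j)
        (b i, dirDeriv u (b i) x₀, x i • b i) ∧
    ∑ p, augment 0 (Matrix.of fun p r =>
          dirDeriv (dirDeriv (dirDeriv (dirDeriv u (b p)) (b r)) (b i)) (b i) x₀) p p
        * es (augmentVec L x) (univ.erase p) (K + 1)
      + ∑ p, ∑ r ∈ univ.erase p,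
        (augment 0 (Matrix.of fun p r => dirDeriv (dirDeriv (dirDeriv u (b p)) (b r)) (b i) x₀) p p
          * augment 0 (Matrix.of fun p r =>
            dirDeriv (dirDeriv (dirDeriv u (b p)) (b r)) (b i) x₀) r r
          - augment 0 (Matrix.of fun p r =>
            dirDeriv (dirDeriv (dirDeriv u (b p)) (b r)) (b i) x₀) p r
          * augment 0 (Matrix.of fun p r =>
            dirDeriv (dirDeriv (dirDeriv u (b p)) (b r)) (b i) x₀) r p)
        * es (augmentVec L x) ((univ.erase p).erase r) K
      = L * (fderiv ℝ (fderiv ℝ φ) (x₀, u x₀, ∑ j, dirDeriv u (b j) x₀ • b j)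
          (b i, dirDeriv u (b i) x₀, x i • b i) (b i, dirDeriv u (b i) x₀, x i • b i)
        + fderiv ℝ φ (x₀, u x₀, ∑ j, dirDeriv u (b j) x₀ • b j)
          (0, x i, ∑ j, dirDeriv (dirDeriv (dirDeriv u (b j)) (b i)) (b i) x₀ • b j)) := by
  have hjet : ∀ p r, Jet2 (fun t : ℝ => augment L (Matrix.of fun k l =>
        dirDeriv (dirDeriv u (b k)) (b l) (x₀ + t • b i)) p r)
      (Matrix.diagonal (augmentVec L x) p r)
      (augment 0 (Matrix.of fun p r => dirDeriv (dirDeriv (dirDeriv u (b p)) (b r)) (b i) x₀) p r)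
      (augment 0 (Matrix.of fun p r =>
        dirDeriv (dirDeriv (dirDeriv (dirDeriv u (b p)) (b r)) (b i)) (b i) x₀) p r) := by
    intro p r
    rw [← augment_diagonal]
    rcases p with _ | p <;> rcases r with _ | r
    · simpa [augment] using jet2_const L
    · simpa [augment] using jet2_const 0
    · simpa [augment] using jet2_const 0
    · simp only [augment, Matrix.of_apply, Option.elim_some]
      rw [← hdiag]
      exact jet2_line (ContDiffAt.dirDeriv (m := 2) (ContDiffAt.dirDeriv (m := 3) hu _) _) _
  have hdir : ∀ j, ContDiffAt ℝ 3 (dirDeriv u (b j)) x₀ := fun j =>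
    ContDiffAt.dirDeriv (m := 3) hu _
  have hfirst : ∀ᶠ t : ℝ in 𝓝 0, HasDerivAt
      (fun t : ℝ => (x₀ + t • b i, u (x₀ + t • b i), ∑ j, dirDeriv u (b j) (x₀ + t • b i) • b j))
      (b i, dirDeriv u (b i) (x₀ + t • b i),
        ∑ j, dirDeriv (dirDeriv u (b j)) (b i) (x₀ + t • b i) • b j) t := by
    have h1 : ∀ᶠ y in 𝓝 x₀, ∀ j, ContDiffAt ℝ 3 (dirDeriv u (b j)) y :=
      eventually_all.2 fun j => (hdir j).eventually (by simp)
    filter_upwards [(tendsto_line x₀ (b i)).eventually h1,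
      (tendsto_line x₀ (b i)).eventually (hu.eventually (by simp))] with t ht ht'
    refine HasDerivAt.prodMk ?_ (HasDerivAt.prodMk ?_ ?_)
    · simpa using ((hasDerivAt_id t).smul_const (b i)).const_add x₀
    · exact hasDerivAt_line (ht'.differentiableAt (by simp))
    · exact HasDerivAt.fun_sum fun j _ =>
        (hasDerivAt_line ((ht j).differentiableAt (by simp))).smul_const (b j)
  have hsecond : HasDerivAt (fun t : ℝ => (b i, dirDeriv u (b i) (x₀ + t • b i),
        ∑ j, dirDeriv (dirDeriv u (b j)) (b i) (x₀ + t • b i) • b j))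
      (0, x i, ∑ j, dirDeriv (dirDeriv (dirDeriv u (b j)) (b i)) (b i) x₀ • b j) 0 := by
    refine HasDerivAt.prodMk (hasDerivAt_const _ _) (HasDerivAt.prodMk ?_ ?_)
    · have h1 : DifferentiableAt ℝ (dirDeriv u (b i)) (x₀ + (0 : ℝ) • b i) := by
        simpa using (hdir i).differentiableAt (by simp)
      simpa [hdiag] using hasDerivAt_line h1
    · refine HasDerivAt.fun_sum fun j _ => ?_
      have h2 : ContDiffAt ℝ (2 : ℕ) (dirDeriv (dirDeriv u (b j)) (b i)) x₀ :=
        ContDiffAt.dirDeriv (m := 2) (hdir j) _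
      have h1 : DifferentiableAt ℝ (dirDeriv (dirDeriv u (b j)) (b i)) (x₀ + (0 : ℝ) • b i) := by
        simpa using h2.differentiableAt (by simp)
      simpa using (hasDerivAt_line h1).smul_const (b j)
  have hφjet := (jet2_comp_curve hφ hfirst hsecond).const_mul L
  have hMjet := (jet2_msig hjet K).congr ((tendsto_line x₀ (b i)).eventually heq)
  have e : ∑ j, dirDeriv (dirDeriv u (b j)) (b i) x₀ • b j = x i • b i := by
    simp [hdiag, Matrix.diagonal_apply]
  obtain ⟨-, h1, h2⟩ := hMjet.unique hφjet
  simp only [zero_smul, add_zero, e] at h1 h2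
  exact ⟨h1, h2⟩

end DifferentiatedEquation

section PointwiseBound

open Filter Topology

variable {E κ : Type*} [NormedAddCommGroup E] [InnerProductSpace ℝ E] [Fintype κ]

/-- The lower bound on the twice differentiated right-hand side. -/
lemma le_second_derivative_rhs {φ : E × ℝ × E → ℝ} {p₀ : E × ℝ × E} {L F M : ℝ} (hL : 0 < L)
    (hF : 0 < F) (h1 : ‖fderiv ℝ φ p₀‖ ≤ F) (h2 : ∀ z, |fderiv ℝ (fderiv ℝ φ) p₀ z z| ≤ F * ‖z‖ ^ 2)
    {e : E} (he : ‖e‖ = 1) {v y : ℝ} (hv : |v| ≤ M) (b : κ → E) (t : κ → ℝ) :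
    -(L * F * (2 + M ^ 2) * (1 + y ^ 2)) + ∑ l, L * fderiv ℝ φ p₀ (0, 0, b l) * t l
      ≤ L * (fderiv ℝ (fderiv ℝ φ) p₀ (e, v, y • e) (e, v, y • e)
        + fderiv ℝ φ p₀ (0, y, ∑ l, t l • b l)) := by
  have hM : v ^ 2 ≤ M ^ 2 := sq_le_sq' (by linarith [abs_le.1 hv]) (abs_le.1 hv).2
  have hz : ‖((e, v, y • e) : E × ℝ × E)‖ ^ 2 ≤ 1 + M ^ 2 + y ^ 2 := by
    simp only [Prod.norm_def, norm_smul, he, mul_one, Real.norm_eq_abs]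
    rcases max_choice 1 (max |v| |y|) with h | h
    · rw [h]; nlinarith [sq_nonneg M, sq_nonneg y]
    · rw [h]
      rcases max_choice |v| |y| with h | h <;> rw [h, sq_abs] <;>
        nlinarith [sq_nonneg M, sq_nonneg y]
  have hD2 : -(F * (1 + M ^ 2 + y ^ 2))
      ≤ fderiv ℝ (fderiv ℝ φ) p₀ (e, v, y • e) (e, v, y • e) := by
    have h3 := mul_le_mul_of_nonneg_left hz hF.le
    linarith [h2 (e, v, y • e), neg_abs_le (fderiv ℝ (fderiv ℝ φ) p₀ (e, v, y • e) (e, v, y • e))]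
  have hlin : fderiv ℝ φ p₀ (0, y, ∑ l, t l • b l)
      = y * fderiv ℝ φ p₀ (0, 1, 0) + ∑ l, t l * fderiv ℝ φ p₀ (0, 0, b l) := by
    have : ((0, y, ∑ l, t l • b l) : E × ℝ × E)
        = y • ((0, 1, 0) : E × ℝ × E) + ∑ l, t l • ((0, 0, b l) : E × ℝ × E) := by
      ext <;> simp [Prod.fst_sum, Prod.snd_sum]
    rw [this, map_add, map_smul, map_sum]
    simp only [map_smul, smul_eq_mul]
  have hD1 : -(F * (1 + y ^ 2)) ≤ y * fderiv ℝ φ p₀ (0, 1, 0) := by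
    have := (fderiv ℝ φ p₀).le_of_opNorm_le h1 ((0, 1, 0) : E × ℝ × E)
    simp only [Prod.norm_def, norm_zero, norm_one, Real.norm_eq_abs] at this
    norm_num at this
    have h4 : |y * fderiv ℝ φ p₀ (0, 1, 0)| ≤ (1 + y ^ 2) * F := by
      rw [abs_mul]
      exact mul_le_mul (by nlinarith [sq_nonneg (|y| - 1), sq_abs y]) this (abs_nonneg _)
        (by positivity)
    linarith [neg_abs_le (y * fderiv ℝ φ p₀ (0, 1, 0))]
  have hs : ∑ l, L * fderiv ℝ φ p₀ (0, 0, b l) * t l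
      = L * ∑ l, t l * fderiv ℝ φ p₀ (0, 0, b l) := by
    rw [mul_sum]
    exact sum_congr rfl fun l _ => by ring
  rw [hlin, hs]
  have : 0 ≤ fderiv ℝ (fderiv ℝ φ) p₀ (e, v, y • e) (e, v, y • e)
      + y * fderiv ℝ φ p₀ (0, 1, 0) + F * (2 + M ^ 2) * (1 + y ^ 2) := by
    nlinarith [mul_nonneg hF.le (mul_nonneg (sq_nonneg M) (sq_nonneg y))]
  nlinarith [mul_nonneg hL.le this]

lemma abs_fderiv_le {φ : E × ℝ × E → ℝ} {p₀ : E × ℝ × E} {F M : ℝ} (hF : 0 < F)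
    (h1 : ‖fderiv ℝ φ p₀‖ ≤ F) (z : E × ℝ × E) (h : ‖z‖ ≤ M) : |fderiv ℝ φ p₀ z| ≤ F * M :=
  ((fderiv ℝ φ p₀).le_of_opNorm_le h1 z).trans (by gcongr)

lemma abs_sum_mul_le_card {v s : κ → ℝ} {A B : ℝ} (hv : ∀ i, |v i| ≤ A) (hs : ∀ i, |s i| ≤ B)
    (hA : 0 ≤ A) : |∑ i, v i * s i| ≤ Fintype.card κ * (A * B) := by
  refine (abs_sum_le_sum_abs _ _).trans ?_
  refine (sum_le_card_nsmul _ _ (A * B) fun i _ => ?_).trans (by simp)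
  rw [abs_mul]
  exact mul_le_mul (hv i) (hs i) (abs_nonneg _) hA

/-- The interior estimate at a maximum point of the Pogorelov test function. -/
lemma exists_bound_at_max (E κ : Type*) [NormedAddCommGroup E] [InnerProductSpace ℝ E] [Fintype κ]
    [DecidableEq κ] (K : ℕ) {L C₀ m F M : ℝ} (hL : 0 < L) (hm : 0 < m)
    (hF : 0 < F) (hM : 0 < M) :
    ∃ N β B : ℝ, 0 < N ∧ 1 ≤ β ∧ 0 < B ∧
      ∀ (u : E → ℝ) (x₀ : E) (b : OrthonormalBasis κ ℝ E) (x : κ → ℝ) (a : κ)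
        (φ : E × ℝ × E → ℝ), ContDiffAt ℝ 4 u x₀ →
      (∀ i j, dirDeriv (dirDeriv u (b i)) (b j) x₀ = Matrix.diagonal x i j) →
      ContDiff ℝ 2 φ →
      (∀ᶠ y in 𝓝 x₀, msig (K + 3)
          (augment L (Matrix.of fun i j => dirDeriv (dirDeriv u (b i)) (b j) y))
        = L * φ (y, u y, ∑ j, dirDeriv u (b j) y • b j)) →
      Gam x univ (K + 2) → es x univ (K + 2) ≤ C₀ →
      m ≤ φ (x₀, u x₀, ∑ j, dirDeriv u (b j) x₀ • b j) →
      φ (x₀, u x₀, ∑ j, dirDeriv u (b j) x₀ • b j) ≤ F →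
      ‖fderiv ℝ φ (x₀, u x₀, ∑ j, dirDeriv u (b j) x₀ • b j)‖ ≤ F →
      (∀ z, |fderiv ℝ (fderiv ℝ φ) (x₀, u x₀, ∑ j, dirDeriv u (b j) x₀ • b j) z z| ≤ F * ‖z‖ ^ 2) →
      (∀ p, x p ≤ x a) → u x₀ < 0 → -u x₀ ≤ M → (∀ i, |dirDeriv u (b i) x₀| ≤ M) →
      (∀ᶠ y in 𝓝 x₀, ∀ ξ : E, (-u y) ^ β * dirDeriv (dirDeriv u ξ) ξ y
          * Real.exp (N / 2 * ∑ j, dirDeriv u (b j) y ^ 2)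
        ≤ (-u x₀) ^ β * x a * Real.exp (N / 2 * ∑ j, dirDeriv u (b j) x₀ ^ 2) * ‖ξ‖ ^ 2) →
      -u x₀ * x a ≤ B := by
  set n : ℝ := (Fintype.card κ : ℝ)
  have hn : 0 ≤ n := Nat.cast_nonneg _
  set C : ℝ := L * F * ((K + 3) + (2 + M ^ 2) + (n + 1) * (1 + M) ^ 2) with hC
  have hLF : 0 < L * F := mul_pos hL hF
  obtain ⟨N, β, B, hN, hβ, hB, key⟩ := exists_pogorelov_bound (ι := Option κ) K hL (C₀ := C₀)
    (mul_pos hL hm) (C := C) (by positivity) hM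
  refine ⟨N, β, B, hN, hβ, hB, ?_⟩
  intro u x₀ b x a φ hu hdiag hφ heq hG hA hmφ hφF h1 h2 hmax hneg hUM hv hloc
  set p₀ : E × ℝ × E := (x₀, u x₀, ∑ j, dirDeriv u (b j) x₀ • b j) with hp₀
  have hes : es (augmentVec L x) univ (K + 3) = L * φ p₀ := by
    rw [← heq.self_of_nhds, ← msig_diagonal, ← augment_diagonal]
    congr 2
    ext i j
    exact (hdiag i j).symm
  have hxa : 0 < x a := by
    by_contra! h
    have := hG 1 (by omega)
    rw [es_one_eq_sum] at this
    exact absurd this (not_lt.2 (sum_nonpos fun i _ => (hmax i).trans h))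
  have hGa : Gam (augmentVec L x) univ (K + 3) := by
    refine gam_augmentVec hL hG ?_
    rw [← es_augmentVec, hes]
    exact mul_pos hL (hm.trans_le hmφ)
  set T : κ → κ → κ → ℝ := fun i j l =>
    dirDeriv (dirDeriv (dirDeriv u (b i)) (b j)) (b l) x₀ with hT
  set Q : κ → ℝ := fun i =>
    dirDeriv (dirDeriv (dirDeriv (dirDeriv u (b a)) (b a)) (b i)) (b i) x₀ with hQ
  have T₁ : ∀ i j l, T i j l = T j i l := fun i j l =>
    (dirDeriv_swap_second hu (b i) (b j) (b l)).self_of_nhds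
  have T₂ : ∀ i j l, T i j l = T i l j := fun i j l =>
    (dirDeriv_swap_third hu (b i) (b j) (b l)).self_of_nhds
  set t : Option κ → Option κ → Option κ → ℝ := fun i j l =>
    l.elim 0 fun l => augment 0 (Matrix.of fun i j => T i j l) i j with ht
  set q : Option κ → ℝ := fun i => i.elim 0 Q with hq
  have t₁ : ∀ i j l, t i j l = t j i l := by
    rintro (_ | i) (_ | j) (_ | l) <;> first | rfl | exact T₁ _ _ _
  have t₂ : ∀ i j l, t i j l = t i l j := by
    rintro (_ | i) (_ | j) (_ | l) <;> first | rfl | exact T₂ _ _ _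
  have tss : ∀ i j l, t (some i) (some j) (some l) = T i j l := fun i j l => rfl
  have tn : ∀ i j, t none i j = 0 := by rintro (_ | i) (_ | j) <;> rfl
  set v : Option κ → ℝ := fun i => i.elim 0 fun i => dirDeriv u (b i) x₀ with hvdef
  set s : Option κ → ℝ := fun i => i.elim 0 fun i =>
    L * fderiv ℝ φ p₀ (b i, dirDeriv u (b i) x₀, 0) with hs
  set P : Option κ → ℝ := fun i => i.elim 0 fun i => L * fderiv ℝ φ p₀ (0, 0, b i) with hP
  have hv' : ∀ i, |v i| ≤ M := by
    rintro (_ | i)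
    · simpa [hvdef] using hM.le
    · exact hv i
  have hs' : ∀ i, |L * fderiv ℝ φ p₀ (b i, dirDeriv u (b i) x₀, 0)| ≤ L * F * (1 + M) := by
    intro i
    rw [abs_mul, abs_of_pos hL, mul_assoc]
    refine mul_le_mul_of_nonneg_left (abs_fderiv_le hF h1 _ ?_) hL.le
    simp only [Prod.norm_def, b.norm_eq_one, norm_zero, Real.norm_eq_abs]
    exact max_le (by linarith) (max_le (by linarith [hv i]) (by linarith))
  have hP' : ∀ i, |L * fderiv ℝ φ p₀ (0, 0, b i)| ≤ L * F := by
    intro i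
    rw [abs_mul, abs_of_pos hL]
    refine mul_le_mul_of_nonneg_left ?_ hL.le
    simpa using abs_fderiv_le (M := 1) hF h1 (0, 0, b i) (by simp [Prod.norm_def])
  have hde := differentiated_equation hu b hdiag hφ heq
  refine key (augmentVec L x) v s P q t (-u x₀) _ none (some a) (by simp) rfl hGa
    (by rwa [es_augmentVec_erase_none]) (by rw [hes]; gcongr) ?_ ?_ (by linarith) hUM hv' t₁ t₂
    tn rfl rfl ?_ ?_ ?_ rfl ?_ ?_ ?_ ?_ ?_
  · rw [hes, hC]
    have : (K + 3 : ℝ) * (L * φ p₀) ≤ (K + 3) * (L * F) := by gcongr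
    have h5 : 0 ≤ L * F * ((2 + M ^ 2) + (n + 1) * (1 + M) ^ 2) := by positivity
    linarith
  · rintro (_ | p) hp
    · exact absurd rfl hp
    · exact hmax p
  · rintro (_ | i) hi
    · exact absurd rfl hi
    · exact (second_order_conditions hu b hdiag hneg hxa hloc i 0 rfl).1
  · rintro (_ | i) hi c hc0 hca
    · exact absurd rfl hi
    · have := (second_order_conditions hu b hdiag hneg hxa hloc i (fun p => c (some p)) hca).2
      simp only [Fintype.sum_option, hc0, tn, zero_mul, mul_zero, zero_add, ne_eq,
        OfNat.ofNat_ne_zero, not_false_eq_true, zero_pow]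
      exact this
  · rintro (_ | j) hj
    · exact absurd rfl hj
    · refine (hde j).1.trans ?_
      have : ((b j, dirDeriv u (b j) x₀, x j • b j) : E × ℝ × E)
          = (b j, dirDeriv u (b j) x₀, 0) + x j • ((0, 0, b j) : E × ℝ × E) := by
        ext <;> simp
      rw [this, map_add, map_smul]
      simp only [hs, hP, augmentVec, Option.elim_some, smul_eq_mul]
      ring
  · have e : ∑ i, q i * es (augmentVec L x) (univ.erase i) (K + 2)
        + ∑ i, ∑ j ∈ univ.erase i, (t i i (some a) * t j j (some a) - t i j (some a) ^ 2)
          * es (augmentVec L x) ((univ.erase i).erase j) (K + 1)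
        = L * (fderiv ℝ (fderiv ℝ φ) p₀
            (b a, dirDeriv u (b a) x₀, x a • b a) (b a, dirDeriv u (b a) x₀, x a • b a)
          + fderiv ℝ φ p₀ (0, x a, ∑ j, T j a a • b j)) := by
      rw [← (hde a).2]
      congr 1
      · refine sum_congr rfl fun p _ => ?_
        rcases p with _ | p
        · rfl
        · congr 1
          exact (dirDeriv_fourth_symm hu (b p) (b a)).symm
      · refine sum_congr rfl fun p _ => sum_congr rfl fun r _ => ?_
        congr 2
        rw [sq]
        nth_rewrite 2 [t₁]
        rfl
    rw [e]
    have hle := le_second_derivative_rhs (y := x a) hL hF h1 h2 (b.norm_eq_one a) (hv a) b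
      fun j => T j a a
    have hsum : ∑ l, P l * t (some a) (some a) l
        = ∑ l, L * fderiv ℝ φ p₀ (0, 0, b l) * T l a a := by
      rw [Fintype.sum_option]
      simp only [hP, Option.elim_none, Option.elim_some, zero_mul, zero_add, tss]
      exact sum_congr rfl fun l _ => by rw [T₂ a a l, T₁ a l a]
    have hc : L * F * (2 + M ^ 2) * (1 + x a ^ 2) ≤ C * (1 + x a ^ 2) := by
      refine mul_le_mul_of_nonneg_right ?_ (by positivity)
      rw [hC]
      have h5 : 0 ≤ L * F * ((K + 3) + (n + 1) * (1 + M) ^ 2) := by positivity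
      linarith
    rw [hsum]
    change -(C * (1 + x a ^ 2)) + _ ≤ _
    linarith
  · refine (hs' a).trans ?_
    have h5 : 0 ≤ L * F * ((K + 3) + (2 + M ^ 2) + M + M ^ 2 + n * (1 + M) ^ 2) := by positivity
    rw [hC]
    linarith
  · refine (hP' a).trans ?_
    rw [hC]
    refine le_mul_of_one_le_right hLF.le ?_
    nlinarith [mul_nonneg hn (sq_nonneg (1 + M))]
  · rw [Fintype.sum_option]
    simp only [hs, hvdef, Option.elim_none, Option.elim_some, zero_mul, zero_add]
    refine (abs_sum_mul_le_card hv hs' hM.le).trans ?_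
    have h5 : 0 ≤ L * F * ((K + 3) + (2 + M ^ 2) + (1 + M) ^ 2 + n * (1 + M)) := by positivity
    rw [hC]
    change n * _ ≤ _
    linarith
  · rw [Fintype.sum_option]
    simp only [hP, hvdef, Option.elim_none, Option.elim_some, zero_mul, zero_add]
    refine (abs_sum_mul_le_card hP' hv hLF.le).trans ?_
    have h5 : 0 ≤ L * F * ((K + 3) + (2 + M ^ 2) + (1 + M) ^ 2 + n * (1 + M + M ^ 2)) := by
      positivity
    rw [hC]
    change n * _ ≤ _
    linarith

end PointwiseBound

section EuclideanHessian

open Filter Topology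

variable {n : ℕ} {u : EuclideanSpace ℝ (Fin n) → ℝ} {x : EuclideanSpace ℝ (Fin n)}

lemma esigma_natCast (k : ℕ) (lam : Fin n → ℝ) : esigma univ (k : ℤ) lam = es lam univ k := by
  simp [esigma, es]

lemma dirDeriv_dirDeriv_eq_dotProduct (hu : ContDiffAt ℝ 2 u x) (v w : EuclideanSpace ℝ (Fin n)) :
    dirDeriv (dirDeriv u v) w x = v.ofLp ⬝ᵥ (hessianMat u x).mulVec w.ofLp := by
  have hrep : ∀ z : EuclideanSpace ℝ (Fin n), z = ∑ k, z k • EuclideanSpace.single k (1 : ℝ) := by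
    intro z
    ext k
    simp [Finset.sum_apply, Pi.single_apply]
  rw [dirDeriv_dirDeriv hu]
  conv_lhs => rw [hrep v, hrep w]
  simp only [map_sum, map_smul, _root_.sum_apply, _root_.smul_apply,
    dotProduct, Matrix.mulVec, mul_sum, smul_eq_mul, hessianMat, Matrix.of_apply]
  refine sum_congr rfl fun k _ => sum_congr rfl fun l _ => ?_
  rw [iteratedFDeriv_two_eq_dirDeriv hu, dirDeriv_dirDeriv hu]
  ring

lemma hessianMat_apply (hu : ContDiffAt ℝ 2 u x) (i j : Fin n) :
    hessianMat u x i j = dirDeriv (dirDeriv u (EuclideanSpace.single i 1))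
      (EuclideanSpace.single j 1) x :=
  iteratedFDeriv_two_eq_dirDeriv hu _ _

lemma msig_dirDeriv_eq_es (hu : ContDiffAt ℝ 2 u x) (hH : (hessianMat u x).IsHermitian)
    (b : OrthonormalBasis (Fin n) ℝ (EuclideanSpace ℝ (Fin n))) (k : ℕ) :
    msig k (Matrix.of fun i j => dirDeriv (dirDeriv u (b i)) (b j) x)
      = es hH.eigenvalues univ k := by
  set P : Matrix (Fin n) (Fin n) ℝ := Matrix.of fun k i => b i k with hP
  have h1 : P.transpose * P = 1 := by
    ext i j
    have := orthonormal_iff_ite.1 b.orthonormal i j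
    rw [PiLp.inner_apply] at this
    simpa [hP, Matrix.mul_apply, Matrix.one_apply, mul_comm] using this
  have h2 : (Matrix.of fun i j => dirDeriv (dirDeriv u (b i)) (b j) x)
      = P.transpose * hessianMat u x * P := by
    ext i j
    rw [Matrix.of_apply, dirDeriv_dirDeriv_eq_dotProduct hu, Matrix.mul_assoc]
    simp [hP, Matrix.mul_apply, dotProduct, Matrix.mulVec]
  rw [h2, msig_conj (mul_eq_one_comm.1 h1), msig_eq_es_eigenvalues hH]

lemma dirDeriv_eigenvectorBasis (hu : ContDiffAt ℝ 2 u x) (hH : (hessianMat u x).IsHermitian)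
    (i j : Fin n) :
    dirDeriv (dirDeriv u (hH.eigenvectorBasis i)) (hH.eigenvectorBasis j) x
      = Matrix.diagonal hH.eigenvalues i j := by
  rw [dirDeriv_dirDeriv_eq_dotProduct hu, hH.mulVec_eigenvectorBasis]
  have := orthonormal_iff_ite.1 hH.eigenvectorBasis.orthonormal i j
  rw [PiLp.inner_apply] at this
  rw [dotProduct_smul, Matrix.diagonal_apply, smul_eq_mul]
  have h2 : (hH.eigenvectorBasis i).ofLp ⬝ᵥ (hH.eigenvectorBasis j).ofLp = if i = j then 1 else 0 := by
    simpa [dotProduct, mul_comm] using this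
  rw [h2]
  split_ifs with h <;> simp [h]

lemma inner_gradVec (v : EuclideanSpace ℝ (Fin n)) :
    inner ℝ v (gradVec u x) = dirDeriv u v x := by
  have hrep : v = ∑ k, v k • EuclideanSpace.single k (1 : ℝ) := by
    ext k
    simp [Finset.sum_apply, Pi.single_apply]
  conv_rhs => rw [hrep, dirDeriv]
  rw [PiLp.inner_apply]
  simp [gradVec, mul_comm]

lemma gradVec_eq_sum (b : OrthonormalBasis (Fin n) ℝ (EuclideanSpace ℝ (Fin n))) :
    gradVec u x = ∑ j, dirDeriv u (b j) x • b j := by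
  simp only [← inner_gradVec]
  exact (b.sum_repr' _).symm

lemma sum_sq_dirDeriv (b : OrthonormalBasis (Fin n) ℝ (EuclideanSpace ℝ (Fin n))) :
    ∑ j, dirDeriv u (b j) x ^ 2 = ‖gradVec u x‖ ^ 2 := by
  rw [gradVec_eq_sum b, norm_sq_sum_smul]

lemma abs_dirDeriv_le_norm_gradVec (b : OrthonormalBasis (Fin n) ℝ (EuclideanSpace ℝ (Fin n)))
    (j : Fin n) : |dirDeriv u (b j) x| ≤ ‖gradVec u x‖ := by
  rw [← inner_gradVec]
  simpa using abs_real_inner_le_norm (b j) (gradVec u x)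

/-- The trace of the Hessian is the first elementary symmetric function of its eigenvalues. -/
lemma sum_hessianMat_eq_es (hH : (hessianMat u x).IsHermitian) :
    ∑ i, hessianMat u x i i = es hH.eigenvalues univ 1 := by
  rw [es_one_eq_sum]
  simpa [Matrix.trace] using hH.trace_eq_sum_eigenvalues

/-- The quadratic form of the Hessian is bounded by its largest eigenvalue. -/
lemma dirDeriv_le_max_eigenvalue (hu : ContDiffAt ℝ 2 u x) (hH : (hessianMat u x).IsHermitian)
    {a : Fin n} (ha : ∀ p, hH.eigenvalues p ≤ hH.eigenvalues a) (ξ : EuclideanSpace ℝ (Fin n)) :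
    dirDeriv (dirDeriv u ξ) ξ x ≤ hH.eigenvalues a * ‖ξ‖ ^ 2 := by
  set b := hH.eigenvectorBasis
  set c : Fin n → ℝ := fun i => inner ℝ (b i) ξ
  have hξ : ξ = ∑ i, c i • b i := (b.sum_repr' ξ).symm
  have h1 : dirDeriv (dirDeriv u ξ) ξ x = ∑ i, c i ^ 2 * hH.eigenvalues i := by
    rw [dirDeriv_dirDeriv hu, hξ]
    simp only [map_sum, map_smul, _root_.sum_apply, _root_.smul_apply]
    have : ∀ i j, fderiv ℝ (fderiv ℝ u) x (b i) (b j) = Matrix.diagonal hH.eigenvalues j i :=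
      fun i j => by rw [← dirDeriv_eigenvectorBasis hu hH, dirDeriv_dirDeriv hu]
    simp [this, Matrix.diagonal_apply]
    exact sum_congr rfl fun i _ => by ring
  rw [h1, hξ, norm_sq_sum_smul, mul_sum]
  exact sum_le_sum fun i _ => by
    rw [mul_comm]; exact mul_le_mul_of_nonneg_right (ha i) (sq_nonneg _)

end EuclideanHessian

section GlobalMaximum

open Filter Topology

variable {E : Type*} [NormedAddCommGroup E]

/-- A function on `Ω × sphere` weighted by a positive power of a function vanishing on the boundary
attains its supremum as soon as it is positive somewhere. -/
lemma exists_max_of_weight [ProperSpace E] {Ω : Set E} (hΩ : IsOpen Ω)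
    (hb : Bornology.IsBounded Ω) {U : E → ℝ} (hU : ContinuousOn U (closure Ω))
    (hU0 : ∀ x ∈ frontier Ω, U x = 0) (hUpos : ∀ x ∈ Ω, 0 < U x) {Ψ : E × E → ℝ}
    (hΨ : ContinuousOn Ψ (Ω ×ˢ Set.univ)) {B : ℝ} (hB : 0 < B)
    (hΨB : ∀ x ∈ Ω, ∀ ξ : E, ‖ξ‖ = 1 → Ψ (x, ξ) ≤ B) {β : ℝ} (hβ : 1 ≤ β)
    {x₁ ξ₁ : E} (hx₁ : x₁ ∈ Ω) (hξ₁ : ‖ξ₁‖ = 1) (hpos : 0 < U x₁ ^ β * Ψ (x₁, ξ₁)) :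
    ∃ x₀ ∈ Ω, ∃ ξ₀ : E, ‖ξ₀‖ = 1 ∧ ∀ x ∈ Ω, ∀ ξ : E, ‖ξ‖ = 1 →
      U x ^ β * Ψ (x, ξ) ≤ U x₀ ^ β * Ψ (x₀, ξ₀) := by
  set A := U x₁ ^ β * Ψ (x₁, ξ₁) with hA
  set η : ℝ := min (min 1 (U x₁)) (A / B) with hη
  have hη0 : 0 < η := lt_min (lt_min one_pos (hUpos x₁ hx₁)) (div_pos hpos hB)
  set S : Set E := closure Ω ∩ U ⁻¹' Set.Ici η
  have hS : IsCompact S := by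
    refine hb.isCompact_closure.of_isClosed_subset ?_ Set.inter_subset_left
    exact hU.preimage_isClosed_of_isClosed isClosed_closure isClosed_Ici
  have hSΩ : S ⊆ Ω := by
    rintro x ⟨hx, hxη⟩
    by_contra hxΩ
    have h0 : U x = 0 := hU0 x (by rw [hΩ.frontier_eq]; exact ⟨hx, hxΩ⟩)
    have : η ≤ U x := hxη
    linarith
  have hcompact : IsCompact (S ×ˢ Metric.sphere (0 : E) 1) := hS.prod (isCompact_sphere 0 1)
  have hcont : ContinuousOn (fun p : E × E => U p.1 ^ β * Ψ p) (S ×ˢ Metric.sphere (0 : E) 1) := by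
    refine ContinuousOn.mul ?_ (hΨ.mono (Set.prod_mono hSΩ (Set.subset_univ _)))
    refine ContinuousOn.rpow_const ?_ fun p hp => Or.inl (hUpos p.1 (hSΩ hp.1)).ne'
    exact hU.comp continuousOn_fst fun p hp => hp.1.1
  have hmem : (x₁, ξ₁) ∈ S ×ˢ Metric.sphere (0 : E) 1 :=
    ⟨⟨subset_closure hx₁, show η ≤ U x₁ from (min_le_left _ _).trans (min_le_right _ _)⟩, by simpa using hξ₁⟩
  obtain ⟨⟨x₀, ξ₀⟩, ⟨hx₀, hξ₀⟩, hmax⟩ := hcompact.exists_isMaxOn ⟨_, hmem⟩ hcont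
  refine ⟨x₀, hSΩ hx₀, ξ₀, by simpa using hξ₀, fun x hx ξ hξ => ?_⟩
  by_cases hxη : η ≤ U x
  · exact hmax (show (x, ξ) ∈ S ×ˢ Metric.sphere (0 : E) 1 from
      ⟨⟨subset_closure hx, hxη⟩, by simpa using hξ⟩)
  · push Not at hxη
    refine le_trans ?_ (hmax hmem)
    have hUx := hUpos x hx
    have h1 : U x ^ β ≤ U x := by
      simpa using Real.rpow_le_rpow_of_exponent_ge hUx
        (hxη.le.trans ((min_le_left _ _).trans (min_le_left _ _))) hβ
    calc U x ^ β * Ψ (x, ξ) ≤ U x ^ β * B := by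
          gcongr
          exact hΨB x hx ξ hξ
      _ ≤ η * B := by
          gcongr
          exact h1.trans hxη.le
      _ ≤ A / B * B := by
          gcongr
          exact min_le_right _ _
      _ = A := div_mul_cancel₀ _ hB.ne'

variable [NormedSpace ℝ E]

lemma dirDeriv_nonpos_of_isLocalMax {u : E → ℝ} {x : E} (hu : ContDiffAt ℝ 2 u x)
    (hx : IsLocalMax u x) (v : E) : dirDeriv (dirDeriv u v) v x ≤ 0 := by
  refine (Jet2.of_isLocalMax (jet2_line hu v) ?_).2
  have : Tendsto (fun t : ℝ => x + t • v) (𝓝 0) (𝓝 x) := tendsto_line x v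
  have h2 := this.eventually hx
  simpa [IsLocalMax, IsMaxFilter] using h2

/-- Strong maximum principle for functions with positive Laplacian. -/
lemma neg_of_sum_dirDeriv_pos [ProperSpace E] {ι : Type*} [Fintype ι] (e : ι → E) {Ω : Set E}
    (hΩ : IsOpen Ω) (hb : Bornology.IsBounded Ω) {u : E → ℝ} (hc : ContinuousOn u (closure Ω))
    (hu : ∀ x ∈ Ω, ContDiffAt ℝ 2 u x) (h0 : ∀ x ∈ frontier Ω, u x = 0)
    (hpos : ∀ x ∈ Ω, 0 < ∑ i, dirDeriv (dirDeriv u (e i)) (e i) x) : ∀ x ∈ Ω, u x < 0 := by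
  have hno : ∀ z ∈ Ω, ¬ ∀ y ∈ closure Ω, u y ≤ u z := by
    intro z hz hmax
    have hloc : IsLocalMax u z := by
      filter_upwards [hΩ.mem_nhds hz] with y hy using hmax y (subset_closure hy)
    exact (hpos z hz).not_ge
      (sum_nonpos fun i _ => dirDeriv_nonpos_of_isLocalMax (hu z hz) hloc _)
  intro x hx
  by_contra! hux
  obtain ⟨y, hy, hmax⟩ := hb.isCompact_closure.exists_isMaxOn ⟨x, subset_closure hx⟩ hc
  by_cases hyΩ : y ∈ Ω
  · exact hno y hyΩ fun z hz => hmax hz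
  · have hy0 : u y = 0 := h0 y (by rw [hΩ.frontier_eq]; exact ⟨hy, hyΩ⟩)
    exact hno x hx fun z hz => (hmax hz).trans (hy0.le.trans hux)

/-- Second derivatives of a function of class `C²` up to the boundary are bounded. -/
lemma exists_bound_iteratedFDeriv_two [ProperSpace E] {Ω : Set E} (hΩ : IsOpen Ω)
    (hb : Bornology.IsBounded Ω) {u : E → ℝ} (hu : ContDiffOn ℝ 2 u (closure Ω)) :
    ∃ B : ℝ, 0 < B ∧ ∀ x ∈ Ω, ‖iteratedFDeriv ℝ 2 u x‖ ≤ B := by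
  suffices h : ∃ B : ℝ, ∀ x ∈ closure Ω ∩ Ω, ‖iteratedFDeriv ℝ 2 u x‖ ≤ B by
    obtain ⟨B, hB⟩ := h
    exact ⟨max B 1, by positivity, fun x hx =>
      (hB x ⟨subset_closure hx, hx⟩).trans (le_max_left _ _)⟩
  refine hb.isCompact_closure.induction_on
    (p := fun s => ∃ B : ℝ, ∀ x ∈ s ∩ Ω, ‖iteratedFDeriv ℝ 2 u x‖ ≤ B) ⟨0, by simp⟩ ?_ ?_ ?_
  · rintro s t hst ⟨B, hB⟩
    exact ⟨B, fun x hx => hB x ⟨hst hx.1, hx.2⟩⟩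
  · rintro s t ⟨B, hB⟩ ⟨B', hB'⟩
    refine ⟨max B B', fun x hx => ?_⟩
    rcases hx.1 with h | h
    · exact (hB x ⟨h, hx.2⟩).trans (le_max_left _ _)
    · exact (hB' x ⟨h, hx.2⟩).trans (le_max_right _ _)
  · intro z hz
    obtain ⟨v, hv, p, hp⟩ := (hu z hz) 2 le_rfl
    rw [Set.insert_eq_of_mem hz] at hv
    have hzv : z ∈ v := mem_of_mem_nhdsWithin hz hv
    have hcont : ContinuousWithinAt (fun y => p y 2) v z := hp.cont 2 le_rfl z hzv
    have hlt : ∀ᶠ y in 𝓝[v] z, ‖p y 2‖ < ‖p z 2‖ + 1 :=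
      hcont.norm.eventually (gt_mem_nhds (lt_add_one _))
    have hlt' : ∀ᶠ y in 𝓝[closure Ω] z, y ∈ v ∧ ‖p y 2‖ < ‖p z 2‖ + 1 := by
      filter_upwards [hv, nhdsWithin_le_of_mem hv hlt] with y h1 h2 using ⟨h1, h2⟩
    obtain ⟨o, ho, hzo, hsub⟩ := mem_nhdsWithin.1 hlt'
    refine ⟨o ∩ closure Ω, mem_nhdsWithin.2 ⟨o, ho, hzo, subset_rfl⟩, ‖p z 2‖ + 1, ?_⟩
    rintro y ⟨⟨hyo, hyc⟩, hyΩ⟩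
    have hopen : IsOpen (o ∩ Ω) := ho.inter hΩ
    have hp' : HasFTaylorSeriesUpToOn 2 u p (o ∩ Ω) :=
      hp.mono fun w hw => (hsub ⟨hw.1, subset_closure hw.2⟩).1
    have e := hp'.eq_iteratedFDerivWithin_of_uniqueDiffOn (m := 2) le_rfl hopen.uniqueDiffOn
      ⟨hyo, hyΩ⟩
    rw [iteratedFDerivWithin_of_isOpen 2 hopen ⟨hyo, hyΩ⟩] at e
    rw [← e]
    exact (hsub ⟨hyo, hyc⟩).2.le

end GlobalMaximum

section PogorelovEstimate

open Filter Topology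

/-- The weighted second derivatives are bounded by their value at an interior maximum point. -/
lemma exists_second_derivative_bound {n K : ℕ} {α G m M F : ℝ} (hα : 0 < α)
    (hm : 0 < m) (hM : 0 < M) (hF : 0 < F) :
    ∃ β : ℝ, 0 < β ∧ ∃ C : ℝ, 0 < C ∧
      ∀ (Ω : Set (EuclideanSpace ℝ (Fin n)))
        (φ : EuclideanSpace ℝ (Fin n) × ℝ × EuclideanSpace ℝ (Fin n) → ℝ)
        (u : EuclideanSpace ℝ (Fin n) → ℝ),
        IsOpen Ω → Bornology.IsBounded Ω → ContDiff ℝ 2 φ →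
        (∀ x ∈ Ω, ∀ s v, m ≤ φ (x, s, v)) →
        (∀ p, p.1 ∈ Ω → ∀ j : ℕ, j ≤ 2 → ‖iteratedFDeriv ℝ j φ p‖ ≤ F) →
        ContDiffOn ℝ 4 u Ω → ContDiffOn ℝ 2 u (closure Ω) →
        (∀ x ∈ frontier Ω, u x = 0) → (∀ x ∈ Ω, u x < 0) →
        ∀ hsym : ∀ x ∈ Ω, (hessianMat u x).IsHermitian,
        (∀ x (hx : x ∈ Ω), Gam (hsym x hx).eigenvalues univ (K + 2)) →
        (∀ x (hx : x ∈ Ω), es (hsym x hx).eigenvalues univ (K + 2)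
          + α * es (hsym x hx).eigenvalues univ (K + 3) = φ (x, u x, gradVec u x)) →
        (∀ x (hx : x ∈ Ω), -G ≤ es (hsym x hx).eigenvalues univ (K + 3)) →
        (∀ x ∈ Ω, |u x| ≤ M ∧ ‖gradVec u x‖ ≤ M) →
        ∀ x ∈ Ω, ∀ ξ, ‖ξ‖ = 1 → (-u x) ^ β * dirDeriv (dirDeriv u ξ) ξ x ≤ C := by
  obtain ⟨N, β, B, hN, hβ, hB, key⟩ := exists_bound_at_max (EuclideanSpace ℝ (Fin n)) (Fin n) K
    (L := 1 / α) (C₀ := F + α * G) (by positivity) hm hF hM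
  refine ⟨β, by linarith, M ^ (β - 1) * B * Real.exp (N / 2 * M ^ 2), by positivity, ?_⟩
  intro Ω φ u hΩ hb hφ hmφ hφF hu4 hu2 h0 hneg hsym hGam heq hlow hM1 x₁ hx₁ ξ₁ hξ₁
  rcases le_or_gt (dirDeriv (dirDeriv u ξ₁) ξ₁ x₁) 0 with hle | hgt
  · exact (mul_nonpos_of_nonneg_of_nonpos
      (Real.rpow_nonneg (by linarith [hneg x₁ hx₁]) _) hle).trans (by positivity)
  have hu : ∀ x ∈ Ω, ContDiffAt ℝ 4 u x := fun x hx => hu4.contDiffAt (hΩ.mem_nhds hx)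
  have hu' : ∀ x ∈ Ω, ContDiffAt ℝ 2 u x := fun x hx => (hu x hx).of_le (by norm_num)
  set Ψ : EuclideanSpace ℝ (Fin n) × EuclideanSpace ℝ (Fin n) → ℝ := fun p =>
    fderiv ℝ (fderiv ℝ u) p.1 p.2 p.2 * Real.exp (N / 2 * ‖gradVec u p.1‖ ^ 2) with hΨdef
  have hΨV : ∀ x ∈ Ω, ∀ ξ, Ψ (x, ξ) = dirDeriv (dirDeriv u ξ) ξ x
      * Real.exp (N / 2 * ‖gradVec u x‖ ^ 2) := fun x hx ξ => by
    rw [dirDeriv_dirDeriv (hu' x hx)]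
  have hΨ : ContinuousOn Ψ (Ω ×ˢ Set.univ) := by
    have hcD : ContinuousOn (fderiv ℝ (fderiv ℝ u)) Ω := fun x hx => by
      have h3 : ContDiffAt ℝ 3 (fderiv ℝ u) x := (hu x hx).fderiv_right (by norm_num)
      have h4 : ContDiffAt ℝ 2 (fderiv ℝ (fderiv ℝ u)) x := h3.fderiv_right (by norm_num)
      exact h4.continuousAt.continuousWithinAt
    have hcg : ContinuousOn (fun x => ‖gradVec u x‖ ^ 2) Ω := by
      simp only [← sum_sq_dirDeriv (EuclideanSpace.basisFun (Fin n) ℝ)]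
      refine continuousOn_finsetSum _ fun j _ => ContinuousOn.pow (fun x hx => ?_) 2
      exact (ContDiffAt.dirDeriv (m := 3) (hu x hx) _).continuousAt.continuousWithinAt
    have hfst : Set.MapsTo Prod.fst (Ω ×ˢ (Set.univ : Set (EuclideanSpace ℝ (Fin n)))) Ω :=
      fun p hp => hp.1
    have h1 := (hcD.comp continuousOn_fst hfst)
    have h2 := (hcg.comp continuousOn_fst hfst)
    refine ContinuousOn.mul ?_ (Real.continuous_exp.comp_continuousOn (continuousOn_const.mul h2))
    exact (h1.clm_apply continuousOn_snd).clm_apply continuousOn_snd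
  obtain ⟨B₂, hB₂, hbound⟩ := exists_bound_iteratedFDeriv_two hΩ hb hu2
  have hexp : ∀ x ∈ Ω, Real.exp (N / 2 * ‖gradVec u x‖ ^ 2) ≤ Real.exp (N / 2 * M ^ 2) := by
    intro x hx
    have := (hM1 x hx).2
    gcongr
  have hΨB : ∀ x ∈ Ω, ∀ ξ, ‖ξ‖ = 1 → Ψ (x, ξ) ≤ B₂ * Real.exp (N / 2 * M ^ 2) := by
    intro x hx ξ hξ
    rw [hΨV x hx, ← iteratedFDeriv_two_eq_dirDeriv (hu' x hx)]
    have h1 := (iteratedFDeriv ℝ 2 u x).le_opNorm ![ξ, ξ]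
    simp only [Fin.prod_univ_two, Matrix.cons_val_zero, Matrix.cons_val_one, hξ, mul_one] at h1
    have h2 : iteratedFDeriv ℝ 2 u x ![ξ, ξ] ≤ B₂ :=
      (le_abs_self _).trans (h1.trans (hbound x hx))
    exact mul_le_mul h2 (hexp x hx) (Real.exp_pos _).le hB₂.le
  have hUpos : ∀ x ∈ Ω, 0 < -u x := fun x hx => by linarith [hneg x hx]
  have hpos : 0 < (-u x₁) ^ β * Ψ (x₁, ξ₁) := by
    rw [hΨV x₁ hx₁]
    have := hUpos x₁ hx₁
    positivity
  obtain ⟨x₀, hx₀, ξ₀, hξ₀, hmax⟩ := exists_max_of_weight (U := fun x => -u x) hΩ hb hu2.continuousOn.fun_neg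
    (fun x hx => by simp [h0 x hx]) hUpos hΨ (by positivity) hΨB hβ hx₁ hξ₁ hpos
  set lam := (hsym x₀ hx₀).eigenvalues with hlam
  set b := (hsym x₀ hx₀).eigenvectorBasis with hbdef
  have hne : Nonempty (Fin n) := by
    by_contra hcon
    rw [not_nonempty_iff] at hcon
    have := hGam x₀ hx₀ 1 (by omega)
    rw [es_one_eq_sum] at this
    simp at this
  obtain ⟨a, ha⟩ := Finite.exists_max lam
  have hU₀ := hUpos x₀ hx₀
  have hΨa : ∀ x ∈ Ω, ∀ ξ, ‖ξ‖ = 1 → (-u x) ^ β * Ψ (x, ξ)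
      ≤ (-u x₀) ^ β * lam a * Real.exp (N / 2 * ‖gradVec u x₀‖ ^ 2) := by
    intro x hx ξ hξ
    refine (hmax x hx ξ hξ).trans ?_
    rw [hΨV x₀ hx₀, ← mul_assoc]
    have := dirDeriv_le_max_eigenvalue (hu' x₀ hx₀) (hsym x₀ hx₀) ha ξ₀
    rw [hξ₀, one_pow, mul_one] at this
    gcongr
  have hp₀ : ∑ j, dirDeriv u (b j) x₀ • b j = gradVec u x₀ := (gradVec_eq_sum b).symm
  have hbd := fun j hj => hφF (x₀, u x₀, gradVec u x₀) hx₀ j hj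
  have hfinal : -u x₀ * lam a ≤ B := by
    refine key u x₀ b lam a φ (hu x₀ hx₀) (dirDeriv_eigenvectorBasis (hu' x₀ hx₀) _) hφ ?_
      (hGam x₀ hx₀) ?_ ?_ ?_ ?_ ?_ ha (hneg x₀ hx₀) ?_ ?_ ?_
    · filter_upwards [hΩ.mem_nhds hx₀] with y hy
      rw [msig_augment, msig_dirDeriv_eq_es (hu' y hy) (hsym y hy),
        msig_dirDeriv_eq_es (hu' y hy) (hsym y hy), ← gradVec_eq_sum, ← heq y hy]
      field_simp
      ring
    · have h1 := heq x₀ hx₀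
      have h2 := hlow x₀ hx₀
      have h3 := hbd 0 (by norm_num)
      rw [norm_iteratedFDeriv_zero, Real.norm_eq_abs] at h3
      have h4 := le_abs_self (φ (x₀, u x₀, gradVec u x₀))
      have h5 := mul_le_mul_of_nonneg_left h2 hα.le
      linarith
    · exact hmφ x₀ hx₀ _ _
    · have h3 := hbd 0 (by norm_num)
      rw [norm_iteratedFDeriv_zero] at h3
      rw [hp₀]
      exact (le_abs_self _).trans h3
    · have h3 := hbd 1 (by norm_num)
      rw [norm_iteratedFDeriv_one] at h3
      rwa [hp₀]
    · intro z
      have h3 := (iteratedFDeriv ℝ 2 φ (x₀, u x₀, gradVec u x₀)).le_of_opNorm_le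
        (hbd 2 le_rfl) ![z, z]
      rw [iteratedFDeriv_two_apply] at h3
      simpa [hp₀, Fin.prod_univ_two, sq] using h3
    · exact (neg_le_abs _).trans (hM1 x₀ hx₀).1
    · exact fun i => (abs_dirDeriv_le_norm_gradVec b i).trans (hM1 x₀ hx₀).2
    · simp only [sum_sq_dirDeriv]
      filter_upwards [hΩ.mem_nhds hx₀] with y hy ξ
      rcases eq_or_ne ξ 0 with rfl | hξ
      · simp [dirDeriv_dirDeriv (hu' y hy)]
      · have hn : 0 < ‖ξ‖ := norm_pos_iff.2 hξ
        have h1 := hΨa y hy (‖ξ‖⁻¹ • ξ) (by rw [norm_smul, norm_inv, norm_norm]; field_simp)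
        rw [hΨdef] at h1
        simp only [map_smul, _root_.smul_apply, smul_eq_mul] at h1
        rw [dirDeriv_dirDeriv (hu' y hy)]
        have h2 := mul_le_mul_of_nonneg_right h1 (sq_nonneg ‖ξ‖)
        refine le_of_eq_of_le ?_ h2
        field_simp
  have hU₁ := hUpos x₁ hx₁
  have hMU : -u x₀ ≤ M := (neg_le_abs _).trans (hM1 x₀ hx₀).1
  calc (-u x₁) ^ β * dirDeriv (dirDeriv u ξ₁) ξ₁ x₁
      ≤ (-u x₁) ^ β * Ψ (x₁, ξ₁) := by
        rw [hΨV x₁ hx₁]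
        gcongr
        exact le_mul_of_one_le_right hgt.le (Real.one_le_exp (by positivity))
    _ ≤ (-u x₀) ^ β * lam a * Real.exp (N / 2 * ‖gradVec u x₀‖ ^ 2) := hΨa x₁ hx₁ ξ₁ hξ₁
    _ = (-u x₀) ^ (β - 1) * (-u x₀ * lam a) * Real.exp (N / 2 * ‖gradVec u x₀‖ ^ 2) := by
        rw [Real.rpow_sub_one hU₀.ne', ← mul_assoc, div_mul_cancel₀ _ hU₀.ne']
    _ ≤ (-u x₀) ^ (β - 1) * B * Real.exp (N / 2 * ‖gradVec u x₀‖ ^ 2) := by gcongr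
    _ ≤ M ^ (β - 1) * B * Real.exp (N / 2 * M ^ 2) := by
        have h1 : (-u x₀) ^ (β - 1) ≤ M ^ (β - 1) :=
          Real.rpow_le_rpow hU₀.le hMU (by linarith)
        have h2 := hexp x₀ hx₀
        gcongr

end PogorelovEstimate

/-- Theorem 1.1: Pogorelov type `C²` estimate `(-u)^β Δu ≤ C` for admissible
(`(k-1)`-convex) solutions of the sum Hessian equation
`σ_{k-1}(D²u) + α σ_k(D²u) = f(x,u,Du)` in `Ω`, `u = 0` on `∂Ω`,
assuming `σ_k(D²u) ≥ -G`. -/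
theorem pogorelov_estimate_sum_hessian (n k : ℕ) (hn : 2 ≤ n) (hk2 : 2 ≤ k)
    (hkn : k ≤ n) (α G m M F D : ℝ) (hα : 0 < α) (hG : 0 ≤ G) (hm : 0 < m)
    (hM : 0 < M) (hF : 0 < F) (hD : 0 < D) :
    ∃ β : ℝ, 0 < β ∧ ∃ C : ℝ, 0 < C ∧
      ∀ (Ω : Set (EuclideanSpace ℝ (Fin n)))
        (f : EuclideanSpace ℝ (Fin n) → ℝ → EuclideanSpace ℝ (Fin n) → ℝ)
        (u : EuclideanSpace ℝ (Fin n) → ℝ),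
        IsOpen Ω → IsConnected Ω → Bornology.IsBounded Ω → Metric.diam Ω ≤ D →
        ContDiff ℝ 2 (fun p : EuclideanSpace ℝ (Fin n) × ℝ × EuclideanSpace ℝ (Fin n) =>
          f p.1 p.2.1 p.2.2) →
        (∀ x ∈ closure Ω, ∀ (s : ℝ) (v : EuclideanSpace ℝ (Fin n)), m ≤ f x s v) →
        (∀ p : EuclideanSpace ℝ (Fin n) × ℝ × EuclideanSpace ℝ (Fin n),
          p.1 ∈ closure Ω → ∀ j : ℕ, j ≤ 2 →
            ‖iteratedFDeriv ℝ j
              (fun q : EuclideanSpace ℝ (Fin n) × ℝ × EuclideanSpace ℝ (Fin n) =>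
                f q.1 q.2.1 q.2.2) p‖ ≤ F) →
        ContDiffOn ℝ 4 u Ω → ContDiffOn ℝ 2 u (closure Ω) →
        (∀ x ∈ frontier Ω, u x = 0) →
        ∀ hsym : ∀ x ∈ Ω, (hessianMat u x).IsHermitian,
        (∀ x (hx : x ∈ Ω), (hsym x hx).eigenvalues ∈ GammaTilde n k α) →
        (∀ x (hx : x ∈ Ω),
          Ssum α Finset.univ (k : ℤ) ((hsym x hx).eigenvalues) = f x (u x) (gradVec u x)) →
        (∀ x (hx : x ∈ Ω), -G ≤ esigma Finset.univ (k : ℤ) ((hsym x hx).eigenvalues)) →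
        (∀ x ∈ closure Ω, |u x| ≤ M ∧ ‖gradVec u x‖ ≤ M) →
        ∀ x ∈ Ω, (-u x) ^ β * (∑ i : Fin n, hessianMat u x i i) ≤ C := by
  have hSsum : ∀ (l : ℕ) (lam : Fin n → ℝ), Ssum α univ ((l + 1 : ℕ) : ℤ) lam
      = es lam univ l + α * es lam univ (l + 1) := by
    intro l lam
    have hl : ((l + 1 : ℕ) : ℤ) - 1 = (l : ℤ) := by push_cast; ring
    rw [Ssum, hl, esigma_natCast, esigma_natCast]
  have hGam : ∀ (l : ℕ) (lam : Fin n → ℝ), lam ∈ GammaTilde n (l + 1) α → Gam lam univ l := by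
    intro l lam h j hj
    rcases Nat.eq_zero_or_pos j with rfl | hj0
    · rw [es_zero]; exact one_pos
    · rw [← esigma_natCast]
      exact h.1 j hj0 hj
  have hneg : ∀ (l : ℕ), k = l + 2 → ∀ (Ω : Set (EuclideanSpace ℝ (Fin n)))
      (u : EuclideanSpace ℝ (Fin n) → ℝ), IsOpen Ω → Bornology.IsBounded Ω →
      ContDiffOn ℝ 4 u Ω → ContDiffOn ℝ 2 u (closure Ω) → (∀ x ∈ frontier Ω, u x = 0) →
      ∀ hsym : ∀ x ∈ Ω, (hessianMat u x).IsHermitian,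
      (∀ x (hx : x ∈ Ω), (hsym x hx).eigenvalues ∈ GammaTilde n k α) → ∀ x ∈ Ω, u x < 0 := by
    intro l hl Ω u hΩ hb hu4 hu2 h0 hsym hadm
    have hu : ∀ x ∈ Ω, ContDiffAt ℝ 2 u x := fun x hx =>
      (hu4.contDiffAt (hΩ.mem_nhds hx)).of_le (by norm_num)
    refine neg_of_sum_dirDeriv_pos (fun i : Fin n => EuclideanSpace.single i (1 : ℝ)) hΩ hb
      hu2.continuousOn hu h0 fun x hx => ?_
    simp only [← hessianMat_apply (hu x hx)]
    rw [sum_hessianMat_eq_es (hsym x hx)]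
    exact hGam (l + 1) _ (hl ▸ hadm x hx) 1 (by omega)
  obtain rfl | hk3 := hk2.eq_or_lt
  · refine ⟨1, one_pos, M * (F + α * G), by positivity, ?_⟩
    intro Ω f u hΩ _ hb _ _ _ hfF hu4 hu2 h0 hsym hadm heq hlow hM1 x hx
    have hux := hneg 0 rfl Ω u hΩ hb hu4 hu2 h0 hsym hadm x hx
    have h1 := heq x hx
    rw [hSsum 1, ← sum_hessianMat_eq_es] at h1
    have h2 := hlow x hx
    rw [esigma_natCast] at h2
    have h3 := hfF (x, u x, gradVec u x) (subset_closure hx) 0 (by norm_num)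
    rw [norm_iteratedFDeriv_zero] at h3
    have h4 := (le_abs_self _).trans h3
    have h5 := mul_le_mul_of_nonneg_left h2 hα.le
    rw [Real.rpow_one]
    have h6 : -u x ≤ M := (neg_le_abs _).trans (hM1 x (subset_closure hx)).1
    calc -u x * ∑ i, hessianMat u x i i ≤ -u x * (F + α * G) := by
          refine mul_le_mul_of_nonneg_left ?_ (by linarith)
          simp only [Nat.reduceAdd] at h1
          linarith
      _ ≤ M * (F + α * G) := by gcongr
  · obtain ⟨K, rfl⟩ : ∃ K, k = K + 3 := ⟨k - 3, by omega⟩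
    obtain ⟨β, hβ, C, hC, key⟩ := exists_second_derivative_bound (n := n) (K := K) (G := G) hα hm hM hF
    refine ⟨β, hβ, n * C, by positivity, ?_⟩
    intro Ω f u hΩ _ hb _ hf hmf hfF hu4 hu2 h0 hsym hadm heq hlow hM1 x hx
    have hle := key Ω (fun p => f p.1 p.2.1 p.2.2) u hΩ hb hf
      (fun y hy => hmf y (subset_closure hy)) (fun p hp => hfF p (subset_closure hp)) hu4 hu2 h0
      (hneg (K + 1) rfl Ω u hΩ hb hu4 hu2 h0 hsym hadm) hsym
      (fun y hy => hGam (K + 2) _ (hadm y hy))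
      (fun y hy => by rw [← heq y hy, hSsum (K + 2)])
      (fun y hy => by rw [← esigma_natCast]; exact hlow y hy)
      (fun y hy => hM1 y (subset_closure hy)) x hx
    have hux : ContDiffAt ℝ 2 u x := (hu4.contDiffAt (hΩ.mem_nhds hx)).of_le (by norm_num)
    rw [mul_sum]
    refine (sum_le_card_nsmul _ _ C fun i _ => ?_).trans (by simp)
    rw [hessianMat_apply hux]
    exact hle _ (by simp)
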